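/- arXiv:2001.10986 — 2 statements merged into one kernel-verified Lean document; each statement's English description precedes it below -/
import Mathlib

section
/- (Linear convergence, three cells) For the domain decomposition iterates (π^ℓ) with the three-cell partition, one has for every ℓ > 1: Δ(π^ℓ) ≤ (1 + exp(−2‖c‖_∞/ε)·μ(X₂)/μ(X₁∪X₃))⁻¹ · Δ(π^{ℓ−1}). In particular Δ(π^ℓ) → 0 and π^ℓ converges (weakly-*) to the unique minimizer π* of KL(·|K) over Π(μ,ν). -/
open MeasureTheory ENNReal Filter Topology

noncomputable section

/-- `phi s = s * log s - s + 1` (note `phi 0 = 1` since `Real.log 0 = 0`);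
this is the integrand of the Kullback--Leibler divergence. -/
def phi (s : ℝ) : ℝ := s * Real.log s - s + 1

open Classical in
/-- Kullback--Leibler divergence `KL(ρ|σ) ∈ [0,∞]`: `∫ phi (dρ/dσ) dσ` if `ρ ≪ σ`,
and `∞` otherwise (nonnegativity of `ρ` is automatic for measures). -/
def KL {Z : Type*} [MeasurableSpace Z] (ρ σ : Measure Z) : ℝ≥0∞ :=
  if ρ ≪ σ then ∫⁻ z, ENNReal.ofReal (phi ((ρ.rnDeriv σ) z).toReal) ∂σ else ⊤

/-- The set `Π(μh, νh)` of transport plans with marginals `μh` and `νh`. -/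
def Coupling {X Y : Type*} [MeasurableSpace X] [MeasurableSpace Y]
    (μh : Measure X) (νh : Measure Y) : Set (Measure (X × Y)) :=
  {π | π.map Prod.fst = μh ∧ π.map Prod.snd = νh}

/-- The Gibbs kernel measure `K = exp(-c/ε) ⋅ (μ ⊗ ν)`. -/
def Kmeas {X Y : Type*} [MeasurableSpace X] [MeasurableSpace Y]
    (μ : Measure X) (ν : Measure Y) [SFinite ν] (c : X × Y → ℝ) (ε : ℝ) : Measure (X × Y) :=
  (μ.prod ν).withDensity fun p => ENNReal.ofReal (Real.exp (-c p / ε))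

/-- The product density `(u ⊗ v)(x,y) = u x * v y`, as an `ℝ≥0∞`-valued density. -/
def prodDensity {X Y : Type*} (u : X → ℝ) (v : Y → ℝ) : X × Y → ℝ≥0∞ :=
  fun p => ENNReal.ofReal (u p.1 * v p.2)

/-- `L^∞₊(μ)`: measurable, a.e. nonnegative, essentially bounded functions. -/
def LinftyPlus {Z : Type*} [MeasurableSpace Z] (μ : Measure Z) (u : Z → ℝ) : Prop :=
  Measurable u ∧ (∀ᵐ z ∂μ, 0 ≤ u z) ∧ ∃ C : ℝ, ∀ᵐ z ∂μ, u z ≤ C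

/-- `πJ` is the (entropic) optimal plan for the cell problem
`min { KL(⋅|K) : plan ∈ Π(μJ, νJ) }`. -/
def IsOptPlan {X Y : Type*} [MeasurableSpace X] [MeasurableSpace Y]
    (K : Measure (X × Y)) (μJ : Measure X) (νJ : Measure Y) (πJ : Measure (X × Y)) : Prop :=
  πJ ∈ Coupling μJ νJ ∧ ∀ π' ∈ Coupling μJ νJ, KL πJ K ≤ KL π' K

lemma phi_eq_klFun (s : ℝ) : phi s = InformationTheory.klFun s := by
  rw [phi, InformationTheory.klFun_apply]; ring

lemma phi_nonneg {s : ℝ} (hs : 0 ≤ s) : 0 ≤ phi s := by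
  rw [phi_eq_klFun]; exact InformationTheory.klFun_nonneg hs

lemma phi_one : phi 1 = 0 := by simp [phi]

lemma convexOn_phi : ConvexOn ℝ (Set.Ici 0) phi := by
  have : phi = InformationTheory.klFun := funext phi_eq_klFun
  rw [this]; exact InformationTheory.convexOn_klFun

lemma measurable_phi : Measurable phi := by
  have : phi = InformationTheory.klFun := funext phi_eq_klFun
  rw [this]; exact InformationTheory.measurable_klFun

lemma sq_sqrt_sub_one_le_phi {a : ℝ} (ha : 0 ≤ a) : (√a - 1) ^ 2 ≤ phi a := by
  rcases ha.eq_or_lt with rfl | ha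
  · simp [phi]
  · have hs : 0 < √a := Real.sqrt_pos.2 ha
    have h1 : 1 - (√a)⁻¹ ≤ Real.log √a := Real.one_sub_inv_le_log_of_pos hs
    have h2 : Real.log a = 2 * Real.log √a := by
      rw [Real.log_sqrt ha.le]; ring
    have h3 : √a * √a = a := Real.mul_self_sqrt ha.le
    have h4 : a * (1 - (√a)⁻¹) = a - √a := by
      field_simp; nlinarith
    rw [phi, h2]
    nlinarith [mul_le_mul_of_nonneg_left h1 ha.le]

/-- Quantitative strict convexity of `phi` at midpoints. -/
lemma abs_sub_le_phi_midpoint {s t lam : ℝ} (hs : 0 ≤ s) (ht : 0 ≤ t) (hl : 0 < lam) :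
    |s - t| ≤ lam * (s + t) + lam⁻¹ * (phi s + phi t - 2 * phi ((s + t) / 2)) := by
  have key : (√s - √t) ^ 2 / 2 ≤ phi s + phi t - 2 * phi ((s + t) / 2) := by
    set m := (s + t) / 2 with hm
    rcases (by positivity : 0 ≤ m).eq_or_lt with h0 | h0
    · have h1 : s = 0 := by linarith
      have h2 : t = 0 := by linarith
      simp [h1, h2, hm, phi]
      norm_num
    · have aux : ∀ a, 0 ≤ a → (√a - √m) ^ 2 ≤ a * Real.log a - a * Real.log m - a + m := by
        intro a ha
        have h := sq_sqrt_sub_one_le_phi (div_nonneg ha h0.le)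
        have hm1 : √m * √m = m := Real.mul_self_sqrt h0.le
        have hsm : 0 < √m := Real.sqrt_pos.2 h0
        have e1 : m * (√(a / m) - 1) ^ 2 = (√a - √m) ^ 2 := by
          rw [Real.sqrt_div ha]
          field_simp
          rw [Real.sq_sqrt h0.le]
        have e2 : m * phi (a / m) = a * Real.log a - a * Real.log m - a + m := by
          rcases ha.eq_or_lt with rfl | ha
          · simp [phi]
          · rw [phi, Real.log_div ha.ne' h0.ne']; field_simp
        rw [← e1, ← e2]
        exact mul_le_mul_of_nonneg_left h h0.le
      have h1 := aux s hs
      have h2 := aux t ht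
      have h3 : phi s + phi t - 2 * phi m
          = (s * Real.log s - s * Real.log m - s + m)
            + (t * Real.log t - t * Real.log m - t + m) := by
        have : s + t = 2 * m := by rw [hm]; ring
        simp only [phi]
        linear_combination (Real.log m) * this
      rw [h3]
      nlinarith [sq_nonneg (√s - √m + (√t - √m))]
  have hs2 := Real.mul_self_sqrt hs
  have ht2 := Real.mul_self_sqrt ht
  have hfac : s - t = (√s - √t) * (√s + √t) := by nlinarith
  have hsum : (√s + √t) ^ 2 ≤ 2 * (s + t) := by nlinarith [sq_nonneg (√s - √t)]
  have h5 : |s - t| ≤ lam * (√s + √t) ^ 2 / 2 + lam⁻¹ * ((√s - √t) ^ 2 / 2) := by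
    rw [hfac, abs_mul, abs_of_nonneg (by positivity : 0 ≤ √s + √t)]
    have h6 : 0 ≤ (lam * (√s + √t) - |√s - √t|) ^ 2 := sq_nonneg _
    rw [← sq_abs (√s - √t)]
    have h7 : lam * (√s + √t) ^ 2 / 2 + lam⁻¹ * (|√s - √t| ^ 2 / 2) - |√s - √t| * (√s + √t)
        = lam⁻¹ / 2 * (lam * (√s + √t) - |√s - √t|) ^ 2 := by
      field_simp
      ring
    have : 0 ≤ lam⁻¹ / 2 * (lam * (√s + √t) - |√s - √t|) ^ 2 := by positivity
    linarith
  have h8 : lam⁻¹ * ((√s - √t) ^ 2 / 2) ≤ lam⁻¹ * (phi s + phi t - 2 * phi ((s + t) / 2)) :=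
    mul_le_mul_of_nonneg_left key (by positivity)
  nlinarith

/-- The measure with nonnegative real density `s` with respect to `K`. -/
def densMeas {Z : Type*} [MeasurableSpace Z] (K : Measure Z) (s : Z → ℝ) : Measure Z :=
  K.withDensity fun z => ENNReal.ofReal (s z)

section Densities

variable {Z : Type*} [MeasurableSpace Z] {K ρ : Measure Z} {s t : Z → ℝ}

lemma KL_densMeas [SigmaFinite K] (hs : Measurable s) (hs0 : ∀ z, 0 ≤ s z) :
    KL (densMeas K s) K = ∫⁻ z, ENNReal.ofReal (phi (s z)) ∂K := by
  have hac : densMeas K s ≪ K := withDensity_absolutelyContinuous _ _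
  rw [KL, if_pos hac]
  refine lintegral_congr_ae ?_
  filter_upwards [Measure.rnDeriv_withDensity K hs.ennreal_ofReal] with z hz
  rw [densMeas, hz, ENNReal.toReal_ofReal (hs0 z)]

lemma exists_densMeas_eq [IsFiniteMeasure ρ] [SigmaFinite K] (h : ρ ≪ K) :
    ∃ s : Z → ℝ, Measurable s ∧ (∀ z, 0 ≤ s z) ∧ ρ = densMeas K s := by
  refine ⟨fun z => (ρ.rnDeriv K z).toReal, (Measure.measurable_rnDeriv _ _).ennreal_toReal,
    fun z => ENNReal.toReal_nonneg, ?_⟩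
  rw [densMeas, ← Measure.withDensity_rnDeriv_eq ρ K h]
  refine withDensity_congr_ae ?_
  filter_upwards [Measure.rnDeriv_lt_top ρ K] with z hz
  rw [Measure.withDensity_rnDeriv_eq ρ K h, ENNReal.ofReal_toReal hz.ne]

lemma KL_ne_top_ac (h : KL ρ K ≠ ⊤) : ρ ≪ K := by
  by_contra h'
  exact h (if_neg h')

lemma integrable_of_densMeas_univ (hs : Measurable s) (hs0 : ∀ z, 0 ≤ s z)
    (h : densMeas K s Set.univ ≠ ⊤) : Integrable s K := by
  refine (lintegral_ofReal_ne_top_iff_integrable hs.aestronglyMeasurable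
    (ae_of_all _ hs0)).1 ?_
  rwa [densMeas, withDensity_apply _ MeasurableSet.univ, setLIntegral_univ] at h

lemma KL_densMeas_ne_top_iff [SigmaFinite K] (hs : Measurable s) (hs0 : ∀ z, 0 ≤ s z) :
    KL (densMeas K s) K ≠ ⊤ ↔ Integrable (fun z => phi (s z)) K := by
  rw [KL_densMeas hs hs0]
  exact lintegral_ofReal_ne_top_iff_integrable (measurable_phi.comp hs).aestronglyMeasurable
    (ae_of_all _ fun z => phi_nonneg (hs0 z))

lemma KL_densMeas_eq_ofReal [SigmaFinite K] (hs : Measurable s) (hs0 : ∀ z, 0 ≤ s z)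
    (h : Integrable (fun z => phi (s z)) K) :
    KL (densMeas K s) K = ENNReal.ofReal (∫ z, phi (s z) ∂K) := by
  rw [KL_densMeas hs hs0, ofReal_integral_eq_lintegral_ofReal h
    (ae_of_all _ fun z => phi_nonneg (hs0 z))]

lemma integrable_phi_midpoint (hs : Measurable s) (hs0 : ∀ z, 0 ≤ s z)
    (ht : Measurable t) (ht0 : ∀ z, 0 ≤ t z)
    (hsφ : Integrable (fun z => phi (s z)) K) (htφ : Integrable (fun z => phi (t z)) K) :
    Integrable (fun z => phi ((s z + t z) / 2)) K := by
  refine (hsφ.add htφ).mono' (measurable_phi.comp (by fun_prop)).aestronglyMeasurable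
    (ae_of_all _ fun z => ?_)
  have h0 : 0 ≤ (s z + t z) / 2 := by have := hs0 z; have := ht0 z; positivity
  rw [Real.norm_of_nonneg (phi_nonneg h0), Pi.add_apply]
  have := convexOn_phi.2 (hs0 z) (ht0 z) (by norm_num : (0 : ℝ) ≤ 1 / 2)
    (by norm_num : (0 : ℝ) ≤ 1 / 2) (by norm_num)
  simp only [smul_eq_mul] at this
  rw [show (s z + t z) / 2 = 1 / 2 * s z + 1 / 2 * t z by ring]
  have := phi_nonneg (hs0 z)
  have := phi_nonneg (ht0 z)
  linarith

lemma integral_abs_sub_le_phi_midpoint (hs : Measurable s) (hs0 : ∀ z, 0 ≤ s z)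
    (ht : Measurable t) (ht0 : ∀ z, 0 ≤ t z) (hsi : Integrable s K) (hti : Integrable t K)
    (hsφ : Integrable (fun z => phi (s z)) K) (htφ : Integrable (fun z => phi (t z)) K)
    {lam : ℝ} (hl : 0 < lam) :
    ∫ z, |s z - t z| ∂K ≤ lam * (∫ z, s z ∂K + ∫ z, t z ∂K) +
      lam⁻¹ * (∫ z, phi (s z) ∂K + ∫ z, phi (t z) ∂K
        - 2 * ∫ z, phi ((s z + t z) / 2) ∂K) := by
  have hm := integrable_phi_midpoint hs hs0 ht ht0 hsφ htφ
  have h1 : Integrable (fun z => lam * (s z + t z)) K := (hsi.add hti).const_mul lam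
  have h2 : Integrable (fun z => phi (s z) + phi (t z)) K := hsφ.add htφ
  have h3 : Integrable
      (fun z => lam⁻¹ * (phi (s z) + phi (t z) - 2 * phi ((s z + t z) / 2))) K :=
    (h2.sub (hm.const_mul 2)).const_mul lam⁻¹
  calc ∫ z, |s z - t z| ∂K
      ≤ ∫ z, (lam * (s z + t z)
          + lam⁻¹ * (phi (s z) + phi (t z) - 2 * phi ((s z + t z) / 2))) ∂K :=
        integral_mono (hsi.sub hti).abs (h1.add h3) fun z =>
          abs_sub_le_phi_midpoint (hs0 z) (ht0 z) hl
    _ = _ := by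
        rw [integral_add h1 h3, integral_const_mul, integral_add hsi hti, integral_const_mul,
          integral_sub h2 (hm.const_mul 2), integral_add hsφ htφ, integral_const_mul]

/-- Equality in midpoint convexity forces the densities to agree. -/
lemma ae_eq_of_phi_midpoint (hs : Measurable s) (hs0 : ∀ z, 0 ≤ s z)
    (ht : Measurable t) (ht0 : ∀ z, 0 ≤ t z) (hsi : Integrable s K) (hti : Integrable t K)
    (hsφ : Integrable (fun z => phi (s z)) K) (htφ : Integrable (fun z => phi (t z)) K)
    (h : ∫ z, phi (s z) ∂K + ∫ z, phi (t z) ∂K ≤ 2 * ∫ z, phi ((s z + t z) / 2) ∂K) :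
    s =ᵐ[K] t := by
  have h0 : ∫ z, |s z - t z| ∂K ≤ 0 := by
    refine le_of_forall_pos_le_add fun e he => ?_
    set A := ∫ z, s z ∂K + ∫ z, t z ∂K
    have hA : 0 ≤ A := add_nonneg (integral_nonneg hs0) (integral_nonneg ht0)
    have hl : 0 < e / (A + 1) := by positivity
    have := integral_abs_sub_le_phi_midpoint hs hs0 ht ht0 hsi hti hsφ htφ hl
    have h2 : (e / (A + 1))⁻¹ * (∫ z, phi (s z) ∂K + ∫ z, phi (t z) ∂K
        - 2 * ∫ z, phi ((s z + t z) / 2) ∂K) ≤ 0 :=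
      mul_nonpos_of_nonneg_of_nonpos (by positivity) (by linarith)
    have h3 : e / (A + 1) * A ≤ e := by
      rw [div_mul_eq_mul_div, div_le_iff₀ (by positivity)]; nlinarith
    linarith
  have h1 := (integral_eq_zero_iff_of_nonneg (fun z => abs_nonneg (s z - t z))
    (hsi.sub hti).abs).1 (le_antisymm h0 (integral_nonneg fun z => abs_nonneg _))
  filter_upwards [h1] with z hz
  exact sub_eq_zero.1 (abs_eq_zero.1 hz)

lemma densMeas_add (hs : Measurable s) (hs0 : ∀ z, 0 ≤ s z) (ht0 : ∀ z, 0 ≤ t z) :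
    densMeas K (fun z => s z + t z) = densMeas K s + densMeas K t := by
  rw [densMeas, densMeas, densMeas, ← withDensity_add_left hs.ennreal_ofReal]
  congr 1
  ext z
  simp [ENNReal.ofReal_add (hs0 z) (ht0 z)]

lemma densMeas_const_mul {a : ℝ} (ha : 0 ≤ a) (hs : Measurable s) :
    densMeas K (fun z => a * s z) = ENNReal.ofReal a • densMeas K s := by
  rw [densMeas, densMeas, ← withDensity_smul _ hs.ennreal_ofReal]
  congr 1
  ext z
  simp [ENNReal.ofReal_mul ha]

lemma densMeas_congr (h : s =ᵐ[K] t) : densMeas K s = densMeas K t :=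
  withDensity_congr_ae (h.mono fun _ hz => congrArg ENNReal.ofReal hz)

lemma restrict_densMeas {A : Set Z} (hA : MeasurableSet A) :
    (densMeas K s).restrict A = densMeas K (A.indicator s) := by
  rw [densMeas, restrict_withDensity hA, ← withDensity_indicator hA, densMeas]
  congr 1
  ext z
  by_cases hz : z ∈ A <;> simp [hz]

end Densities

section Comparable

variable {Z : Type*} [MeasurableSpace Z] {M : Measure Z} {k : Z → ℝ} {k0 : ℝ}

lemma densMeas_le_of_le_one (hk1 : ∀ z, k z ≤ 1) : densMeas M k ≤ M := by
  conv_rhs => rw [← withDensity_one (μ := M)]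
  refine withDensity_mono (ae_of_all _ fun z => ?_)
  simpa using hk1 z

lemma le_smul_densMeas (hk : Measurable k) (hk0 : 0 < k0) (hkl : ∀ z, k0 ≤ k z) :
    M ≤ ENNReal.ofReal k0⁻¹ • densMeas M k := by
  rw [densMeas, ← withDensity_smul _ hk.ennreal_ofReal]
  conv_lhs => rw [← withDensity_one (μ := M)]
  refine withDensity_mono (ae_of_all _ fun z => ?_)
  simp only [Pi.one_apply, Pi.smul_apply, smul_eq_mul]
  rw [← ENNReal.ofReal_mul (by positivity), ← ENNReal.ofReal_one]
  refine ENNReal.ofReal_le_ofReal ?_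
  have := mul_le_mul_of_nonneg_left (hkl z) (inv_pos.2 hk0).le
  rwa [inv_mul_cancel₀ hk0.ne'] at this

lemma integrable_densMeas_iff (hk : Measurable k) (hk0 : 0 < k0) (hkl : ∀ z, k0 ≤ k z)
    (hk1 : ∀ z, k z ≤ 1) {f : Z → ℝ} : Integrable f (densMeas M k) ↔ Integrable f M :=
  ⟨fun h => (h.smul_measure ENNReal.ofReal_ne_top).mono_measure (le_smul_densMeas hk hk0 hkl),
    fun h => h.mono_measure (densMeas_le_of_le_one hk1)⟩

lemma ae_densMeas_iff_of_pos (hk : Measurable k) (hk0 : 0 < k0) (hkl : ∀ z, k0 ≤ k z)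
    {p : Z → Prop} : (∀ᵐ z ∂densMeas M k, p z) ↔ ∀ᵐ z ∂M, p z := by
  have h1 : densMeas M k ≪ M := withDensity_absolutelyContinuous _ _
  have h2 : M ≪ densMeas M k := by
    refine withDensity_absolutelyContinuous' hk.ennreal_ofReal.aemeasurable
      (ae_of_all _ fun z => ?_)
    simpa using hk0.trans_le (hkl z)
  exact ⟨fun h => h2.ae_le h, fun h => h1.ae_le h⟩

lemma integral_densMeas (hk : Measurable k) (hk0 : ∀ z, 0 ≤ k z) (f : Z → ℝ) :
    ∫ z, f z ∂densMeas M k = ∫ z, k z * f z ∂M := by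
  rw [densMeas, integral_withDensity_eq_integral_toReal_smul hk.ennreal_ofReal
    (ae_of_all _ fun z => ENNReal.ofReal_lt_top)]
  simp [ENNReal.toReal_ofReal, hk0]

lemma lintegral_densMeas (hk : Measurable k) {f : Z → ℝ≥0∞} (hf : Measurable f) :
    ∫⁻ z, f z ∂densMeas M k = ∫⁻ z, ENNReal.ofReal (k z) * f z ∂M := by
  rw [densMeas, lintegral_withDensity_eq_lintegral_mul _ hk.ennreal_ofReal hf]
  rfl

end Comparable

section ProductSpace

variable {X Y : Type*} [MeasurableSpace X] [MeasurableSpace Y]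

lemma densMeas_fst_apply {K : Measure (X × Y)} {s : X × Y → ℝ}
    (hs0 : ∀ z, 0 ≤ s z) (hsi : Integrable s K) {A : Set X} (hA : MeasurableSet A) :
    (densMeas K s).map Prod.fst A = ENNReal.ofReal (∫ z in Prod.fst ⁻¹' A, s z ∂K) := by
  rw [Measure.map_apply measurable_fst hA, densMeas, withDensity_apply _ (measurable_fst hA),
    ofReal_integral_eq_lintegral_ofReal hsi.integrableOn (ae_of_all _ hs0)]

lemma densMeas_snd_apply {K : Measure (X × Y)} {s : X × Y → ℝ}
    (hs0 : ∀ z, 0 ≤ s z) (hsi : Integrable s K) {B : Set Y} (hB : MeasurableSet B) :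
    (densMeas K s).map Prod.snd B = ENNReal.ofReal (∫ z in Prod.snd ⁻¹' B, s z ∂K) := by
  rw [Measure.map_apply measurable_snd hB, densMeas, withDensity_apply _ (measurable_snd hB),
    ofReal_integral_eq_lintegral_ofReal hsi.integrableOn (ae_of_all _ hs0)]

lemma coupling_convex {π₁ π₂ : Measure (X × Y)} {μh : Measure X} {νh : Measure Y}
    (h1 : π₁ ∈ Coupling μh νh) (h2 : π₂ ∈ Coupling μh νh) {t : ℝ} (ht0 : 0 ≤ t) (ht1 : t ≤ 1) :
    ENNReal.ofReal (1 - t) • π₁ + ENNReal.ofReal t • π₂ ∈ Coupling μh νh := by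
  have hsum : ENNReal.ofReal (1 - t) + ENNReal.ofReal t = 1 := by
    rw [← ENNReal.ofReal_add (by linarith) ht0]; simp
  constructor
  · rw [Measure.map_add _ _ measurable_fst, Measure.map_smul, Measure.map_smul, h1.1, h2.1,
      ← add_smul, hsum, one_smul]
  · rw [Measure.map_add _ _ measurable_snd, Measure.map_smul, Measure.map_smul, h1.2, h2.2,
      ← add_smul, hsum, one_smul]

lemma densMeas_midpoint_mem {K : Measure (X × Y)} {μh : Measure X} {νh : Measure Y}
    {s t : X × Y → ℝ} (hs : Measurable s) (hs0 : ∀ z, 0 ≤ s z)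
    (hsm : densMeas K s ∈ Coupling μh νh) (ht : Measurable t) (ht0 : ∀ z, 0 ≤ t z)
    (htm : densMeas K t ∈ Coupling μh νh) :
    densMeas K (fun z => (s z + t z) / 2) ∈ Coupling μh νh := by
  have h1 := coupling_convex hsm htm (by norm_num : (0 : ℝ) ≤ 1 / 2) (by norm_num)
  rw [← densMeas_const_mul (by norm_num) hs, ← densMeas_const_mul (by norm_num) ht,
    ← densMeas_add (hs.const_mul _) (fun z => mul_nonneg (by norm_num) (hs0 z))
      (fun z => mul_nonneg (by norm_num) (ht0 z))] at h1
  convert h1 using 2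
  ext z; ring

/-- The density form of `IsOptPlan`, for plans of finite divergence. -/
structure IsOptDensity (K : Measure (X × Y)) (μh : Measure X) (νh : Measure Y)
    (s : X × Y → ℝ) : Prop where
  meas : Measurable s
  nonneg : ∀ z, 0 ≤ s z
  int : Integrable s K
  int_phi : Integrable (fun z => phi (s z)) K
  mem : densMeas K s ∈ Coupling μh νh
  le : ∀ s' : X × Y → ℝ, Measurable s' → (∀ z, 0 ≤ s' z) → densMeas K s' ∈ Coupling μh νh →
    Integrable (fun z => phi (s' z)) K → ∫ z, phi (s z) ∂K ≤ ∫ z, phi (s' z) ∂K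

lemma coupling_univ {π : Measure (X × Y)} {μh : Measure X} {νh : Measure Y}
    (h : π ∈ Coupling μh νh) : π Set.univ = μh Set.univ := by
  rw [← h.1, Measure.map_apply measurable_fst MeasurableSet.univ, Set.preimage_univ]

lemma IsOptPlan.exists_isOptDensity {K : Measure (X × Y)} [SigmaFinite K] {μh : Measure X}
    [IsFiniteMeasure μh] {νh : Measure Y} {π : Measure (X × Y)} (h : IsOptPlan K μh νh π)
    (hfin : KL π K ≠ ⊤) : ∃ s, IsOptDensity K μh νh s ∧ π = densMeas K s := by
  have hu := coupling_univ h.1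
  have : IsFiniteMeasure π := ⟨by rw [hu]; exact measure_lt_top _ _⟩
  obtain ⟨s, hs, hs0, rfl⟩ := exists_densMeas_eq (KL_ne_top_ac hfin)
  have hφ := (KL_densMeas_ne_top_iff hs hs0).1 hfin
  refine ⟨s, ⟨hs, hs0, integrable_of_densMeas_univ hs hs0 (measure_ne_top _ _), hφ, h.1, ?_⟩,
    rfl⟩
  intro s' hs' hs'0 hmem hφ'
  have := h.2 _ hmem
  rw [KL_densMeas_eq_ofReal hs hs0 hφ, KL_densMeas_eq_ofReal hs' hs'0 hφ',
    ENNReal.ofReal_le_ofReal_iff (integral_nonneg fun z => phi_nonneg (hs'0 z))] at this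
  exact this

lemma phi_add_smul_le {a b t : ℝ} (ha : 0 ≤ a) (hb : |b| ≤ a) (ht0 : 0 < t) (ht1 : t ≤ 1) :
    phi (a + t * b) ≤ phi a + t * (b * Real.log a) + t ^ 2 * a := by
  rcases ha.eq_or_lt with rfl | ha
  · have : b = 0 := by simpa using hb
    simp [this]
  have hc : 0 ≤ a + t * b := by nlinarith [(abs_le.1 hb).1, (abs_le.1 hb).2]
  have hsq : (t * b) ^ 2 / a ≤ t ^ 2 * a := by
    rw [div_le_iff₀ ha]
    have := mul_self_le_mul_self (abs_nonneg b) hb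
    rw [abs_mul_abs_self] at this
    nlinarith [mul_nonneg (sq_nonneg t) (sub_nonneg.2 this)]
  have hlog : (a + t * b) * Real.log (a + t * b)
      ≤ (a + t * b) * Real.log a + t * b + (t * b) ^ 2 / a := by
    rcases hc.eq_or_lt with hc | hc
    · rw [← hc]
      have h1 : t * b = -a := by linarith
      rw [h1]
      field_simp
      simp
    · have h1 := Real.log_le_sub_one_of_pos (div_pos hc ha)
      rw [Real.log_div hc.ne' ha.ne'] at h1
      have h2 := mul_le_mul_of_nonneg_left h1 hc.le
      have h3 : (a + t * b) * ((a + t * b) / a - 1) = t * b + (t * b) ^ 2 / a := by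
        field_simp; ring
      linarith
  rw [phi, phi]
  linarith

namespace IsOptDensity

variable {K : Measure (X × Y)} {μh : Measure X} {νh : Measure Y} {s s' : X × Y → ℝ}

lemma integrable_mul_log [IsFiniteMeasure K] (h : IsOptDensity K μh νh s) :
    Integrable (fun z => s z * Real.log (s z)) K := by
  refine ((h.int_phi.add h.int).sub (integrable_const (1 : ℝ))).congr (ae_of_all _ fun z => ?_)
  simp only [phi, Pi.add_apply, Pi.sub_apply]
  ring

lemma ae_eq (h : IsOptDensity K μh νh s) (h' : IsOptDensity K μh νh s') : s =ᵐ[K] s' := by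
  refine ae_eq_of_phi_midpoint h.meas h.nonneg h'.meas h'.nonneg h.int h'.int h.int_phi
    h'.int_phi ?_
  have hφ := integrable_phi_midpoint h.meas h.nonneg h'.meas h'.nonneg h.int_phi h'.int_phi
  have hmeas : Measurable fun z => (s z + s' z) / 2 := (h.meas.add h'.meas).div_const 2
  have hn : ∀ z, 0 ≤ (s z + s' z) / 2 := fun z => by
    have := h.nonneg z; have := h'.nonneg z; positivity
  have hmem := densMeas_midpoint_mem h.meas h.nonneg h.mem h'.meas h'.nonneg h'.mem
  have h1 := h.le _ hmeas hn hmem hφ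
  have h2 := h'.le _ hmeas hn hmem hφ
  linarith

/-- First-order optimality along perturbations dominated by the density. -/
lemma first_variation [IsFiniteMeasure K] (h : IsOptDensity K μh νh s) {b : X × Y → ℝ}
    (hb : Measurable b) (hbs : ∀ z, |b z| ≤ s z)
    (hb1 : ∀ A, MeasurableSet A → ∫ z in Prod.fst ⁻¹' A, b z ∂K = 0)
    (hb2 : ∀ B, MeasurableSet B → ∫ z in Prod.snd ⁻¹' B, b z ∂K = 0) :
    0 ≤ ∫ z, b z * Real.log (s z) ∂K := by
  have hbi : Integrable b K := h.int.mono' hb.aestronglyMeasurable (ae_of_all _ hbs)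
  have hbl : Integrable (fun z => b z * Real.log (s z)) K := by
    refine h.integrable_mul_log.mono
      (hb.mul (Real.measurable_log.comp h.meas)).aestronglyMeasurable (ae_of_all _ fun z => ?_)
    rw [norm_mul, norm_mul, Real.norm_eq_abs, Real.norm_of_nonneg (h.nonneg z)]
    exact mul_le_mul_of_nonneg_right (hbs z) (norm_nonneg _)
  have hI : 0 ≤ ∫ z, s z ∂K := integral_nonneg h.nonneg
  have step : ∀ t : ℝ, 0 < t → t ≤ 1 →
      0 ≤ ∫ z, b z * Real.log (s z) ∂K + t * ∫ z, s z ∂K := by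
    intro t ht0 ht1
    have hmeas : Measurable fun z => s z + t * b z := h.meas.add (hb.const_mul t)
    have hn : ∀ z, 0 ≤ s z + t * b z := fun z => by
      have h1 := abs_le.1 (hbs z)
      nlinarith [h.nonneg z]
    have hi : Integrable (fun z => s z + t * b z) K := h.int.add (hbi.const_mul t)
    have hle : ∀ z, phi (s z + t * b z)
        ≤ phi (s z) + t * (b z * Real.log (s z)) + t ^ 2 * s z :=
      fun z => phi_add_smul_le (h.nonneg z) (hbs z) ht0 ht1
    have hi1 : Integrable (fun z => phi (s z) + t * (b z * Real.log (s z))) K :=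
      h.int_phi.add (hbl.const_mul t)
    have hi2 : Integrable
        (fun z => phi (s z) + t * (b z * Real.log (s z)) + t ^ 2 * s z) K :=
      hi1.add (h.int.const_mul (t ^ 2))
    have hφ : Integrable (fun z => phi (s z + t * b z)) K :=
      hi2.mono' (measurable_phi.comp hmeas).aestronglyMeasurable (ae_of_all _ fun z => by
        rw [Real.norm_of_nonneg (phi_nonneg (hn z))]; exact hle z)
    have hmem : densMeas K (fun z => s z + t * b z) ∈ Coupling μh νh := by
      constructor
      · rw [← h.mem.1]
        ext A hA
        rw [densMeas_fst_apply hn hi hA, densMeas_fst_apply h.nonneg h.int hA,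
          integral_add h.int.integrableOn (hbi.const_mul t).integrableOn, integral_const_mul,
          hb1 A hA, mul_zero, add_zero]
      · rw [← h.mem.2]
        ext A hA
        rw [densMeas_snd_apply hn hi hA, densMeas_snd_apply h.nonneg h.int hA,
          integral_add h.int.integrableOn (hbi.const_mul t).integrableOn, integral_const_mul,
          hb2 A hA, mul_zero, add_zero]
    have h1 := h.le _ hmeas hn hmem hφ
    have h2 := integral_mono hφ hi2 hle
    rw [integral_add hi1 (h.int.const_mul (t ^ 2)),
      integral_add h.int_phi (hbl.const_mul t), integral_const_mul, integral_const_mul] at h2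
    have h3 : 0 ≤ t * (∫ z, b z * Real.log (s z) ∂K + t * ∫ z, s z ∂K) := by nlinarith
    exact nonneg_of_mul_nonneg_right h3 ht0
  refine le_of_forall_pos_le_add fun e he => ?_
  set I := ∫ z, s z ∂K
  have ht : 0 < min 1 (e / (I + 1)) := lt_min one_pos (by positivity)
  have h1 := step _ ht (min_le_left _ _)
  have h2 : min 1 (e / (I + 1)) * I ≤ e := by
    calc min 1 (e / (I + 1)) * I ≤ e / (I + 1) * I :=
          mul_le_mul_of_nonneg_right (min_le_right _ _) hI
      _ ≤ e := by rw [div_mul_eq_mul_div, div_le_iff₀ (by positivity)]; nlinarith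
  linarith

/-- An optimal density is positive wherever some competitor of finite divergence is. -/
lemma ae_eq_zero_of_eq_zero [IsFiniteMeasure K] (h : IsOptDensity K μh νh s) {r : X × Y → ℝ}
    (hr : Measurable r) (hr0 : ∀ z, 0 ≤ r z) (hri : Integrable r K)
    (hrφ : Integrable (fun z => phi (r z)) K) (hrm : densMeas K r ∈ Coupling μh νh) :
    ∀ᵐ z ∂K, s z = 0 → r z = 0 := by
  set N : Set (X × Y) := {z | s z = 0} with hN
  have hNm : MeasurableSet N := h.meas (measurableSet_singleton 0)
  have hrN : Integrable (N.indicator r) K := hri.indicator hNm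
  have step : ∀ t : ℝ, 0 < t → t < 1 →
      ∫ z, phi (s z) ∂K - ∫ z, phi (r z) ∂K ≤ Real.log t * ∫ z, N.indicator r z ∂K := by
    intro t ht0 ht1
    have hmeas : Measurable fun z => (1 - t) * s z + t * r z :=
      (h.meas.const_mul _).add (hr.const_mul _)
    have hn : ∀ z, 0 ≤ (1 - t) * s z + t * r z := fun z =>
      add_nonneg (mul_nonneg (by linarith) (h.nonneg z)) (mul_nonneg ht0.le (hr0 z))
    have hle : ∀ z, phi ((1 - t) * s z + t * r z)
        ≤ (1 - t) * phi (s z) + t * phi (r z) + t * Real.log t * N.indicator r z := by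
      intro z
      by_cases hz : z ∈ N
      · have hz' : s z = 0 := hz
        rw [Set.indicator_of_mem hz, hz', mul_zero, zero_add]
        rcases (hr0 z).eq_or_lt with h0 | h0
        · rw [← h0, mul_zero]; simp [phi]
        · rw [phi, phi, phi, Real.log_mul ht0.ne' h0.ne', Real.log_zero]
          apply le_of_eq; ring
      · rw [Set.indicator_of_notMem hz, mul_zero, add_zero]
        have := convexOn_phi.2 (h.nonneg z) (hr0 z) (sub_nonneg.2 ht1.le) ht0.le (by ring)
        simpa only [smul_eq_mul] using this
    have hi1 : Integrable (fun z => (1 - t) * phi (s z) + t * phi (r z)) K :=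
      (h.int_phi.const_mul _).add (hrφ.const_mul _)
    have hi2 := hi1.add (hrN.const_mul (t * Real.log t))
    have hφ : Integrable (fun z => phi ((1 - t) * s z + t * r z)) K :=
      hi2.mono' (measurable_phi.comp hmeas).aestronglyMeasurable (ae_of_all _ fun z => by
        rw [Real.norm_of_nonneg (phi_nonneg (hn z))]; exact hle z)
    have hmem : densMeas K (fun z => (1 - t) * s z + t * r z) ∈ Coupling μh νh := by
      rw [densMeas_add (h.meas.const_mul _)
        (fun z => mul_nonneg (by linarith) (h.nonneg z)) (fun z => mul_nonneg ht0.le (hr0 z)),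
        densMeas_const_mul (by linarith) h.meas, densMeas_const_mul ht0.le hr]
      exact coupling_convex h.mem hrm ht0.le ht1.le
    have h1 := h.le _ hmeas hn hmem hφ
    have h2 := integral_mono hφ hi2 hle
    simp only [Pi.add_apply] at h2
    rw [integral_add hi1 (hrN.const_mul _),
      integral_add (h.int_phi.const_mul _) (hrφ.const_mul _), integral_const_mul,
      integral_const_mul, integral_const_mul] at h2
    refine le_of_mul_le_mul_left ?_ ht0
    nlinarith
  have hR0 : ∀ z, 0 ≤ N.indicator r z := fun z => Set.indicator_nonneg (fun z _ => hr0 z) z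
  have hR : ∫ z, N.indicator r z ∂K = 0 := by
    refine le_antisymm (not_lt.1 fun hpos => ?_) (integral_nonneg hR0)
    set D := ∫ z, phi (s z) ∂K - ∫ z, phi (r z) ∂K with hD
    set R := ∫ z, N.indicator r z ∂K with hRdef
    have h1 := step (Real.exp (-((|D| + 1) / R))) (Real.exp_pos _)
      (Real.exp_lt_one_iff.2 (neg_neg_of_pos (by positivity)))
    rw [Real.log_exp, neg_mul, div_mul_cancel₀ _ hpos.ne'] at h1
    linarith [neg_abs_le D]
  filter_upwards [(integral_eq_zero_iff_of_nonneg hR0 hrN).1 hR] with z hz hsz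
  rwa [Set.indicator_of_mem (show z ∈ N from hsz)] at hz

end IsOptDensity

end ProductSpace

section CrossRatio

variable {X Y : Type*} [MeasurableSpace X] [MeasurableSpace Y]

/-- Exchange of the second coordinates of a pair of points of `X × Y`. -/
def exchange (q : (X × Y) × (X × Y)) : (X × Y) × (X × Y) := ((q.1.1, q.2.2), (q.2.1, q.1.2))

lemma measurePreserving_exchange (μ : Measure X) (ν : Measure Y) [SFinite μ] [SFinite ν] :
    MeasurePreserving (exchange : (X × Y) × (X × Y) → _)
      ((μ.prod ν).prod (μ.prod ν)) ((μ.prod ν).prod (μ.prod ν)) := by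
  have e1 := measurePreserving_prodAssoc μ ν (μ.prod ν)
  have e2 := (measurePreserving_prodAssoc ν μ ν).symm
  have e3 : MeasurePreserving (Prod.swap : (Y × X) × Y → _) ((ν.prod μ).prod ν)
    (ν.prod (ν.prod μ)) := Measure.measurePreserving_swap
  have e4 : MeasurePreserving (Prod.map id Prod.swap : Y × (Y × X) → _) (ν.prod (ν.prod μ))
    (ν.prod (μ.prod ν)) := (MeasurePreserving.id ν).prod Measure.measurePreserving_swap
  have e5 := (MeasurePreserving.id μ).prod (e4.comp (e3.comp e2))
  exact e1.symm.comp (e5.comp e1)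

/-- The Schrödinger factorization in cross-ratio form. -/
lemma IsOptDensity.cross_ratio {μ : Measure X} {ν : Measure Y} [IsProbabilityMeasure μ]
    [IsProbabilityMeasure ν] {k : X × Y → ℝ} {k0 : ℝ} (hk : Measurable k) (hk0 : 0 < k0)
    (hkl : ∀ z, k0 ≤ k z) (hk1 : ∀ z, k z ≤ 1) {μh : Measure X} {νh : Measure Y}
    {s : X × Y → ℝ} (h : IsOptDensity (densMeas (μ.prod ν) k) μh νh s) :
    ∀ᵐ q ∂(μ.prod ν).prod (μ.prod ν), 0 < s q.1 → 0 < s q.2 → 0 < s (exchange q).1 →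
      0 < s (exchange q).2 → s q.1 * s q.2 = s (exchange q).1 * s (exchange q).2 := by
  have hfin : IsFiniteMeasure (densMeas (μ.prod ν) k) := isFiniteMeasure_of_le _
    (densMeas_le_of_le_one hk1)
  have hσ := measurePreserving_exchange μ ν
  set M := μ.prod ν with hM
  have hsw : MeasurePreserving (Prod.swap : (X × Y) × (X × Y) → _) (M.prod M) (M.prod M) :=
    Measure.measurePreserving_swap
  have hs := h.meas
  have hkp : ∀ z, 0 < k z := fun z => hk0.trans_le (hkl z)
  set d : (X × Y) × (X × Y) → ℝ := fun q =>
    s q.1 * s q.2 - s (exchange q).1 * s (exchange q).2 with hd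
  set m : (X × Y) × (X × Y) → ℝ := fun q =>
    min (min (s q.1) (s q.2)) (min (s (exchange q).1) (s (exchange q).2)) with hm
  set G : (X × Y) × (X × Y) → ℝ := fun q => m q * (d q / (1 + |d q|)) with hG
  have hσm : Measurable (exchange : (X × Y) × (X × Y) → _) := hσ.measurable
  have hdm : Measurable d := by fun_prop
  have hmm : Measurable m := by fun_prop
  have hGm : Measurable G := hmm.mul (hdm.div (measurable_const.add hdm.abs))
  have hm0 : ∀ q, 0 ≤ m q := fun q =>
    le_min (le_min (h.nonneg _) (h.nonneg _)) (le_min (h.nonneg _) (h.nonneg _))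
  have hdσ : ∀ q, d (exchange q) = -d q := fun q => by simp only [hd, exchange]; ring
  have hmσ : ∀ q, m (exchange q) = m q := fun q => by
    simp only [hm, exchange]; rw [min_comm]
  have hGσ : ∀ q, G (exchange q) = -G q := fun q => by
    simp only [hG, hdσ, hmσ, abs_neg]; ring
  have hdsw : ∀ q, d (Prod.swap q) = d q := fun q => by
    simp only [hd, exchange, Prod.swap]; ring
  have hmsw : ∀ q, m (Prod.swap q) = m q := fun q => by
    simp only [hm, exchange, Prod.swap]
    rw [min_comm (s q.2), min_comm (s (q.2.1, q.1.2))]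
  have hGsw : ∀ q, G (Prod.swap q) = G q := fun q => by simp only [hG, hdsw, hmsw]
  have hGle : ∀ q, |G q| ≤ s q.1 := fun q => by
    have h1 : |d q / (1 + |d q|)| ≤ 1 := by
      rw [abs_div, abs_of_pos (by positivity : 0 < 1 + |d q|)]
      exact (div_le_one (by positivity)).2 (by linarith)
    calc |G q| = m q * |d q / (1 + |d q|)| := by rw [hG, abs_mul, abs_of_nonneg (hm0 q)]
      _ ≤ m q * 1 := mul_le_mul_of_nonneg_left h1 (hm0 q)
      _ ≤ s q.1 := by rw [mul_one]; exact (min_le_left _ _).trans (min_le_left _ _)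
  have hFi : ∀ w : X × Y → ℝ, Measurable w → Integrable (fun z => w z * s z) M →
      Integrable (fun q => w q.1 * G q) (M.prod M) := by
    intro w hw hwi
    refine (hwi.comp_fst M).mono ((hw.comp measurable_fst).mul hGm).aestronglyMeasurable
      (ae_of_all _ fun q => ?_)
    rw [norm_mul (w q.1) (G q), norm_mul (w q.1) (s q.1), Real.norm_eq_abs (G q),
      Real.norm_of_nonneg (h.nonneg q.1)]
    exact mul_le_mul_of_nonneg_left (hGle q) (norm_nonneg _)
  set b : X × Y → ℝ := fun z => -(k0 * (∫ z', G (z, z') ∂M) / k z) with hb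
  have hηm : Measurable fun z => ∫ z', G (z, z') ∂M :=
    hGm.stronglyMeasurable.integral_prod_right'.measurable
  have hbm : Measurable b := ((hηm.const_mul k0).div hk).neg
  have hbs : ∀ z, |b z| ≤ s z := fun z => by
    have h1 : |∫ z', G (z, z') ∂M| ≤ s z := by
      have := norm_integral_le_of_norm_le_const (μ := M) (f := fun z' => G (z, z')) (C := s z)
        (ae_of_all _ fun z' => hGle (z, z'))
      simpa using this
    rw [hb, abs_neg, abs_div, abs_mul, abs_of_pos hk0, abs_of_pos (hkp z), div_le_iff₀ (hkp z),
      mul_comm]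
    exact mul_le_mul h1 (hkl z) hk0.le (h.nonneg z)
  have hbint : ∀ w : X × Y → ℝ, Measurable w → Integrable (fun z => w z * s z) M →
      ∫ z, b z * w z ∂densMeas M k = -k0 * ∫ q, w q.1 * G q ∂M.prod M := by
    intro w hw hwi
    rw [integral_densMeas hk (fun z => (hkp z).le), integral_prod _ (hFi w hw hwi),
      ← integral_const_mul]
    refine integral_congr_ae (ae_of_all _ fun z => ?_)
    simp only [hb, integral_const_mul]
    have := (hkp z).ne'
    field_simp
  have inv : ∀ (T : (X × Y) × (X × Y) → (X × Y) × (X × Y)),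
      MeasurePreserving T (M.prod M) (M.prod M) → ∀ F : (X × Y) × (X × Y) → ℝ, Measurable F →
      ∫ q, F (T q) ∂M.prod M = ∫ q, F q ∂M.prod M := by
    intro T hT F hF
    conv_rhs => rw [← hT.map_eq, integral_map hT.measurable.aemeasurable hF.aestronglyMeasurable]
  have hsM : Integrable s M := (integrable_densMeas_iff hk hk0 hkl hk1).1 h.int
  have hindi : ∀ C : Set (X × Y), MeasurableSet C →
      Integrable (fun z => C.indicator 1 z * s z) M := by
    intro C hC
    refine (hsM.indicator hC).congr (ae_of_all _ fun z => ?_)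
    by_cases hz : z ∈ C <;> simp [hz]
  have hbC : ∀ C : Set (X × Y), MeasurableSet C → ∫ z in C, b z ∂densMeas M k
      = -k0 * ∫ q, C.indicator 1 q.1 * G q ∂M.prod M := by
    intro C hC
    rw [← hbint _ (measurable_one.indicator hC) (hindi C hC), ← integral_indicator hC]
    refine integral_congr_ae (ae_of_all _ fun z => ?_)
    by_cases hz : z ∈ C <;> simp [hz]
  have hb1 : ∀ A, MeasurableSet A → ∫ z in Prod.fst ⁻¹' A, b z ∂densMeas M k = 0 := by
    intro A hA
    have hC : MeasurableSet (Prod.fst ⁻¹' A : Set (X × Y)) := measurable_fst hA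
    rw [hbC _ hC]
    have h1 := inv _ hσ (fun q => (Prod.fst ⁻¹' A : Set (X × Y)).indicator 1 q.1 * G q)
      (((measurable_one.indicator hC).comp measurable_fst).mul hGm)
    have h2 : ∀ q : (X × Y) × (X × Y),
        (Prod.fst ⁻¹' A : Set (X × Y)).indicator (1 : X × Y → ℝ) (exchange q).1
          * G (exchange q)
        = -((Prod.fst ⁻¹' A : Set (X × Y)).indicator 1 q.1 * G q) := by
      intro q
      rw [hGσ, mul_neg]
      rfl
    simp only [h2, integral_neg] at h1
    rw [show ∫ q, (Prod.fst ⁻¹' A : Set (X × Y)).indicator (1 : X × Y → ℝ) q.1 * G q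
      ∂M.prod M = 0 by linarith, mul_zero]
  have hb2 : ∀ B, MeasurableSet B → ∫ z in Prod.snd ⁻¹' B, b z ∂densMeas M k = 0 := by
    intro A hA
    have hC : MeasurableSet (Prod.snd ⁻¹' A : Set (X × Y)) := measurable_snd hA
    rw [hbC _ hC]
    have h1 := inv _ (hσ.comp hsw)
      (fun q => (Prod.snd ⁻¹' A : Set (X × Y)).indicator 1 q.1 * G q)
      (((measurable_one.indicator hC).comp measurable_fst).mul hGm)
    have h2 : ∀ q : (X × Y) × (X × Y),
        (Prod.snd ⁻¹' A : Set (X × Y)).indicator (1 : X × Y → ℝ) ((exchange ∘ Prod.swap) q).1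
          * G ((exchange ∘ Prod.swap) q)
        = -((Prod.snd ⁻¹' A : Set (X × Y)).indicator 1 q.1 * G q) := by
      intro q
      rw [Function.comp_apply, hGσ, hGsw, mul_neg]
      rfl
    simp only [h2, integral_neg] at h1
    rw [show ∫ q, (Prod.snd ⁻¹' A : Set (X × Y)).indicator (1 : X × Y → ℝ) q.1 * G q
      ∂M.prod M = 0 by linarith, mul_zero]
  set w : X × Y → ℝ := fun z => Real.log (s z) with hw
  have hwm : Measurable w := Real.measurable_log.comp hs
  have hwi : Integrable (fun z => w z * s z) M := by
    refine ((integrable_densMeas_iff hk hk0 hkl hk1).1 h.integrable_mul_log).congr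
      (ae_of_all _ fun z => mul_comm _ _)
  set F : (X × Y) × (X × Y) → ℝ := fun q => w q.1 * G q with hF
  have hFm : Measurable F := (hwm.comp measurable_fst).mul hGm
  have hFI : Integrable F (M.prod M) := hFi w hwm hwi
  have hneg : ∫ q, F q ∂M.prod M ≤ 0 := by
    have h1 := h.first_variation hbm hbs hb1 hb2
    rw [hbint w hwm hwi] at h1
    by_contra! h2
    nlinarith
  have i2 : Integrable (fun q => F (Prod.swap q)) (M.prod M) :=
    hsw.integrable_comp_of_integrable hFI
  have i3 : Integrable (fun q => F (exchange q)) (M.prod M) := hσ.integrable_comp_of_integrable hFI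
  have i4 : Integrable (fun q => F (exchange (Prod.swap q))) (M.prod M) :=
    (hσ.comp hsw).integrable_comp_of_integrable hFI
  have hsum : ∀ q, F q + F (Prod.swap q) + (F (exchange q) + F (exchange (Prod.swap q)))
      = G q * (w q.1 + w q.2 - w (exchange q).1 - w (exchange q).2) := by
    intro q
    simp only [hF, hGσ, hGsw]
    simp only [exchange, Prod.swap]
    ring
  have hpos : ∀ q, 0 < s q.1 → 0 < s q.2 → 0 < s (exchange q).1 → 0 < s (exchange q).2 →
      w q.1 + w q.2 - w (exchange q).1 - w (exchange q).2
        = Real.log (s q.1 * s q.2) - Real.log (s (exchange q).1 * s (exchange q).2) := by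
    intro q h1 h2 h3 h4
    rw [Real.log_mul h1.ne' h2.ne', Real.log_mul h3.ne' h4.ne']
    ring
  have hsum0 : ∀ q, 0 ≤ F q + F (Prod.swap q) + (F (exchange q) + F (exchange (Prod.swap q))) := by
    intro q
    rw [hsum]
    rcases (hm0 q).eq_or_lt with h0 | h0
    · simp [hG, ← h0]
    · simp only [hm, lt_min_iff] at h0
      rw [hpos q h0.1.1 h0.1.2 h0.2.1 h0.2.2]
      have hA := mul_pos h0.1.1 h0.1.2
      have hB := mul_pos h0.2.1 h0.2.2
      rcases le_total (s q.1 * s q.2) (s (exchange q).1 * s (exchange q).2) with hAB | hAB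
      · refine mul_nonneg_of_nonpos_of_nonpos ?_ (sub_nonpos.2 (Real.log_le_log hA hAB))
        exact mul_nonpos_of_nonneg_of_nonpos (hm0 q)
          (div_nonpos_of_nonpos_of_nonneg (sub_nonpos.2 hAB) (by positivity))
      · refine mul_nonneg ?_ (sub_nonneg.2 (Real.log_le_log hB hAB))
        exact mul_nonneg (hm0 q) (div_nonneg (sub_nonneg.2 hAB) (by positivity))
  have hInt : ∫ q, (F q + F (Prod.swap q) + (F (exchange q) + F (exchange (Prod.swap q))))
      ∂M.prod M ≤ 0 := by
    have j1 := inv _ hsw F hFm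
    have j2 := inv _ hσ F hFm
    have j3 := inv _ (hσ.comp hsw) F hFm
    simp only [Function.comp_apply] at j3
    have i12 : Integrable (fun q => F q + F (Prod.swap q)) (M.prod M) := hFI.add i2
    have i34 : Integrable (fun q => F (exchange q) + F (exchange (Prod.swap q))) (M.prod M) :=
      i3.add i4
    rw [integral_add i12 i34, integral_add hFI i2, integral_add i3 i4, j1, j2, j3]
    linarith
  have hzero := (integral_eq_zero_iff_of_nonneg hsum0 ((hFI.add i2).add (i3.add i4))).1
    (le_antisymm hInt (integral_nonneg hsum0))
  filter_upwards [hzero] with q hq h1 h2 h3 h4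
  have hq' : G q * (w q.1 + w q.2 - w (exchange q).1 - w (exchange q).2) = 0 := by
    rw [← hsum]; exact hq
  rw [hpos q h1 h2 h3 h4] at hq'
  have hmp : 0 < m q := lt_min (lt_min h1 h2) (lt_min h3 h4)
  rcases mul_eq_zero.1 hq' with h0 | h0
  · rcases mul_eq_zero.1 h0 with h0 | h0
    · exact absurd h0 hmp.ne'
    · rcases div_eq_zero_iff.1 h0 with h0 | h0
      · exact sub_eq_zero.1 h0
      · have : 0 < 1 + |d q| := by positivity
        exact absurd h0 this.ne'
  · exact Real.log_injOn_pos (mul_pos h1 h2) (mul_pos h3 h4) (sub_eq_zero.1 h0)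

end CrossRatio

section Factorization

variable {X Y : Type*} [MeasurableSpace X] [MeasurableSpace Y]

/-- Measurable kernels with values in `[k0, 1]`, where `0 < k0`. -/
structure KernelBound {Z : Type*} [MeasurableSpace Z] (k : Z → ℝ) (k0 : ℝ) : Prop where
  meas : Measurable k
  pos : 0 < k0
  le : ∀ z, k0 ≤ k z
  le_one : ∀ z, k z ≤ 1

lemma KernelBound.kpos {Z : Type*} [MeasurableSpace Z] {k : Z → ℝ} {k0 : ℝ}
    (hk : KernelBound k k0) (z : Z) : 0 < k z := hk.pos.trans_le (hk.le z)

lemma KernelBound.isFiniteMeasure {Z : Type*} [MeasurableSpace Z] {k : Z → ℝ} {k0 : ℝ}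
    (hk : KernelBound k k0) (M : Measure Z) [IsFiniteMeasure M] :
    IsFiniteMeasure (densMeas M k) :=
  isFiniteMeasure_of_le _ (densMeas_le_of_le_one hk.le_one)

lemma densMeas_densMeas {Z : Type*} [MeasurableSpace Z] {M : Measure Z} {k s : Z → ℝ}
    (hk : Measurable k) (hk0 : ∀ z, 0 ≤ k z) (hs : Measurable s) :
    densMeas (densMeas M k) s = densMeas M fun z => k z * s z := by
  rw [densMeas, densMeas, densMeas, ← withDensity_mul _ hk.ennreal_ofReal hs.ennreal_ofReal]
  congr 1
  ext z
  simp [ENNReal.ofReal_mul (hk0 z)]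

lemma map_fst_densMeas {μ : Measure X} {ν : Measure Y} [SFinite μ] [SFinite ν] {w : X × Y → ℝ}
    (hw : Measurable w) : (densMeas (μ.prod ν) w).map Prod.fst =
      μ.withDensity fun x => ∫⁻ y, ENNReal.ofReal (w (x, y)) ∂ν := by
  ext A hA
  rw [Measure.map_apply measurable_fst hA, densMeas, withDensity_apply _ (measurable_fst hA),
    withDensity_apply _ hA, ← Set.prod_univ, ← Measure.prod_restrict, Measure.restrict_univ,
    lintegral_prod _ hw.ennreal_ofReal.aemeasurable]

lemma map_snd_densMeas {μ : Measure X} {ν : Measure Y} [SFinite μ] [SFinite ν] {w : X × Y → ℝ}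
    (hw : Measurable w) : (densMeas (μ.prod ν) w).map Prod.snd =
      ν.withDensity fun y => ∫⁻ x, ENNReal.ofReal (w (x, y)) ∂μ := by
  ext B hB
  rw [Measure.map_apply measurable_snd hB, densMeas, withDensity_apply _ (measurable_snd hB),
    withDensity_apply _ hB, ← Set.univ_prod, ← Measure.prod_restrict, Measure.restrict_univ,
    lintegral_prod_symm _ hw.ennreal_ofReal.aemeasurable]

lemma IsOptDensity.congr {K : Measure (X × Y)} {μh : Measure X} {νh : Measure Y}
    {s t : X × Y → ℝ} (h : IsOptDensity K μh νh s) (ht : Measurable t) (ht0 : ∀ z, 0 ≤ t z)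
    (hst : s =ᵐ[K] t) : IsOptDensity K μh νh t where
  meas := ht
  nonneg := ht0
  int := h.int.congr hst
  int_phi := h.int_phi.congr (hst.mono fun z hz => by simp only [hz])
  mem := densMeas_congr hst ▸ h.mem
  le := fun s' h1 h2 h3 h4 => by
    have : ∫ z, phi (t z) ∂K = ∫ z, phi (s z) ∂K :=
      integral_congr_ae (hst.mono fun z hz => by simp only [hz])
    exact this ▸ h.le s' h1 h2 h3 h4

lemma ae_eq_zero_of_densMeas_eq_zero {Z : Type*} [MeasurableSpace Z] {K : Measure Z} {s : Z → ℝ}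
    (hs : Measurable s) (hs0 : ∀ z, 0 ≤ s z) {A : Set Z} (h : densMeas K s A = 0) :
    ∀ᵐ z ∂K, z ∈ A → s z = 0 := by
  rw [densMeas, withDensity_apply_eq_zero hs.ennreal_ofReal] at h
  refine measure_mono_null (fun z hz => ?_) h
  simp only [Set.mem_compl_iff, Set.mem_ofPred_eq, Classical.not_imp] at hz
  exact ⟨by simpa using lt_of_le_of_ne (hs0 z) (Ne.symm hz.2), hz.1⟩

lemma phi_le_sq {r : ℝ} (hr : 0 ≤ r) : phi r ≤ r ^ 2 + 1 := by
  rcases hr.eq_or_lt with rfl | h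
  · simp [phi]
  · have := mul_le_mul_of_nonneg_left (Real.log_le_sub_one_of_pos h) hr
    unfold phi; nlinarith

lemma integrable_phi_of_bounded {Z : Type*} [MeasurableSpace Z] {K : Measure Z}
    [IsFiniteMeasure K] {r : Z → ℝ} (hr : Measurable r) (hr0 : ∀ z, 0 ≤ r z) {C : ℝ}
    (hC : ∀ z, r z ≤ C) : Integrable (fun z => phi (r z)) K := by
  refine (integrable_const (C ^ 2 + 1)).mono' (measurable_phi.comp hr).aestronglyMeasurable
    (ae_of_all _ fun z => ?_)
  rw [Real.norm_of_nonneg (phi_nonneg (hr0 z))]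
  exact (phi_le_sq (hr0 z)).trans (by have := hr0 z; gcongr; exact hC z)

variable {μ : Measure X} {ν : Measure Y} {k : X × Y → ℝ} {k0 : ℝ}

/-- The normalized product plan `(μ S)⁻¹ • (μ|_S ⊗ n ν)` as a density with respect to `K`. -/
lemma reference_density [IsProbabilityMeasure μ] [IsProbabilityMeasure ν]
    (hk : KernelBound k k0) {S : Set X} (hS : MeasurableSet S) (hS0 : μ S ≠ 0)
    {n : Y → ℝ} (hn : Measurable n) (hn0 : ∀ y, 0 ≤ n y) (hn1 : ∀ y, n y ≤ 1)
    (hmass : densMeas ν n Set.univ = μ S) :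
    ∃ r : X × Y → ℝ, Measurable r ∧ (∀ z, 0 ≤ r z) ∧ (∃ C, ∀ z, r z ≤ C) ∧
      (∀ z, z.1 ∈ S → r z = 0 → n z.2 = 0) ∧
      densMeas (densMeas (μ.prod ν) k) r ∈ Coupling (μ.restrict S) (densMeas ν n) := by
  set m := (μ S).toReal with hm
  have hm0 : 0 < m := ENNReal.toReal_pos hS0 (measure_ne_top _ _)
  have hofm : ENNReal.ofReal m = μ S := ENNReal.ofReal_toReal (measure_ne_top _ _)
  have hi0 : ∀ x, 0 ≤ S.indicator (fun _ => (1 : ℝ)) x := fun x =>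
    Set.indicator_nonneg (fun _ _ => zero_le_one) x
  have hi1 : ∀ x, S.indicator (fun _ => (1 : ℝ)) x ≤ 1 := fun x => by
    by_cases h : x ∈ S <;> simp [h]
  have him : Measurable (S.indicator fun _ => (1 : ℝ)) := measurable_const.indicator hS
  have hrm : Measurable fun z : X × Y =>
      S.indicator (fun _ => (1 : ℝ)) z.1 * n z.2 * m⁻¹ * (k z)⁻¹ :=
    (((him.comp measurable_fst).mul (hn.comp measurable_snd)).mul_const _).mul hk.meas.inv
  refine ⟨fun z => S.indicator (fun _ => (1 : ℝ)) z.1 * n z.2 * m⁻¹ * (k z)⁻¹, hrm, ?_,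
    ⟨m⁻¹ * k0⁻¹, ?_⟩, ?_, ?_⟩
  · intro z
    have := hi0 z.1; have := hn0 z.2; have := hk.kpos z
    positivity
  · intro z
    have h1 : S.indicator (fun _ => (1 : ℝ)) z.1 * n z.2 ≤ 1 :=
      mul_le_one₀ (hi1 _) (hn0 _) (hn1 _)
    have h2 : (k z)⁻¹ ≤ k0⁻¹ := inv_anti₀ hk.pos (hk.le z)
    have := hk.kpos z
    calc S.indicator (fun _ => (1 : ℝ)) z.1 * n z.2 * m⁻¹ * (k z)⁻¹ ≤ 1 * m⁻¹ * k0⁻¹ := by gcongr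
      _ = _ := by ring
  · intro z hz h0
    have := (hk.kpos z).ne'
    simpa [hz, hm0.ne', this] using h0
  · rw [densMeas_densMeas hk.meas (fun z => (hk.kpos z).le) hrm]
    have hw : (fun z : X × Y => k z * (S.indicator (fun _ => (1 : ℝ)) z.1 * n z.2 * m⁻¹ * (k z)⁻¹))
        = fun z => S.indicator (fun _ => (1 : ℝ)) z.1 * (m⁻¹ * n z.2) := by
      ext z
      have := (hk.kpos z).ne'
      field_simp
    have hwm : Measurable fun z : X × Y => S.indicator (fun _ => (1 : ℝ)) z.1 * (m⁻¹ * n z.2) :=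
      (him.comp measurable_fst).mul ((hn.comp measurable_snd).const_mul _)
    rw [hw]
    have hofi : ∀ x, ENNReal.ofReal (S.indicator (fun _ => (1 : ℝ)) x)
        = S.indicator (1 : X → ℝ≥0∞) x := fun x => by
      by_cases h : x ∈ S <;> simp [h]
    have hminv : (ENNReal.ofReal m⁻¹) * μ S = 1 := by
      rw [← hofm, ← ENNReal.ofReal_mul (by positivity), inv_mul_cancel₀ hm0.ne', ENNReal.ofReal_one]
    have hnint : ∫⁻ y, ENNReal.ofReal (n y) ∂ν = μ S := by
      rw [← hmass, densMeas, withDensity_apply _ MeasurableSet.univ, Measure.restrict_univ]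
    constructor
    · rw [map_fst_densMeas hwm, ← withDensity_indicator_one hS]
      congr 1
      ext x
      simp_rw [ENNReal.ofReal_mul (hi0 x), ENNReal.ofReal_mul (inv_pos.2 hm0).le, hofi]
      rw [lintegral_const_mul _ (hn.ennreal_ofReal.const_mul _),
        lintegral_const_mul _ hn.ennreal_ofReal, hnint, hminv, mul_one]
    · rw [map_snd_densMeas hwm, densMeas]
      congr 1
      ext y
      simp_rw [ENNReal.ofReal_mul (hi0 _), ENNReal.ofReal_mul (inv_pos.2 hm0).le, hofi]
      rw [lintegral_mul_const _ (measurable_one.indicator hS), lintegral_indicator_one hS,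
        ← mul_assoc, mul_comm (μ S), hminv, one_mul]

end Factorization

section ProductForm

variable {X Y : Type*} [MeasurableSpace X] [MeasurableSpace Y] {μ : Measure X} {ν : Measure Y}
  {k : X × Y → ℝ} {k0 : ℝ}

lemma exists_density_le_one [IsFiniteMeasure ν] {ν' : Measure Y} (h : ν' ≤ ν) :
    ∃ n : Y → ℝ, Measurable n ∧ (∀ y, 0 ≤ n y) ∧ (∀ y, n y ≤ 1) ∧ ν' = densMeas ν n := by
  have hfin : IsFiniteMeasure ν' := isFiniteMeasure_of_le ν h
  refine ⟨fun y => min (ν'.rnDeriv ν y).toReal 1,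
    (Measure.measurable_rnDeriv _ _).ennreal_toReal.min measurable_const,
    fun y => le_min ENNReal.toReal_nonneg zero_le_one, fun y => min_le_right _ _, ?_⟩
  conv_lhs => rw [← Measure.withDensity_rnDeriv_eq ν' ν h.absolutelyContinuous]
  refine withDensity_congr_ae ?_
  filter_upwards [Measure.rnDeriv_le_one_of_le h] with y hy
  have hne : ν'.rnDeriv ν y ≠ ⊤ := (hy.trans_lt ENNReal.one_lt_top).ne
  rw [min_eq_left (by simpa using ENNReal.toReal_mono ENNReal.one_ne_top hy),
    ENNReal.ofReal_toReal hne]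

/-- The product density `u ⊗ v` with `a ≤ u ≤ b`, `0 < a`, `0 ≤ v`, and a Harnack inequality
for `u`. -/
structure ProductForm (k0 : ℝ) (u : X → ℝ) (v : Y → ℝ) (a b : ℝ) : Prop where
  meas_u : Measurable u
  meas_v : Measurable v
  pos : 0 < a
  le_u : ∀ x, a ≤ u x
  u_le : ∀ x, u x ≤ b
  harnack : ∀ x x', u x ≤ k0⁻¹ * u x'
  v_nonneg : ∀ y, 0 ≤ v y

variable [IsProbabilityMeasure μ] [IsProbabilityMeasure ν]

lemma IsOptPlan.exists_isOptDensity_of_le (hk : KernelBound k k0) {S : Set X}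
    (hS : MeasurableSet S) (hS0 : μ S ≠ 0) {ν' : Measure Y} (hν : ν' ≤ ν)
    (hmass : ν' Set.univ = μ S) {πJ : Measure (X × Y)}
    (h : IsOptPlan (densMeas (μ.prod ν) k) (μ.restrict S) ν' πJ) :
    ∃ s, IsOptDensity (densMeas (μ.prod ν) k) (μ.restrict S) ν' s ∧
      πJ = densMeas (densMeas (μ.prod ν) k) s := by
  have hfin := hk.isFiniteMeasure (μ.prod ν)
  obtain ⟨n, hn, hn0, hn1, rfl⟩ := exists_density_le_one hν
  obtain ⟨r, hr, hr0, ⟨C, hC⟩, -, hmem⟩ := reference_density hk hS hS0 hn hn0 hn1 hmass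
  refine h.exists_isOptDensity (ne_top_of_le_ne_top ?_ (h.2 _ hmem))
  exact (KL_densMeas_ne_top_iff hr hr0).2 (integrable_phi_of_bounded hr hr0 hC)

/-- The optimal density is positive exactly on the product of the supports of the marginals. -/
lemma IsOptDensity.ae_pos_iff (hk : KernelBound k k0) {S : Set X}
    (hS : MeasurableSet S) (hS0 : μ S ≠ 0) {n : Y → ℝ} (hn : Measurable n) (hn0 : ∀ y, 0 ≤ n y)
    (hn1 : ∀ y, n y ≤ 1) (hmass : densMeas ν n Set.univ = μ S) {s : X × Y → ℝ}
    (h : IsOptDensity (densMeas (μ.prod ν) k) (μ.restrict S) (densMeas ν n) s) :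
    ∀ᵐ z ∂μ.prod ν, 0 < s z ↔ z.1 ∈ S ∧ 0 < n z.2 := by
  have hfin := hk.isFiniteMeasure (μ.prod ν)
  obtain ⟨r, hr, hr0, ⟨C, hC⟩, hrn, hmem⟩ := reference_density hk hS hS0 hn hn0 hn1 hmass
  have hri : Integrable r (densMeas (μ.prod ν) k) :=
    (integrable_const C).mono' hr.aestronglyMeasurable (ae_of_all _ fun z => by
      rw [Real.norm_of_nonneg (hr0 z)]; exact hC z)
  have h1 := h.ae_eq_zero_of_eq_zero hr hr0 hri (integrable_phi_of_bounded hr hr0 hC) hmem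
  have h2 : ∀ᵐ z ∂densMeas (μ.prod ν) k, z ∈ Prod.fst ⁻¹' Sᶜ → s z = 0 := by
    refine ae_eq_zero_of_densMeas_eq_zero h.meas h.nonneg ?_
    rw [← Measure.map_apply measurable_fst hS.compl, h.mem.1, Measure.restrict_apply hS.compl,
      Set.compl_inter_self, measure_empty]
  have hn' : MeasurableSet (n ⁻¹' {0}) := hn (measurableSet_singleton 0)
  have h3 : ∀ᵐ z ∂densMeas (μ.prod ν) k, z ∈ Prod.snd ⁻¹' (n ⁻¹' {0}) → s z = 0 := by
    refine ae_eq_zero_of_densMeas_eq_zero h.meas h.nonneg ?_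
    rw [← Measure.map_apply measurable_snd hn', h.mem.2, densMeas,
      withDensity_apply_eq_zero hn.ennreal_ofReal]
    refine measure_mono_null (t := ∅) ?_ measure_empty
    rintro y ⟨hy, hy'⟩
    exact hy (by rw [show n y = 0 from hy']; simp)
  rw [ae_densMeas_iff_of_pos hk.meas hk.pos hk.le] at h1 h2 h3
  filter_upwards [h1, h2, h3] with z h1 h2 h3
  constructor
  · intro hs
    refine ⟨by_contra fun hz => hs.ne' (h2 hz),
      lt_of_le_of_ne (hn0 _) fun hz => hs.ne' (h3 hz.symm)⟩
  · rintro ⟨hz, hz'⟩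
    refine lt_of_le_of_ne (h.nonneg z) fun h0 => hz'.ne' (hrn z hz (h1 h0.symm))

/-- Optimal densities are of product form, with quantitative bounds on the first factor. -/
lemma IsOptDensity.exists_product_form (hk : KernelBound k k0) {S : Set X}
    (hS : MeasurableSet S) (hS0 : μ S ≠ 0) {ν' : Measure Y} (hν : ν' ≤ ν)
    (hmass : ν' Set.univ = μ S) {s : X × Y → ℝ}
    (h : IsOptDensity (densMeas (μ.prod ν) k) (μ.restrict S) ν' s) :
    ∃ (u : X → ℝ) (v : Y → ℝ) (a b : ℝ), ProductForm k0 u v a b ∧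
      s =ᵐ[densMeas (μ.prod ν) k] fun z => S.indicator u z.1 * v z.2 := by
  obtain ⟨n, hn, hn0, hn1, rfl⟩ := exists_density_le_one hν
  have hcr := h.cross_ratio hk.meas hk.pos hk.le hk.le_one
  have hpos := h.ae_pos_iff hk hS hS0 hn hn0 hn1 hmass
  have hσ := measurePreserving_exchange μ ν
  have hs := h.meas
  have hfst : Measure.QuasiMeasurePreserving Prod.fst ((μ.prod ν).prod (μ.prod ν)) (μ.prod ν) :=
    Measure.quasiMeasurePreserving_fst
  have hsnd : Measure.QuasiMeasurePreserving Prod.snd ((μ.prod ν).prod (μ.prod ν)) (μ.prod ν) :=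
    Measure.quasiMeasurePreserving_snd
  have hcr' : ∀ᵐ q ∂(μ.prod ν).prod (μ.prod ν),
      s q.1 * s q.2 = s (exchange q).1 * s (exchange q).2 := by
    filter_upwards [hcr, hfst.ae hpos, hsnd.ae hpos,
      (hfst.comp hσ.quasiMeasurePreserving).ae hpos,
      (hsnd.comp hσ.quasiMeasurePreserving).ae hpos] with q hq h1 h2 h3 h4
    simp only [Function.comp_apply] at h3 h4
    by_cases hp : (q.1.1 ∈ S ∧ 0 < n q.1.2) ∧ (q.2.1 ∈ S ∧ 0 < n q.2.2)
    · exact hq (h1.2 hp.1) (h2.2 hp.2) (h3.2 ⟨hp.1.1, hp.2.2⟩) (h4.2 ⟨hp.2.1, hp.1.2⟩)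
    · have e1 : s q.1 * s q.2 = 0 := by
        by_contra h0
        rw [mul_eq_zero, not_or] at h0
        exact hp ⟨h1.1 (lt_of_le_of_ne (h.nonneg _) (Ne.symm h0.1)),
          h2.1 (lt_of_le_of_ne (h.nonneg _) (Ne.symm h0.2))⟩
      have e2 : s (exchange q).1 * s (exchange q).2 = 0 := by
        by_contra h0
        rw [mul_eq_zero, not_or] at h0
        have p1 := h3.1 (lt_of_le_of_ne (h.nonneg _) (Ne.symm h0.1))
        have p2 := h4.1 (lt_of_le_of_ne (h.nonneg _) (Ne.symm h0.2))
        exact hp ⟨⟨p1.1, p2.2⟩, ⟨p2.1, p1.2⟩⟩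
      rw [e1, e2]
  have hfreq : ∃ᶠ z in ae (μ.prod ν), 0 < s z := by
    intro hno
    have h0 : s =ᵐ[densMeas (μ.prod ν) k] fun _ => 0 := by
      refine (ae_densMeas_iff_of_pos hk.meas hk.pos hk.le).2 ?_
      filter_upwards [hno] with z hz
      exact le_antisymm (not_lt.1 hz) (h.nonneg z)
    have h1 := coupling_univ h.mem
    rw [densMeas_congr h0, Measure.restrict_apply_univ] at h1
    exact hS0 (by simpa [densMeas] using h1.symm)
  obtain ⟨z0, hz0, hprod⟩ := (hfreq.and_eventually (Measure.ae_ae_of_ae_prod hcr')).exists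
  set u0 : X → ℝ := fun x => s (x, z0.2) / s z0 with hu0
  set v : Y → ℝ := fun y => s (z0.1, y) with hv
  have hu0m : Measurable u0 := (hs.comp measurable_prodMk_right).div_const _
  have hvm : Measurable v := hs.comp measurable_prodMk_left
  have hv0 : ∀ y, 0 ≤ v y := fun y => h.nonneg _
  have hu00 : ∀ x, 0 ≤ u0 x := fun x => div_nonneg (h.nonneg _) hz0.le
  have hsuv : ∀ᵐ z ∂μ.prod ν, s z = u0 z.1 * v z.2 := by
    filter_upwards [hprod] with z hz
    simp only [exchange] at hz
    simp only [hu0, hv]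
    rw [div_mul_eq_mul_div, eq_div_iff hz0.ne', mul_comm (s z), hz, mul_comm]
  set V : ℝ≥0∞ := ∫⁻ y, ENNReal.ofReal (v y) ∂ν with hV
  set Z : X → ℝ≥0∞ := fun x => ∫⁻ y, ENNReal.ofReal (k (x, y) * v y) ∂ν with hZ
  have hZm : Measurable Z :=
    (hk.meas.mul (hvm.comp measurable_snd)).ennreal_ofReal.lintegral_prod_right'
  have hZV : ∀ x, Z x ≤ V := fun x => lintegral_mono fun y => ENNReal.ofReal_le_ofReal
    (mul_le_of_le_one_left (hv0 y) (hk.le_one _))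
  have hVZ : ∀ x, ENNReal.ofReal k0 * V ≤ Z x := fun x => by
    rw [hV, ← lintegral_const_mul _ hvm.ennreal_ofReal]
    refine lintegral_mono fun y => ?_
    rw [← ENNReal.ofReal_mul hk.pos.le]
    exact ENNReal.ofReal_le_ofReal (mul_le_mul_of_nonneg_right (hk.le _) (hv0 y))
  have hmarg : ∀ᵐ x ∂μ, ENNReal.ofReal (u0 x) * Z x = S.indicator 1 x := by
    have h1 := h.mem.1
    have hks : Measurable fun z => k z * s z := hk.meas.mul hs
    rw [densMeas_densMeas hk.meas (fun z => (hk.kpos z).le) hs, map_fst_densMeas hks,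
      ← withDensity_indicator_one hS, withDensity_eq_iff_of_sigmaFinite
        (hks.ennreal_ofReal.lintegral_prod_right').aemeasurable
        (measurable_one.indicator hS).aemeasurable] at h1
    filter_upwards [h1, Measure.ae_ae_of_ae_prod hsuv] with x hx hx'
    rw [← hx, hZ]
    simp only
    have hkv : Measurable fun y => k (x, y) * v y :=
      (hk.meas.comp measurable_prodMk_left).mul hvm
    rw [← lintegral_const_mul _ hkv.ennreal_ofReal]
    refine lintegral_congr_ae ?_
    filter_upwards [hx'] with y hy
    rw [hy, ← ENNReal.ofReal_mul (hu00 x)]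
    congr 1
    ring
  obtain ⟨x0, hx0S, hx0⟩ : ∃ x ∈ S, ENNReal.ofReal (u0 x) * Z x = 1 := by
    have : ∃ᶠ x in ae μ, x ∈ S := frequently_ae_mem_iff.2 hS0
    obtain ⟨x, hx, hx'⟩ := (this.and_eventually hmarg).exists
    exact ⟨x, hx, by simpa [hx] using hx'⟩
  have hZ0 : Z x0 ≠ 0 := fun h0 => by simp [h0] at hx0
  have hu0ne : ENNReal.ofReal (u0 x0) ≠ 0 := fun h0 => by simp [h0] at hx0
  have hZT : Z x0 ≠ ⊤ := fun h0 => by rw [h0, ENNReal.mul_top hu0ne] at hx0; simp at hx0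
  have hk0' : ENNReal.ofReal k0 ≠ 0 := by simpa using hk.pos
  have hV0 : V ≠ 0 := fun h0 => hZ0 (le_antisymm ((hZV x0).trans h0.le) zero_le)
  have hVT : V ≠ ⊤ := fun h0 => by
    have := hVZ x0
    rw [h0, ENNReal.mul_top hk0'] at this
    exact hZT (top_le_iff.1 this)
  have hVp : 0 < V.toReal := ENNReal.toReal_pos hV0 hVT
  have hZT' : ∀ x, Z x ≠ ⊤ := fun x => ne_top_of_le_ne_top hVT (hZV x)
  have hz1 : ∀ x, (Z x).toReal ≤ V.toReal := fun x => ENNReal.toReal_mono hVT (hZV x)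
  have hz2 : ∀ x, k0 * V.toReal ≤ (Z x).toReal := fun x => by
    have := ENNReal.toReal_mono (hZT' x) (hVZ x)
    rwa [ENNReal.toReal_mul, ENNReal.toReal_ofReal hk.pos.le] at this
  have hkV : 0 < k0 * V.toReal := mul_pos hk.pos hVp
  have hzp : ∀ x, 0 < (Z x).toReal := fun x => hkV.trans_le (hz2 x)
  have hua : ∀ x, V.toReal⁻¹ ≤ (Z x).toReal⁻¹ := fun x => inv_anti₀ (hzp x) (hz1 x)
  have hub : ∀ x, (Z x).toReal⁻¹ ≤ k0⁻¹ * V.toReal⁻¹ := fun x => by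
    rw [← mul_inv]; exact inv_anti₀ hkV (hz2 x)
  refine ⟨fun x => (Z x).toReal⁻¹, v, V.toReal⁻¹, k0⁻¹ * V.toReal⁻¹, ⟨hZm.ennreal_toReal.inv, hvm,
    inv_pos.2 hVp, hua, hub, fun x x' => (hub x).trans ?_, hv0⟩, ?_⟩
  · exact mul_le_mul_of_nonneg_left (hua x') (inv_pos.2 hk.pos).le
  · refine (ae_densMeas_iff_of_pos hk.meas hk.pos hk.le).2 ?_
    have hq : Measure.QuasiMeasurePreserving Prod.fst (μ.prod ν) μ :=
      Measure.quasiMeasurePreserving_fst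
    filter_upwards [hsuv, hq.ae hmarg] with z hz hz'
    rw [hz]
    congr 1
    by_cases hS' : z.1 ∈ S
    · rw [Set.indicator_of_mem hS'] at hz' ⊢
      have := congrArg ENNReal.toReal hz'
      rw [ENNReal.toReal_mul, ENNReal.toReal_ofReal (hu00 _)] at this
      exact eq_inv_of_mul_eq_one_left (by simpa using this)
    · rw [Set.indicator_of_notMem hS'] at hz' ⊢
      rcases mul_eq_zero.1 hz' with h0 | h0
      · exact le_antisymm (ENNReal.ofReal_eq_zero.1 h0) (hu00 _)
      · exact absurd (by rw [h0]; simp) (hzp z.1).ne'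

end ProductForm

section Restriction

variable {X Y : Type*} [MeasurableSpace X] [MeasurableSpace Y]

/-- The marginal on `Y` of the part of `π` over `S`. -/
def cellMarginal (π : Measure (X × Y)) (S : Set X) : Measure Y :=
  (π.restrict (S ×ˢ Set.univ)).map Prod.snd

lemma map_fst_restrict {π : Measure (X × Y)} {S : Set X} (hS : MeasurableSet S) :
    (π.restrict (S ×ˢ Set.univ)).map Prod.fst = (π.map Prod.fst).restrict S := by
  rw [Set.prod_univ, Measure.restrict_map measurable_fst hS]

lemma cellMarginal_le {μ : Measure X} {ν : Measure Y} {π : Measure (X × Y)}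
    (h : π ∈ Coupling μ ν) (S : Set X) : cellMarginal π S ≤ ν :=
  h.2 ▸ Measure.map_mono Measure.restrict_le_self measurable_snd

lemma cellMarginal_univ {μ : Measure X} {ν : Measure Y} {π : Measure (X × Y)}
    (h : π ∈ Coupling μ ν) {S : Set X} (hS : MeasurableSet S) :
    cellMarginal π S Set.univ = μ S := by
  rw [cellMarginal, Measure.map_apply measurable_snd MeasurableSet.univ, Set.preimage_univ,
    Measure.restrict_apply_univ, Set.prod_univ, ← Measure.map_apply measurable_fst hS, h.1]

lemma cellMarginal_add {π : Measure (X × Y)} {S T : Set X} (hT : MeasurableSet T)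
    (hd : Disjoint S T) (hU : S ∪ T = Set.univ) :
    cellMarginal π S + cellMarginal π T = π.map Prod.snd := by
  rw [cellMarginal, cellMarginal, ← Measure.map_add _ _ measurable_snd,
    ← Measure.restrict_union (Set.disjoint_prod.2 (Or.inl hd)) (hT.prod MeasurableSet.univ),
    ← Set.union_prod, hU, Set.univ_prod_univ, Measure.restrict_univ]

lemma coupling_add_cells {μ : Measure X} {ν : Measure Y} {π πa πb : Measure (X × Y)}
    (h : π ∈ Coupling μ ν) {S T : Set X} (hT : MeasurableSet T) (hd : Disjoint S T)
    (hU : S ∪ T = Set.univ) (ha : πa ∈ Coupling (μ.restrict S) (cellMarginal π S))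
    (hb : πb ∈ Coupling (μ.restrict T) (cellMarginal π T)) : πa + πb ∈ Coupling μ ν := by
  constructor
  · rw [Measure.map_add _ _ measurable_fst, ha.1, hb.1, ← Measure.restrict_union hd hT, hU,
      Measure.restrict_univ]
  · rw [Measure.map_add _ _ measurable_snd, ha.2, hb.2, cellMarginal_add hT hd hU, h.2]

lemma phi_add_of_disjoint {a b : ℝ} (h : a = 0 ∨ b = 0) : phi (a + b) = phi a + phi b - 1 := by
  rcases h with rfl | rfl <;> simp [phi]

lemma integrable_phi_indicator {Z : Type*} [MeasurableSpace Z] {K : Measure Z} [IsFiniteMeasure K]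
    {s : Z → ℝ} (h : Integrable (fun z => phi (s z)) K) {A : Set Z} (hA : MeasurableSet A) :
    Integrable (fun z => phi (A.indicator s z)) K := by
  have : (fun z => phi (A.indicator s z))
      = fun z => A.indicator (fun z => phi (s z)) z + Aᶜ.indicator (fun _ => (1 : ℝ)) z := by
    ext z
    by_cases hz : z ∈ A <;> simp [hz, phi]
  rw [this]
  exact (h.indicator hA).add ((integrable_const 1).indicator hA.compl)

lemma integral_phi_add_of_disjoint {Z : Type*} [MeasurableSpace Z] {K : Measure Z}
    [IsFiniteMeasure K] {s t : Z → ℝ} (hs : Integrable (fun z => phi (s z)) K)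
    (ht : Integrable (fun z => phi (t z)) K) (h : ∀ z, s z = 0 ∨ t z = 0) :
    Integrable (fun z => phi (s z + t z)) K ∧
      ∫ z, phi (s z + t z) ∂K = ∫ z, phi (s z) ∂K + ∫ z, phi (t z) ∂K - ∫ _, (1 : ℝ) ∂K := by
  have e : (fun z => phi (s z + t z)) = fun z => phi (s z) + phi (t z) - 1 :=
    funext fun z => phi_add_of_disjoint (h z)
  rw [e]
  refine ⟨(hs.add ht).sub (integrable_const 1), ?_⟩
  have h1 : Integrable (fun z => phi (s z) + phi (t z)) K := hs.add ht
  rw [integral_sub h1 (integrable_const 1), integral_add hs ht]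

/-- The restriction of an optimal plan to a cell is optimal for its own marginals. -/
lemma IsOptDensity.indicator {K : Measure (X × Y)} [IsFiniteMeasure K] {μh : Measure X}
    {νh : Measure Y} {s : X × Y → ℝ} (h : IsOptDensity K μh νh s) {P : Set X}
    (hP : MeasurableSet P) :
    IsOptDensity K (μh.restrict P) (cellMarginal (densMeas K s) P)
      ((P ×ˢ Set.univ).indicator s) := by
  have hA : MeasurableSet (P ×ˢ (Set.univ : Set Y)) := hP.prod MeasurableSet.univ
  set A := P ×ˢ (Set.univ : Set Y) with hAdef
  refine ⟨h.meas.indicator hA, fun z => Set.indicator_nonneg (fun z _ => h.nonneg z) z,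
    h.int.indicator hA, integrable_phi_indicator h.int_phi hA, ?_, ?_⟩
  · rw [← restrict_densMeas hA]
    exact ⟨by rw [map_fst_restrict hP, h.mem.1], rfl⟩
  · intro e he he0 hem heφ
    have heA : e =ᵐ[K] A.indicator e := by
      have : ∀ᵐ z ∂K, z ∈ Aᶜ → e z = 0 := by
        refine ae_eq_zero_of_densMeas_eq_zero he he0 ?_
        rw [hAdef, Set.prod_univ, ← Set.preimage_compl, ← Measure.map_apply measurable_fst hP.compl,
          hem.1, Measure.restrict_apply hP.compl, Set.compl_inter_self, measure_empty]
      filter_upwards [this] with z hz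
      by_cases hzA : z ∈ A
      · simp [hzA]
      · rw [Set.indicator_of_notMem hzA, hz hzA]
    have hs' : ∀ z, A.indicator s z + Aᶜ.indicator s z = s z := fun z =>
      congrFun (Set.indicator_self_add_compl A s) z
    have d1 := integral_phi_add_of_disjoint (integrable_phi_indicator h.int_phi hA)
      (integrable_phi_indicator h.int_phi hA.compl)
      (fun z => by by_cases hz : z ∈ A <;> simp [hz])
    have d2 := integral_phi_add_of_disjoint (integrable_phi_indicator heφ hA)
      (integrable_phi_indicator h.int_phi hA.compl)
      (fun z => by by_cases hz : z ∈ A <;> simp [hz])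
    simp only [hs'] at d1
    have hce : ∫ z, phi (A.indicator e z) ∂K = ∫ z, phi (e z) ∂K :=
      integral_congr_ae (heA.symm.mono fun z hz => by simp only [hz])
    have hAe0 : ∀ z, 0 ≤ A.indicator e z := fun z => Set.indicator_nonneg (fun z _ => he0 z) z
    have hAs0 : ∀ z, 0 ≤ Aᶜ.indicator s z := fun z =>
      Set.indicator_nonneg (fun z _ => h.nonneg z) z
    have hmem : densMeas K (fun z => A.indicator e z + Aᶜ.indicator s z) ∈ Coupling μh νh := by
      have hAc : Aᶜ = Pᶜ ×ˢ (Set.univ : Set Y) := by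
        rw [hAdef, Set.prod_univ, Set.prod_univ, Set.preimage_compl]
      rw [densMeas_add (he.indicator hA) hAe0 hAs0, densMeas_congr heA.symm,
        ← restrict_densMeas hA.compl, hAc]
      refine coupling_add_cells h.mem hP.compl disjoint_compl_right (Set.union_compl_self P) hem
        ⟨by rw [map_fst_restrict hP.compl, h.mem.1], rfl⟩
    have := h.le (fun z => A.indicator e z + Aᶜ.indicator s z)
      ((he.indicator hA).add (h.meas.indicator hA.compl))
      (fun z => add_nonneg (hAe0 z) (hAs0 z)) hmem d2.1
    linarith [d1.2, d2.2]

end Restriction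

section Dual

variable {X Y : Type*} [MeasurableSpace X] [MeasurableSpace Y]

lemma mul_phi_div {s g : ℝ} (hs : 0 ≤ s) (hg : 0 < g) :
    g * phi (s / g) = phi s - s * Real.log g + g - 1 := by
  rcases hs.eq_or_lt with rfl | hs
  · simp [phi]
  · unfold phi
    rw [Real.log_div hs.ne' hg.ne']
    field_simp
    ring

lemma integral_mul_fst {K : Measure (X × Y)} {s : X × Y → ℝ} (hs : Measurable s)
    (hs0 : ∀ z, 0 ≤ s z) {f : X → ℝ} (hf : Measurable f) :
    ∫ z, s z * f z.1 ∂K = ∫ x, f x ∂(densMeas K s).map Prod.fst := by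
  rw [integral_map measurable_fst.aemeasurable hf.aestronglyMeasurable, integral_densMeas hs hs0]

lemma integral_mul_snd {K : Measure (X × Y)} {s : X × Y → ℝ} (hs : Measurable s)
    (hs0 : ∀ z, 0 ≤ s z) {f : Y → ℝ} (hf : Measurable f) :
    ∫ z, s z * f z.2 ∂K = ∫ y, f y ∂(densMeas K s).map Prod.snd := by
  rw [integral_map measurable_snd.aemeasurable hf.aestronglyMeasurable, integral_densMeas hs hs0]

lemma exists_abs_log_le {Z : Type*} {f : Z → ℝ} {a b : ℝ} (ha : 0 < a) (hl : ∀ z, a ≤ f z)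
    (hu : ∀ z, f z ≤ b) : ∃ C, ∀ z, |Real.log (f z)| ≤ C := by
  refine ⟨|Real.log a| + |Real.log b|, fun z => ?_⟩
  have h1 := Real.log_le_log ha (hl z)
  have h2 := Real.log_le_log (ha.trans_le (hl z)) (hu z)
  rw [abs_le]
  constructor
  · linarith [neg_abs_le (Real.log a), abs_nonneg (Real.log b)]
  · linarith [le_abs_self (Real.log b), abs_nonneg (Real.log a)]

variable {K : Measure (X × Y)} [IsFiniteMeasure K] {α : X → ℝ} {β : Y → ℝ} {a b a' b' : ℝ}

/-- Divergence relative to a product reference density, in terms of the marginals. -/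
lemma integral_mul_phi_div (hα : Measurable α) (hβ : Measurable β) (ha : 0 < a)
    (hαl : ∀ x, a ≤ α x) (hαu : ∀ x, α x ≤ b) (ha' : 0 < a') (hβl : ∀ y, a' ≤ β y)
    (hβu : ∀ y, β y ≤ b') {μh : Measure X} {νh : Measure Y} {s : X × Y → ℝ}
    (hs : Measurable s) (hs0 : ∀ z, 0 ≤ s z) (hsi : Integrable s K)
    (hsφ : Integrable (fun z => phi (s z)) K) (hmem : densMeas K s ∈ Coupling μh νh) :
    Integrable (fun z => α z.1 * β z.2 * phi (s z / (α z.1 * β z.2))) K ∧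
    ∫ z, α z.1 * β z.2 * phi (s z / (α z.1 * β z.2)) ∂K =
      ∫ z, phi (s z) ∂K - ∫ x, Real.log (α x) ∂μh - ∫ y, Real.log (β y) ∂νh
        + ∫ z, (α z.1 * β z.2 - 1) ∂K := by
  have hαp : ∀ x, 0 < α x := fun x => ha.trans_le (hαl x)
  have hβp : ∀ y, 0 < β y := fun y => ha'.trans_le (hβl y)
  obtain ⟨C, hC⟩ := exists_abs_log_le ha hαl hαu
  obtain ⟨C', hC'⟩ := exists_abs_log_le ha' hβl hβu
  have hlα : Measurable fun x => Real.log (α x) := Real.measurable_log.comp hα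
  have hlβ : Measurable fun y => Real.log (β y) := Real.measurable_log.comp hβ
  have i1 : Integrable (fun z => s z * Real.log (α z.1)) K :=
    hsi.mul_bdd (hlα.comp measurable_fst).aestronglyMeasurable (ae_of_all _ fun z => hC z.1)
  have i2 : Integrable (fun z => s z * Real.log (β z.2)) K :=
    hsi.mul_bdd (hlβ.comp measurable_snd).aestronglyMeasurable (ae_of_all _ fun z => hC' z.2)
  have i3 : Integrable (fun z => α z.1 * β z.2 - 1) K := by
    refine Integrable.sub ((integrable_const (b * b')).mono'
      ((hα.comp measurable_fst).mul (hβ.comp measurable_snd)).aestronglyMeasurable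
      (ae_of_all _ fun z => ?_)) (integrable_const 1)
    have h1 := hαp z.1; have h2 := hβp z.2
    rw [Real.norm_of_nonneg (by positivity)]
    exact mul_le_mul (hαu _) (hβu _) h2.le (h1.le.trans (hαu _))
  have e : (fun z => α z.1 * β z.2 * phi (s z / (α z.1 * β z.2))) = fun z =>
      phi (s z) - s z * Real.log (α z.1) - s z * Real.log (β z.2) + (α z.1 * β z.2 - 1) := by
    ext z
    rw [mul_phi_div (hs0 z) (mul_pos (hαp _) (hβp _)), Real.log_mul (hαp _).ne' (hβp _).ne']
    ring
  rw [e]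
  have j1 : Integrable (fun z => phi (s z) - s z * Real.log (α z.1)) K := hsφ.sub i1
  have j2 : Integrable (fun z => phi (s z) - s z * Real.log (α z.1) - s z * Real.log (β z.2)) K :=
    j1.sub i2
  refine ⟨j2.add i3, ?_⟩
  rw [integral_add j2 i3, integral_sub j1 i2, integral_sub hsφ i1,
    integral_mul_fst hs hs0 hlα, integral_mul_snd hs hs0 hlβ, hmem.1, hmem.2]

end Dual

section Step

variable {X Y : Type*} [MeasurableSpace X] [MeasurableSpace Y] {μ : Measure X} {ν : Measure Y}
  {k : X × Y → ℝ} {k0 : ℝ} {u : X → ℝ} {v : Y → ℝ} {a b : ℝ}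

namespace ProductForm

lemma u_pos (h : ProductForm k0 u v a b) (x : X) : 0 < u x := h.pos.trans_le (h.le_u x)

lemma measurable_cell (h : ProductForm k0 u v a b) {S : Set X} (hS : MeasurableSet S) :
    Measurable fun z : X × Y => S.indicator u z.1 * v z.2 :=
  ((h.meas_u.indicator hS).comp measurable_fst).mul (h.meas_v.comp measurable_snd)

lemma cell_nonneg (h : ProductForm k0 u v a b) (S : Set X) (z : X × Y) :
    0 ≤ S.indicator u z.1 * v z.2 :=
  mul_nonneg (Set.indicator_nonneg (fun x _ => (h.u_pos x).le) _) (h.v_nonneg _)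

end ProductForm

variable [IsProbabilityMeasure μ] [IsProbabilityMeasure ν]

lemma IsOptPlan.exists_cell_form (hk : KernelBound k k0) {π : Measure (X × Y)}
    (hπ : π ∈ Coupling μ ν) {S : Set X} (hS : MeasurableSet S) (hS0 : μ S ≠ 0)
    {πJ : Measure (X × Y)}
    (h : IsOptPlan (densMeas (μ.prod ν) k) (μ.restrict S) (cellMarginal π S) πJ) :
    ∃ (u : X → ℝ) (v : Y → ℝ) (a b : ℝ), ProductForm k0 u v a b ∧
      IsOptDensity (densMeas (μ.prod ν) k) (μ.restrict S) (cellMarginal π S)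
        (fun z => S.indicator u z.1 * v z.2) ∧
      πJ = densMeas (densMeas (μ.prod ν) k) fun z => S.indicator u z.1 * v z.2 := by
  have hν := cellMarginal_le hπ S
  have hmass := cellMarginal_univ hπ hS
  obtain ⟨s, hs, rfl⟩ := h.exists_isOptDensity_of_le hk hS hS0 hν hmass
  obtain ⟨u, v, a, b, huv, hsuv⟩ := hs.exists_product_form hk hS hS0 hν hmass
  exact ⟨u, v, a, b, huv, hs.congr (huv.measurable_cell hS) (huv.cell_nonneg S) hsuv,
    densMeas_congr hsuv⟩

/-- Two-sided bounds on the `Y`-factor of the optimal plan over a cell `T` that overlaps the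
previous composite cell in `Q`. -/
lemma ProductForm.ae_bounds (huv : ProductForm k0 u v a b) (hk : KernelBound k k0)
    {Q T : Set X} (hQ : MeasurableSet Q) (hT : MeasurableSet T) (hQT : Q ⊆ T) (hQ0 : μ Q ≠ 0)
    {s : X × Y → ℝ} (hs : Measurable s) (hs0 : ∀ z, 0 ≤ s z)
    (hsν : (densMeas (densMeas (μ.prod ν) k) s).map Prod.snd = ν)
    {v1 : Y → ℝ} {a1 b1 : ℝ} (hv1 : ∀ y, 0 ≤ v1 y) (ha1 : 0 < a1) (hb1 : 0 ≤ b1)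
    (hsT : ∀ z : X × Y, z.1 ∉ T → s z ≤ b1 * v1 z.2)
    (hsQ : ∀ z : X × Y, z.1 ∈ Q → a1 * v1 z.2 ≤ s z)
    (hmarg : (densMeas (densMeas (μ.prod ν) k) fun z => T.indicator u z.1 * v z.2).map Prod.snd =
      cellMarginal (densMeas (densMeas (μ.prod ν) k) s) T) :
    ∃ c C : ℝ, 0 < c ∧ ∀ᵐ y ∂ν, c ≤ v y ∧ v y ≤ C := by
  have hk0 : ∀ z, 0 ≤ k z := fun z => (hk.kpos z).le
  have hTu : MeasurableSet (T ×ˢ (Set.univ : Set Y)) := hT.prod MeasurableSet.univ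
  set A := T ×ˢ (Set.univ : Set Y) with hA
  have hT0 : μ T ≠ 0 := fun h => hQ0 (measure_mono_null hQT h)
  have mT : Measurable fun z => k z * A.indicator s z := hk.meas.mul (hs.indicator hTu)
  have mTc : Measurable fun z => k z * Aᶜ.indicator s z := hk.meas.mul (hs.indicator hTu.compl)
  have muv : Measurable fun z : X × Y => k z * (T.indicator u z.1 * v z.2) :=
    hk.meas.mul (huv.measurable_cell hT)
  set q : Y → ℝ≥0∞ := fun y => ∫⁻ x, ENNReal.ofReal (k (x, y) * A.indicator s (x, y)) ∂μ with hq
  set p : Y → ℝ≥0∞ := fun y => ∫⁻ x, ENNReal.ofReal (k (x, y) * Aᶜ.indicator s (x, y)) ∂μ with hp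
  have hpq : ∀ᵐ y ∂ν, p y + q y = 1 := by
    have mks : Measurable fun z => k z * s z := hk.meas.mul hs
    rw [densMeas_densMeas hk.meas hk0 hs, map_snd_densMeas mks] at hsν
    conv_rhs at hsν => rw [← withDensity_one (μ := ν)]
    rw [withDensity_eq_iff_of_sigmaFinite
      mks.ennreal_ofReal.lintegral_prod_left'.aemeasurable measurable_one.aemeasurable] at hsν
    filter_upwards [hsν] with y hy
    rw [Pi.one_apply] at hy
    rw [← hy, hp, hq]
    simp only
    have mTcy : Measurable fun x => k (x, y) * Aᶜ.indicator s (x, y) :=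
      mTc.comp measurable_prodMk_right
    rw [← lintegral_add_left mTcy.ennreal_ofReal]
    refine lintegral_congr fun x => ?_
    by_cases hx : (x, y) ∈ A <;> simp [hx]
  have hquv : ∀ᵐ y ∂ν, ∫⁻ x, ENNReal.ofReal (k (x, y) * (T.indicator u x * v y)) ∂μ = q y := by
    rw [cellMarginal, restrict_densMeas hTu, densMeas_densMeas hk.meas hk0 (hs.indicator hTu),
      densMeas_densMeas hk.meas hk0 (huv.measurable_cell hT), map_snd_densMeas mT,
      map_snd_densMeas muv, withDensity_eq_iff_of_sigmaFinite
        muv.ennreal_ofReal.lintegral_prod_left'.aemeasurable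
        mT.ennreal_ofReal.lintegral_prod_left'.aemeasurable] at hmarg
    exact hmarg
  have lower : ∀ (S : Set X), MeasurableSet S → ∀ (r : ℝ), 0 ≤ r → ∀ f : X → ℝ≥0∞,
      (∀ x ∈ S, ENNReal.ofReal r ≤ f x) → ENNReal.ofReal (r * (μ S).toReal) ≤ ∫⁻ x, f x ∂μ := by
    intro S hS r hr f hf
    rw [ENNReal.ofReal_mul hr, ENNReal.ofReal_toReal (measure_ne_top _ _), ← setLIntegral_const]
    exact (setLIntegral_mono' hS hf).trans (setLIntegral_le_lintegral _ _)
  have upper : ∀ (r : ℝ) (f : X → ℝ≥0∞), (∀ x, f x ≤ ENNReal.ofReal r) →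
      ∫⁻ x, f x ∂μ ≤ ENNReal.ofReal r := fun r f hf =>
    (lintegral_mono hf).trans (by simp)
  have hb0 : 0 < b := by
    obtain ⟨x, -⟩ := nonempty_of_measure_ne_zero hQ0
    exact (huv.u_pos x).trans_le (huv.u_le x)
  set mQ := (μ Q).toReal with hmQ
  set mT' := (μ T).toReal with hmT
  have hmQp : 0 < mQ := ENNReal.toReal_pos hQ0 (measure_ne_top _ _)
  have hmTp : 0 < mT' := ENNReal.toReal_pos hT0 (measure_ne_top _ _)
  have ha := huv.pos
  have hkp := hk.pos
  set D := b1 * b / (k0 * a1 * mQ) + b with hD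
  have hDp : 0 < D := by positivity
  refine ⟨D⁻¹, (k0 * a * mT')⁻¹, inv_pos.2 hDp, ?_⟩
  filter_upwards [hpq, hquv] with y hpq hquv
  have hv := huv.v_nonneg y
  have hv1 := hv1 y
  have hqT : q y ≠ ⊤ := fun h => by simp [h] at hpq
  have hpT : p y ≠ ⊤ := fun h => by simp [h] at hpq
  have e1 : (p y).toReal + (q y).toReal = 1 := by
    rw [← ENNReal.toReal_add hpT hqT, hpq, ENNReal.toReal_one]
  have e2 : (q y).toReal ≤ b * v y := by
    refine ENNReal.toReal_le_of_le_ofReal (by positivity) ?_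
    rw [← hquv]
    refine upper _ _ fun x => ENNReal.ofReal_le_ofReal ?_
    have : T.indicator u x ≤ b := by
      by_cases hx : x ∈ T
      · simpa [hx] using huv.u_le x
      · simpa [hx] using hb0.le
    calc k (x, y) * (T.indicator u x * v y) ≤ 1 * (b * v y) :=
          mul_le_mul (hk.le_one _) (mul_le_mul_of_nonneg_right this hv)
            (huv.cell_nonneg T (x, y)) zero_le_one
      _ = b * v y := one_mul _
  have e3 : k0 * a * v y * mT' ≤ (q y).toReal := by
    refine (ENNReal.ofReal_le_iff_le_toReal hqT).1 ?_
    rw [← hquv]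
    refine lower T hT _ (by positivity) _ fun x hx => ENNReal.ofReal_le_ofReal ?_
    rw [Set.indicator_of_mem hx, mul_assoc]
    exact mul_le_mul (hk.le _) (mul_le_mul_of_nonneg_right (huv.le_u x) hv) (by positivity)
      (hk0 _)
  have e4 : k0 * (a1 * v1 y) * mQ ≤ (q y).toReal := by
    refine (ENNReal.ofReal_le_iff_le_toReal hqT).1 ?_
    refine lower Q hQ _ (by positivity) _ fun x hx => ENNReal.ofReal_le_ofReal ?_
    rw [Set.indicator_of_mem (show (x, y) ∈ A from ⟨hQT hx, trivial⟩)]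
    exact mul_le_mul (hk.le _) (hsQ (x, y) hx) (by positivity) (hk0 _)
  have e5 : (p y).toReal ≤ b1 * v1 y := by
    refine ENNReal.toReal_le_of_le_ofReal (by positivity) ?_
    refine upper _ _ fun x => ENNReal.ofReal_le_ofReal ?_
    by_cases hx : x ∈ T
    · have : (x, y) ∈ A := ⟨hx, trivial⟩
      simp only [Set.indicator_compl, Pi.sub_apply, Set.indicator_of_mem this, sub_self, mul_zero]
      positivity
    · have : (x, y) ∈ Aᶜ := fun h => hx h.1
      rw [Set.indicator_of_mem this]
      exact (mul_le_of_le_one_left (hs0 _) (hk.le_one _)).trans (hsT (x, y) hx)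
  constructor
  · rw [inv_le_iff_one_le_mul₀ hDp]
    have h1 : v1 y ≤ b * v y / (k0 * a1 * mQ) := by
      rw [le_div_iff₀ (by positivity)]
      linarith
    have h2 := mul_le_mul_of_nonneg_left h1 hb1
    calc 1 ≤ b1 * (b * v y / (k0 * a1 * mQ)) + b * v y := by linarith
      _ = v y * D := by rw [hD]; ring
  · rw [← one_div, le_div_iff₀ (by positivity)]
    linarith [ENNReal.toReal_nonneg (a := p y)]

end Step

section Contraction

variable {X Y : Type*} [MeasurableSpace X] [MeasurableSpace Y]

/-- Densities with respect to `K` of plans in `Π(μh, νh)` of finite divergence. -/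
structure IsPlanDensity (K : Measure (X × Y)) (μh : Measure X) (νh : Measure Y)
    (s : X × Y → ℝ) : Prop where
  meas : Measurable s
  nonneg : ∀ z, 0 ≤ s z
  int : Integrable s K
  int_phi : Integrable (fun z => phi (s z)) K
  mem : densMeas K s ∈ Coupling μh νh

lemma IsOptDensity.isPlanDensity {K : Measure (X × Y)} {μh : Measure X} {νh : Measure Y}
    {s : X × Y → ℝ} (h : IsOptDensity K μh νh s) : IsPlanDensity K μh νh s :=
  ⟨h.meas, h.nonneg, h.int, h.int_phi, h.mem⟩

variable {μ : Measure X} {ν : Measure Y} [IsProbabilityMeasure μ] [IsProbabilityMeasure ν]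
  {k : X × Y → ℝ} {k0 : ℝ} {u u1 : X → ℝ} {v v1 : Y → ℝ} {a b a1 b1 c C : ℝ}

/-- One step of domain decomposition contracts the suboptimality: `s'` is the current density,
of product form `u1 ⊗ v1` over `Tᶜ ∪ Q`, and `s` is the next one, of product form `u ⊗ v`
over `T`. -/
lemma contraction_of_product_form (hk : KernelBound k k0) {Q T : Set X} (hQ : MeasurableSet Q)
    (hT : MeasurableSet T) (hQT : Q ⊆ T) (hQ0 : μ Q ≠ 0) (h1 : ProductForm k0 u1 v1 a1 b1)
    (huv : ProductForm k0 u v a b) (hc : 0 < c) (hvl : ∀ y, c ≤ v y) (hvu : ∀ y, v y ≤ C)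
    {s' s sopt : X × Y → ℝ} (hs' : IsPlanDensity (densMeas (μ.prod ν) k) μ ν s')
    (hs : IsPlanDensity (densMeas (μ.prod ν) k) μ ν s)
    (hopt : IsPlanDensity (densMeas (μ.prod ν) k) μ ν sopt)
    (e' : ∀ᵐ z ∂densMeas (μ.prod ν) k, z.1 ∉ T ∨ z.1 ∈ Q → s' z = u1 z.1 * v1 z.2)
    (eT : ∀ᵐ z ∂densMeas (μ.prod ν) k, z.1 ∈ T → s z = u z.1 * v z.2)
    (eTc : ∀ᵐ z ∂densMeas (μ.prod ν) k, z.1 ∉ T → s z = u1 z.1 * v1 z.2) :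
    k0 ^ 2 * (μ Q).toReal * (∫ z, phi (s z) ∂densMeas (μ.prod ν) k
        - ∫ z, phi (sopt z) ∂densMeas (μ.prod ν) k) ≤
      (μ Tᶜ).toReal * (∫ z, phi (s' z) ∂densMeas (μ.prod ν) k
        - ∫ z, phi (s z) ∂densMeas (μ.prod ν) k) := by
  have hfin := hk.isFiniteMeasure (μ.prod ν)
  have hk0 : ∀ z, 0 ≤ k z := fun z => (hk.kpos z).le
  have hkp := hk.pos
  have hvp : ∀ y, 0 < v y := fun y => hc.trans_le (hvl y)
  have hup := huv.u_pos
  have hu1p := h1.u_pos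
  set G : X × Y → ℝ := fun z => u z.1 * v z.2 * phi (u1 z.1 * v1 z.2 / (u z.1 * v z.2)) with hG
  have hG0 : ∀ z, 0 ≤ G z := fun z => mul_nonneg (mul_pos (hup _) (hvp _)).le
    (phi_nonneg (div_nonneg (mul_nonneg (hu1p _).le (h1.v_nonneg _))
      (mul_pos (hup _) (hvp _)).le))
  have muv : Measurable fun z : X × Y => u z.1 * v z.2 :=
    (huv.meas_u.comp measurable_fst).mul (huv.meas_v.comp measurable_snd)
  have muv1 : Measurable fun z : X × Y => u1 z.1 * v1 z.2 :=
    (h1.meas_u.comp measurable_fst).mul (h1.meas_v.comp measurable_snd)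
  have hGm : Measurable G := muv.mul (measurable_phi.comp (muv1.div muv))
  have hkG : Measurable fun z => k z * G z := hk.meas.mul hGm
  set H : X → ℝ≥0∞ := fun x => ∫⁻ y, ENNReal.ofReal (k (x, y) * G (x, y)) ∂ν with hH
  have hHm : Measurable H := hkG.ennreal_ofReal.lintegral_prod_right'
  obtain ⟨x2, hx2Q, hx2⟩ := exists_le_setLAverage hQ0 (measure_ne_top μ Q) hHm.aemeasurable
  rw [setLAverage_eq, ENNReal.le_div_iff_mul_le (Or.inl hQ0) (Or.inl (measure_ne_top _ _))] at hx2
  set t : ℝ := u x2 / u1 x2 with ht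
  have htp : 0 < t := div_pos (hup _) (hu1p _)
  classical
  set α : X → ℝ := fun x => if x ∈ T then u x else t * u1 x with hα
  have hαm : Measurable α := Measurable.ite hT huv.meas_u (h1.meas_u.const_mul _)
  have hαl : ∀ x, min a (t * a1) ≤ α x := fun x => by
    by_cases hx : x ∈ T
    · simpa [hα, hx] using Or.inl (huv.le_u x)
    · simpa [hα, hx] using Or.inr (mul_le_mul_of_nonneg_left (h1.le_u x) htp.le)
  have hαu : ∀ x, α x ≤ max b (t * b1) := fun x => by
    by_cases hx : x ∈ T
    · simpa [hα, hx] using Or.inl (huv.u_le x)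
    · simpa [hα, hx] using Or.inr (mul_le_mul_of_nonneg_left (h1.u_le x) htp.le)
  have hα0 : 0 < min a (t * a1) := lt_min huv.pos (mul_pos htp h1.pos)
  have hαp : ∀ x, 0 < α x := fun x => hα0.trans_le (hαl x)
  set F : (X × Y → ℝ) → X × Y → ℝ := fun w z =>
    α z.1 * v z.2 * phi (w z / (α z.1 * v z.2)) with hF
  have dual : ∀ w, IsPlanDensity (densMeas (μ.prod ν) k) μ ν w → _ := fun w hw =>
    integral_mul_phi_div (K := densMeas (μ.prod ν) k) hαm huv.meas_v hα0 hαl hαu hc hvl hvu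
      hw.meas hw.nonneg hw.int hw.int_phi hw.mem
  have hF0 : ∀ w, (∀ z, 0 ≤ w z) → ∀ z, 0 ≤ F w z := fun w hw z =>
    mul_nonneg (mul_pos (hαp _) (hvp _)).le
      (phi_nonneg (div_nonneg (hw z) (mul_pos (hαp _) (hvp _)).le))
  have hFm : ∀ w, Measurable w → Measurable (F w) := fun w hw => by
    have : Measurable fun z : X × Y => α z.1 * v z.2 :=
      (hαm.comp measurable_fst).mul (huv.meas_v.comp measurable_snd)
    exact this.mul (measurable_phi.comp (hw.div this))
  obtain ⟨i', I'⟩ := dual s' hs'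
  obtain ⟨i, I⟩ := dual s hs
  obtain ⟨-, Iopt⟩ := dual sopt hopt
  have hJopt : 0 ≤ ∫ z, F sopt z ∂densMeas (μ.prod ν) k := integral_nonneg (hF0 _ hopt.nonneg)
  have hQu : MeasurableSet (Q ×ˢ (Set.univ : Set Y)) := hQ.prod MeasurableSet.univ
  set A := Q ×ˢ (Set.univ : Set Y) with hA
  have hFsT : ∀ᵐ z ∂densMeas (μ.prod ν) k, z.1 ∈ T → F s z = 0 := by
    filter_upwards [eT] with z hz hzT
    have hne := (mul_pos (hup z.1) (hvp z.2)).ne'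
    simp only [hF, hα, hzT, if_true, hz hzT, div_self hne, phi_one, mul_zero]
  have gain : ∫ z, F s z ∂densMeas (μ.prod ν) k + ∫ z in A, F s' z ∂densMeas (μ.prod ν) k ≤
      ∫ z, F s' z ∂densMeas (μ.prod ν) k := by
    rw [← integral_indicator hQu, ← integral_add i (i'.indicator hQu)]
    refine integral_mono_ae (i.add (i'.indicator hQu)) i' ?_
    filter_upwards [hFsT, eTc, e'] with z h1 h2 h3
    by_cases hzT : z.1 ∈ T
    · change F s z + A.indicator (F s') z ≤ F s' z
      rw [h1 hzT, zero_add]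
      exact Set.indicator_le_self' (fun _ _ => hF0 _ hs'.nonneg _) z
    · have hzA : z ∉ A := fun h => hzT (hQT h.1)
      change F s z + A.indicator (F s') z ≤ F s' z
      rw [Set.indicator_of_notMem hzA, add_zero]
      simp only [hF, h2 hzT, h3 (Or.inl hzT), le_refl]
  have hJ : ENNReal.ofReal (∫ z in A, F s' z ∂densMeas (μ.prod ν) k) = ∫⁻ x in Q, H x ∂μ := by
    rw [ofReal_integral_eq_lintegral_ofReal i'.integrableOn (ae_of_all _ (hF0 _ hs'.nonneg))]
    have e1 : ∀ᵐ z ∂(densMeas (μ.prod ν) k).restrict A,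
        ENNReal.ofReal (F s' z) = ENNReal.ofReal (G z) := by
      refine (ae_restrict_iff' hQu).2 ?_
      filter_upwards [e'] with z hz hzA
      have hzQ : z.1 ∈ Q := hzA.1
      simp only [hF, hα, hG, hQT hzQ, if_true, hz (Or.inr hzQ)]
    have e2 : (densMeas (μ.prod ν) k).restrict A = densMeas ((μ.restrict Q).prod ν) k := by
      rw [densMeas, restrict_withDensity hQu, hA, ← Measure.prod_restrict, Measure.restrict_univ]
      rfl
    rw [lintegral_congr_ae e1, e2, lintegral_densMeas hk.meas hGm.ennreal_ofReal]
    simp_rw [← ENNReal.ofReal_mul (hk0 _)]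
    rw [lintegral_prod _ hkG.ennreal_ofReal.aemeasurable]
  have hloss : ENNReal.ofReal (∫ z, F s z ∂densMeas (μ.prod ν) k) ≤
      μ Tᶜ * (ENNReal.ofReal (k0⁻¹ ^ 2) * H x2) := by
    rw [ofReal_integral_eq_lintegral_ofReal i (ae_of_all _ (hF0 _ hs.nonneg)),
      lintegral_densMeas hk.meas (hFm s hs.meas).ennreal_ofReal]
    have hk2 : Measurable fun y => k (x2, y) * G (x2, y) := hkG.comp measurable_prodMk_left
    have e3 : μ Tᶜ * (ENNReal.ofReal (k0⁻¹ ^ 2) * H x2) = ∫⁻ z, Tᶜ.indicator 1 z.1 *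
        (ENNReal.ofReal (k0⁻¹ ^ 2) * ENNReal.ofReal (k (x2, z.2) * G (x2, z.2))) ∂μ.prod ν := by
      rw [lintegral_prod_mul (measurable_one.indicator hT.compl).aemeasurable
        (hk2.ennreal_ofReal.const_mul _).aemeasurable, lintegral_indicator_one hT.compl,
        lintegral_const_mul _ hk2.ennreal_ofReal]
    rw [e3]
    refine lintegral_mono_ae ?_
    filter_upwards [(ae_densMeas_iff_of_pos hk.meas hk.pos hk.le).1 hFsT,
      (ae_densMeas_iff_of_pos hk.meas hk.pos hk.le).1 eTc] with z h2 h3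
    by_cases hzT : z.1 ∈ T
    · simp [h2 hzT]
    rw [Set.indicator_of_mem (show z.1 ∈ Tᶜ from hzT), Pi.one_apply, one_mul,
      ← ENNReal.ofReal_mul (hk0 _), ← ENNReal.ofReal_mul (by positivity)]
    refine ENNReal.ofReal_le_ofReal ?_
    have hu12 := hu1p x2
    have hu2 := hup x2
    have hv2 := hvp z.2
    have hu1z := hu1p z.1
    have hratio : u1 z.1 * v1 z.2 / (t * u1 z.1 * v z.2) = v1 z.2 / (t * v z.2) := by
      field_simp
    have hratio2 : u1 x2 * v1 z.2 / (u x2 * v z.2) = v1 z.2 / (t * v z.2) := by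
      rw [ht]; field_simp
    have hFz : F s z = t * u1 z.1 * v z.2 * phi (v1 z.2 / (t * v z.2)) := by
      simp only [hF, hα, hzT, if_false, h3 hzT, hratio]
    have hGz : G (x2, z.2) = t * u1 x2 * v z.2 * phi (v1 z.2 / (t * v z.2)) := by
      simp only [hG, hratio2]
      rw [ht, div_mul_cancel₀ _ hu12.ne']
    have hφ : 0 ≤ phi (v1 z.2 / (t * v z.2)) :=
      phi_nonneg (div_nonneg (h1.v_nonneg _) (by positivity))
    have hkk : k z ≤ k0⁻¹ * k (x2, z.2) := by
      rw [← div_eq_inv_mul, le_div_iff₀ hkp]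
      calc k z * k0 ≤ 1 * k (x2, z.2) := mul_le_mul (hk.le_one _) (hk.le _) hkp.le zero_le_one
        _ = _ := one_mul _
    have hk2p := hk.kpos (x2, z.2)
    rw [hFz, hGz]
    calc k z * (t * u1 z.1 * v z.2 * phi (v1 z.2 / (t * v z.2)))
        ≤ (k0⁻¹ * k (x2, z.2)) *
          (t * (k0⁻¹ * u1 x2) * v z.2 * phi (v1 z.2 / (t * v z.2))) := by
          gcongr
          exact h1.harnack _ _
      _ = _ := by ring
  have hHT : H x2 ≠ ⊤ := fun h => by
    rw [h, ENNReal.top_mul hQ0, ← hJ] at hx2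
    exact ENNReal.ofReal_ne_top (top_le_iff.1 hx2)
  have hJ0 : 0 ≤ ∫ z in A, F s' z ∂densMeas (μ.prod ν) k := integral_nonneg (hF0 _ hs'.nonneg)
  have g1 : (H x2).toReal * (μ Q).toReal ≤ ∫ z in A, F s' z ∂densMeas (μ.prod ν) k := by
    rw [← ENNReal.toReal_mul]
    exact ENNReal.toReal_le_of_le_ofReal hJ0 (hx2.trans hJ.ge)
  have g2 : ∫ z, F s z ∂densMeas (μ.prod ν) k
      ≤ (μ Tᶜ).toReal * (k0⁻¹ ^ 2 * (H x2).toReal) := by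
    have hne : μ Tᶜ * (ENNReal.ofReal (k0⁻¹ ^ 2) * H x2) ≠ ⊤ :=
      ENNReal.mul_ne_top (measure_ne_top _ _) (ENNReal.mul_ne_top ENNReal.ofReal_ne_top hHT)
    have := (ENNReal.ofReal_le_iff_le_toReal hne).1 hloss
    rwa [ENNReal.toReal_mul, ENNReal.toReal_mul, ENNReal.toReal_ofReal (by positivity)] at this
  have hE : ∫ z, phi (s z) ∂densMeas (μ.prod ν) k - ∫ z, phi (sopt z) ∂densMeas (μ.prod ν) k
      ≤ ∫ z, F s z ∂densMeas (μ.prod ν) k := by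
    linarith only [I, Iopt, hJopt]
  have hE' : ∫ z in A, F s' z ∂densMeas (μ.prod ν) k
      ≤ ∫ z, phi (s' z) ∂densMeas (μ.prod ν) k - ∫ z, phi (s z) ∂densMeas (μ.prod ν) k := by
    linarith only [I, I', gain]
  calc _ ≤ k0 ^ 2 * (μ Q).toReal * ((μ Tᶜ).toReal * (k0⁻¹ ^ 2 * (H x2).toReal)) :=
        mul_le_mul_of_nonneg_left (hE.trans g2) (by positivity)
    _ = (μ Tᶜ).toReal * ((H x2).toReal * (μ Q).toReal) := by
        field_simp
    _ ≤ _ := mul_le_mul_of_nonneg_left (g1.trans hE') ENNReal.toReal_nonneg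

end Contraction

section Convergence

variable {X Y : Type*} [MeasurableSpace X] [MeasurableSpace Y]

lemma IsPlanDensity.add_cells {K : Measure (X × Y)} [IsFiniteMeasure K] {μ : Measure X}
    {ν : Measure Y} {π : Measure (X × Y)} (h : π ∈ Coupling μ ν) {S T : Set X}
    (hT : MeasurableSet T) (hd : Disjoint S T) (hU : S ∪ T = Set.univ) {sa sb : X × Y → ℝ}
    (ha : IsOptDensity K (μ.restrict S) (cellMarginal π S) sa)
    (hb : IsOptDensity K (μ.restrict T) (cellMarginal π T) sb)
    (h0 : ∀ z, sa z = 0 ∨ sb z = 0) : IsPlanDensity K μ ν fun z => sa z + sb z where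
  meas := ha.meas.add hb.meas
  nonneg z := add_nonneg (ha.nonneg z) (hb.nonneg z)
  int := ha.int.add hb.int
  int_phi := (integral_phi_add_of_disjoint ha.int_phi hb.int_phi h0).1
  mem := by
    rw [densMeas_add ha.meas ha.nonneg hb.nonneg]
    exact coupling_add_cells h hT hd hU ha.mem hb.mem

lemma IsPlanDensity.integral_eq_one {K : Measure (X × Y)} {μ : Measure X} {ν : Measure Y}
    [IsProbabilityMeasure μ] {s : X × Y → ℝ} (h : IsPlanDensity K μ ν s) : ∫ z, s z ∂K = 1 := by
  have h1 := coupling_univ h.mem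
  rw [densMeas, withDensity_apply _ MeasurableSet.univ, Measure.restrict_univ,
    ← ofReal_integral_eq_lintegral_ofReal h.int (ae_of_all _ h.nonneg), measure_univ,
    ENNReal.ofReal_eq_one] at h1
  exact h1

/-- Suboptimality controls the total variation distance to the minimizer. -/
lemma IsOptDensity.integral_abs_sub_le {K : Measure (X × Y)} {μ : Measure X} {ν : Measure Y}
    [IsProbabilityMeasure μ] {s sopt : X × Y → ℝ} (hopt : IsOptDensity K μ ν sopt)
    (hs : IsPlanDensity K μ ν s) {lam : ℝ} (hl : 0 < lam) :
    ∫ z, |s z - sopt z| ∂K ≤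
      2 * lam + lam⁻¹ * (∫ z, phi (s z) ∂K - ∫ z, phi (sopt z) ∂K) := by
  have h1 := integral_abs_sub_le_phi_midpoint hs.meas hs.nonneg hopt.meas hopt.nonneg hs.int
    hopt.int hs.int_phi hopt.int_phi hl
  rw [hs.integral_eq_one, hopt.isPlanDensity.integral_eq_one] at h1
  have h2 := hopt.le _ ((hs.meas.add hopt.meas).div_const 2)
    (fun z => by have := hs.nonneg z; have := hopt.nonneg z; simp only [Pi.add_apply]; positivity)
    (densMeas_midpoint_mem hs.meas hs.nonneg hs.mem hopt.meas hopt.nonneg hopt.mem)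
    (integrable_phi_midpoint hs.meas hs.nonneg hopt.meas hopt.nonneg hs.int_phi hopt.int_phi)
  simp only [Pi.add_apply] at h2
  have h3 := mul_le_mul_of_nonneg_left h2 (inv_pos.2 hl).le
  linarith

lemma IsOptDensity.KL_sub_KL {K : Measure (X × Y)} [SigmaFinite K] {μ : Measure X}
    {ν : Measure Y} {s sopt : X × Y → ℝ} (hopt : IsOptDensity K μ ν sopt)
    (hs : IsPlanDensity K μ ν s) :
    KL (densMeas K s) K - KL (densMeas K sopt) K =
      ENNReal.ofReal (∫ z, phi (s z) ∂K - ∫ z, phi (sopt z) ∂K) := by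
  rw [KL_densMeas_eq_ofReal hs.meas hs.nonneg hs.int_phi,
    KL_densMeas_eq_ofReal hopt.meas hopt.nonneg hopt.int_phi,
    ENNReal.ofReal_sub _ (integral_nonneg fun z => phi_nonneg (hopt.nonneg z))]

/-- Weak distance to the minimizer, in terms of the suboptimality. -/
lemma IsOptDensity.abs_integral_sub_le {K : Measure (X × Y)} {μ : Measure X}
    {ν : Measure Y} [IsProbabilityMeasure μ] {s sopt : X × Y → ℝ}
    (hopt : IsOptDensity K μ ν sopt) (hs : IsPlanDensity K μ ν s) {lam : ℝ} (hl : 0 < lam)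
    {f : X × Y → ℝ} (hf : Measurable f) {M : ℝ} (hM : 0 ≤ M) (hfM : ∀ z, |f z| ≤ M) :
    |∫ z, f z ∂densMeas K s - ∫ z, f z ∂densMeas K sopt| ≤
      M * (2 * lam + lam⁻¹ * (∫ z, phi (s z) ∂K - ∫ z, phi (sopt z) ∂K)) := by
  have hi : ∀ {t : X × Y → ℝ}, Integrable t K → Integrable (fun z => t z * f z) K := fun ht =>
    ht.mul_bdd (c := M) hf.aestronglyMeasurable (ae_of_all _ hfM)
  rw [integral_densMeas hs.meas hs.nonneg, integral_densMeas hopt.meas hopt.nonneg,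
    ← integral_sub (hi hs.int) (hi hopt.int)]
  calc |∫ z, (s z * f z - sopt z * f z) ∂K| ≤ ∫ z, M * |s z - sopt z| ∂K := by
        rw [← Real.norm_eq_abs]
        refine norm_integral_le_of_norm_le (((hs.int.sub hopt.int).abs).const_mul M)
          (ae_of_all _ fun z => ?_)
        rw [← sub_mul, Real.norm_eq_abs, abs_mul, mul_comm]
        exact mul_le_mul_of_nonneg_right (hfM z) (abs_nonneg _)
    _ = M * ∫ z, |s z - sopt z| ∂K := integral_const_mul _ _
    _ ≤ _ := mul_le_mul_of_nonneg_left (hopt.integral_abs_sub_le hs hl) hM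

variable {μ : Measure X} {ν : Measure Y} [IsProbabilityMeasure μ] [IsProbabilityMeasure ν]
  {k : X × Y → ℝ} {k0 : ℝ}

/-- Two successive domain decomposition steps, on `{P ∪ Q, R}` and on `{P, Q ∪ R}`: the second
one contracts the suboptimality. -/
lemma contraction_step (hk : KernelBound k k0) {P Q R : Set X} (hP : MeasurableSet P)
    (hQ : MeasurableSet Q) (hR : MeasurableSet R) (hPQ : Disjoint P Q) (hPR : Disjoint P R)
    (hQR : Disjoint Q R) (hU : P ∪ Q ∪ R = Set.univ) (hP0 : μ P ≠ 0) (hQ0 : μ Q ≠ 0)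
    (hR0 : μ R ≠ 0) {π'' πa' πb' πa πb : Measure (X × Y)} {sopt : X × Y → ℝ}
    (hπ : π'' ∈ Coupling μ ν)
    (ha' : IsOptPlan (densMeas (μ.prod ν) k) (μ.restrict (P ∪ Q)) (cellMarginal π'' (P ∪ Q)) πa')
    (hb' : IsOptPlan (densMeas (μ.prod ν) k) (μ.restrict R) (cellMarginal π'' R) πb')
    (ha : IsOptPlan (densMeas (μ.prod ν) k) (μ.restrict P) (cellMarginal (πa' + πb') P) πa)
    (hb : IsOptPlan (densMeas (μ.prod ν) k) (μ.restrict (Q ∪ R))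
      (cellMarginal (πa' + πb') (Q ∪ R)) πb)
    (hopt : IsOptDensity (densMeas (μ.prod ν) k) μ ν sopt) :
    ∃ s' s, IsPlanDensity (densMeas (μ.prod ν) k) μ ν s' ∧
      πa' + πb' = densMeas (densMeas (μ.prod ν) k) s' ∧
      IsPlanDensity (densMeas (μ.prod ν) k) μ ν s ∧
      πa + πb = densMeas (densMeas (μ.prod ν) k) s ∧
      k0 ^ 2 * (μ Q).toReal * (∫ z, phi (s z) ∂densMeas (μ.prod ν) k
          - ∫ z, phi (sopt z) ∂densMeas (μ.prod ν) k) ≤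
        (μ P).toReal * (∫ z, phi (s' z) ∂densMeas (μ.prod ν) k
          - ∫ z, phi (s z) ∂densMeas (μ.prod ν) k) := by
  have hfin := hk.isFiniteMeasure (μ.prod ν)
  set K := densMeas (μ.prod ν) k with hK
  have hT : MeasurableSet (Q ∪ R) := hQ.union hR
  have hPT : Disjoint P (Q ∪ R) := hPQ.union_right hPR
  have hPQR : Disjoint (P ∪ Q) R := hPR.union_left hQR
  have hU' : P ∪ (Q ∪ R) = Set.univ := by rw [← Set.union_assoc, hU]
  have hTc : (Q ∪ R)ᶜ = P := (IsCompl.of_eq hPT.inter_eq hU').symm.compl_eq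
  have hQT : Q ⊆ Q ∪ R := Set.subset_union_left
  obtain ⟨u1, v1, a1, b1, h1, hs1, rfl⟩ := ha'.exists_cell_form hk hπ (hP.union hQ)
    (fun h => hP0 (measure_mono_null Set.subset_union_left h))
  obtain ⟨u3, v3, a3, b3, h3, hs3, rfl⟩ := hb'.exists_cell_form hk hπ hR hR0
  set s' : X × Y → ℝ := fun z =>
    (P ∪ Q).indicator u1 z.1 * v1 z.2 + R.indicator u3 z.1 * v3 z.2 with hs'def
  have hs' : IsPlanDensity K μ ν s' := IsPlanDensity.add_cells hπ hR hPQR hU hs1 hs3 fun z => by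
    by_cases hz : z.1 ∈ R
    · simp [Set.disjoint_right.1 hPQR hz]
    · simp [hz]
  have hπ' : densMeas K (fun z => (P ∪ Q).indicator u1 z.1 * v1 z.2)
      + densMeas K (fun z => R.indicator u3 z.1 * v3 z.2) = densMeas K s' :=
    (densMeas_add hs1.meas hs1.nonneg hs3.nonneg).symm
  have e1 : ∀ z : X × Y, z.1 ∈ P ∪ Q → s' z = u1 z.1 * v1 z.2 := fun z hz => by
    simp only [hs'def, Set.indicator_of_mem hz,
      Set.indicator_of_notMem (Set.disjoint_left.1 hPQR hz), zero_mul, add_zero]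
  rw [hπ'] at ha hb
  have hPu : MeasurableSet (P ×ˢ (Set.univ : Set Y)) := hP.prod MeasurableSet.univ
  have hsP : IsOptDensity K (μ.restrict P) (cellMarginal (densMeas K s') P)
      (fun z => P.indicator u1 z.1 * v1 z.2) := by
    have h := hs1.indicator hP
    have i1 : (P ×ˢ (Set.univ : Set Y)).indicator
        (fun z => (P ∪ Q).indicator u1 z.1 * v1 z.2) = fun z => P.indicator u1 z.1 * v1 z.2 := by
      ext z
      by_cases hz : z.1 ∈ P <;> simp [hz, Set.indicator]
    have i2 : (P ×ˢ (Set.univ : Set Y)).indicator s' = fun z => P.indicator u1 z.1 * v1 z.2 := by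
      ext z
      by_cases hz : z.1 ∈ P
      · rw [Set.indicator_of_mem (by simpa using hz), e1 z (Or.inl hz), Set.indicator_of_mem hz]
      · simp [hz]
    rw [cellMarginal, restrict_densMeas hPu, i1, ← i2, ← restrict_densMeas hPu,
      Measure.restrict_restrict hP, Set.inter_eq_left.2 Set.subset_union_left] at h
    rw [i2] at h
    exact h
  obtain ⟨sP, hsPo, rfl⟩ := ha.exists_isOptDensity_of_le hk hP hP0 (cellMarginal_le hs'.mem P)
    (cellMarginal_univ hs'.mem hP)
  obtain ⟨u, v, a, b, huv, hsT, rfl⟩ := hb.exists_cell_form hk hs'.mem hT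
    (fun h => hQ0 (measure_mono_null hQT h))
  obtain ⟨c, C, hc, hcC⟩ := huv.ae_bounds hk hQ hT hQT hQ0 hs'.meas hs'.nonneg hs'.mem.2
    h1.v_nonneg h1.pos (h1.pos.le.trans (by
      obtain ⟨x⟩ := nonempty_of_isProbabilityMeasure μ
      exact (h1.le_u x).trans (h1.u_le x)))
    (fun z hz => by
      have hzP : z.1 ∈ P := by rw [← hTc]; exact hz
      rw [e1 z (Or.inl hzP)]
      exact mul_le_mul_of_nonneg_right (h1.u_le _) (h1.v_nonneg _))
    (fun z hz => by
      rw [e1 z (Or.inr hz)]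
      exact mul_le_mul_of_nonneg_right (h1.le_u _) (h1.v_nonneg _)) hsT.mem.2
  set w : Y → ℝ := fun y => max c (min (v y) C) with hw
  have hwv : ∀ᵐ z ∂K, w z.2 = v z.2 := by
    rw [hK, ae_densMeas_iff_of_pos hk.meas hk.pos hk.le]
    filter_upwards [Measure.quasiMeasurePreserving_snd.ae hcC] with z hz
    rw [hw]
    simp only
    rw [min_eq_left hz.2, max_eq_right hz.1]
  have huw : ProductForm k0 u w a b := ⟨huv.meas_u,
    measurable_const.max (huv.meas_v.min measurable_const), huv.pos, huv.le_u, huv.u_le, huv.harnack,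
    fun y => hc.le.trans (le_max_left _ _)⟩
  set s : X × Y → ℝ := fun z => P.indicator u1 z.1 * v1 z.2 + (Q ∪ R).indicator u z.1 * v z.2
    with hsdef
  have hs : IsPlanDensity K μ ν s := IsPlanDensity.add_cells hs'.mem hT hPT hU' hsP hsT fun z => by
    by_cases hz : z.1 ∈ P
    · simp [Set.disjoint_left.1 hPT hz]
    · simp [hz]
  refine ⟨s', s, hs', hπ', hs, ?_, ?_⟩
  · rw [hsdef, densMeas_add hsP.meas hsP.nonneg hsT.nonneg, densMeas_congr (hsPo.ae_eq hsP)]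
  · have := contraction_of_product_form hk hQ hT hQT hQ0 h1 huw hc (fun y => le_max_left _ _)
      (fun y => max_le_max le_rfl (min_le_right _ _)) hs' hs hopt.isPlanDensity
      (ae_of_all _ fun z hz => e1 z (hz.imp (fun h => by rw [← hTc]; exact h) id))
      (by
        filter_upwards [hwv] with z hz hzT
        simp only [hsdef, hz, Set.indicator_of_mem hzT,
          Set.indicator_of_notMem (Set.disjoint_right.1 hPT hzT), zero_mul, zero_add])
      (ae_of_all _ fun z hz => by
        have hzP : z.1 ∈ P := by rw [← hTc]; exact hz
        simp only [hsdef, Set.indicator_of_mem hzP, Set.indicator_of_notMem hz, zero_mul,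
          add_zero])
    rwa [hTc] at this

/-- The contraction of `contraction_step`, in terms of the divergence. -/
lemma KL_contraction_step (hk : KernelBound k k0) {P Q R : Set X} (hP : MeasurableSet P)
    (hQ : MeasurableSet Q) (hR : MeasurableSet R) (hPQ : Disjoint P Q) (hPR : Disjoint P R)
    (hQR : Disjoint Q R) (hU : P ∪ Q ∪ R = Set.univ) (hP0 : μ P ≠ 0) (hQ0 : μ Q ≠ 0)
    (hR0 : μ R ≠ 0) {π'' πa' πb' πa πb : Measure (X × Y)} {sopt : X × Y → ℝ}
    (hπ : π'' ∈ Coupling μ ν)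
    (ha' : IsOptPlan (densMeas (μ.prod ν) k) (μ.restrict (P ∪ Q)) (cellMarginal π'' (P ∪ Q)) πa')
    (hb' : IsOptPlan (densMeas (μ.prod ν) k) (μ.restrict R) (cellMarginal π'' R) πb')
    (ha : IsOptPlan (densMeas (μ.prod ν) k) (μ.restrict P) (cellMarginal (πa' + πb') P) πa)
    (hb : IsOptPlan (densMeas (μ.prod ν) k) (μ.restrict (Q ∪ R))
      (cellMarginal (πa' + πb') (Q ∪ R)) πb)
    (hopt : IsOptDensity (densMeas (μ.prod ν) k) μ ν sopt) :
    (∃ s', IsPlanDensity (densMeas (μ.prod ν) k) μ ν s' ∧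
      πa' + πb' = densMeas (densMeas (μ.prod ν) k) s') ∧
    KL (πa + πb) (densMeas (μ.prod ν) k)
        - KL (densMeas (densMeas (μ.prod ν) k) sopt) (densMeas (μ.prod ν) k) ≤
      ENNReal.ofReal ((1 + k0 ^ 2 * (μ Q).toReal / (μ (P ∪ R)).toReal)⁻¹) *
        (KL (πa' + πb') (densMeas (μ.prod ν) k)
          - KL (densMeas (densMeas (μ.prod ν) k) sopt) (densMeas (μ.prod ν) k)) := by
  have hfin := hk.isFiniteMeasure (μ.prod ν)
  obtain ⟨s', s, hs', e', hs, e, h⟩ := contraction_step hk hP hQ hR hPQ hPR hQR hU hP0 hQ0 hR0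
    hπ ha' hb' ha hb hopt
  refine ⟨⟨s', hs', e'⟩, ?_⟩
  rw [e, e', hopt.KL_sub_KL hs, hopt.KL_sub_KL hs', ← ENNReal.ofReal_mul (by positivity)]
  refine ENNReal.ofReal_le_ofReal ?_
  have hE := hopt.le s hs.meas hs.nonneg hs.mem hs.int_phi
  have hp : 0 < (μ P).toReal := ENNReal.toReal_pos hP0 (measure_ne_top _ _)
  have hpm : (μ P).toReal ≤ (μ (P ∪ R)).toReal :=
    ENNReal.toReal_mono (measure_ne_top _ _) (measure_mono Set.subset_union_left)
  have hm : 0 < (μ (P ∪ R)).toReal := hp.trans_le hpm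
  have hκ : 0 ≤ k0 ^ 2 * (μ Q).toReal := by positivity
  have hE' := nonneg_of_mul_nonneg_right ((mul_nonneg hκ (sub_nonneg.2 hE)).trans h) hp
  have h2 := h.trans (mul_le_mul_of_nonneg_right hpm hE')
  rw [inv_mul_eq_div, le_div_iff₀ (by positivity)]
  rw [mul_comm (μ (P ∪ R)).toReal, ← div_le_iff₀ hm] at h2
  have h3 := (mul_div_right_comm (k0 ^ 2 * (μ Q).toReal) (∫ z, phi (s z) ∂densMeas (μ.prod ν) k
    - ∫ z, phi (sopt z) ∂densMeas (μ.prod ν) k) (μ (P ∪ R)).toReal)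
  linarith

end Convergence

/-- Theorem 4.2, linear convergence for the three-cell
decomposition: for the domain decomposition iterates with cells `X₁, X₂, X₃`,
composite partitions `{{1,2},{3}}` and `{{1},{2,3}}`, one has for `ℓ > 1`
`Δ(π^ℓ) ≤ (1 + exp(−2‖c‖/ε)·μ(X₂)/μ(X₁∪X₃))⁻¹ Δ(π^{ℓ−1})`; in particular
`Δ(π^ℓ) → 0` and `π^ℓ` converges weakly-* to the unique minimizer `π*`. -/
theorem three_cell_linear_convergence
    {X Y : Type*} [MetricSpace X] [CompactSpace X] [MeasurableSpace X] [BorelSpace X]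
    [MetricSpace Y] [CompactSpace Y] [MeasurableSpace Y] [BorelSpace Y]
    (μ : Measure X) (ν : Measure Y) [IsProbabilityMeasure μ] [IsProbabilityMeasure ν]
    (c : X × Y → ℝ) (hc : Measurable c) (cmax : ℝ)
    (hc0 : ∀ p, 0 ≤ c p) (hcmax : ∀ p, c p ≤ cmax)
    (ε : ℝ) (hε : 0 < ε)
    (X1 X2 X3 : Set X)
    (hm1 : MeasurableSet X1) (hm2 : MeasurableSet X2) (hm3 : MeasurableSet X3)
    (hd12 : Disjoint X1 X2) (hd13 : Disjoint X1 X3) (hd23 : Disjoint X2 X3)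
    (hcov : X1 ∪ X2 ∪ X3 = Set.univ)
    (hp1 : 0 < μ X1) (hp2 : 0 < μ X2) (hp3 : 0 < μ X3)
    (πopt : Measure (X × Y)) (hπopt : πopt ∈ Coupling μ ν)
    (hmin : ∀ π' ∈ Coupling μ ν, KL πopt (Kmeas μ ν c ε) ≤ KL π' (Kmeas μ ν c ε))
    (π : ℕ → Measure (X × Y)) (hπ0 : π 0 ∈ Coupling μ ν)
    (hstepA : ∀ ℓ : ℕ, 1 ≤ ℓ → Odd ℓ → ∃ πa πb : Measure (X × Y),
      π ℓ = πa + πb ∧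
      IsOptPlan (Kmeas μ ν c ε) (μ.restrict (X1 ∪ X2))
        (((π (ℓ - 1)).restrict ((X1 ∪ X2) ×ˢ Set.univ)).map Prod.snd) πa ∧
      IsOptPlan (Kmeas μ ν c ε) (μ.restrict X3)
        (((π (ℓ - 1)).restrict (X3 ×ˢ Set.univ)).map Prod.snd) πb)
    (hstepB : ∀ ℓ : ℕ, 1 ≤ ℓ → Even ℓ → ∃ πa πb : Measure (X × Y),
      π ℓ = πa + πb ∧
      IsOptPlan (Kmeas μ ν c ε) (μ.restrict X1)
        (((π (ℓ - 1)).restrict (X1 ×ˢ Set.univ)).map Prod.snd) πa ∧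
      IsOptPlan (Kmeas μ ν c ε) (μ.restrict (X2 ∪ X3))
        (((π (ℓ - 1)).restrict ((X2 ∪ X3) ×ˢ Set.univ)).map Prod.snd) πb) :
    (∀ ℓ : ℕ, 1 < ℓ →
      KL (π ℓ) (Kmeas μ ν c ε) - KL πopt (Kmeas μ ν c ε) ≤
        ENNReal.ofReal
          ((1 + Real.exp (-(2 * cmax) / ε) * (μ X2).toReal / (μ (X1 ∪ X3)).toReal)⁻¹) *
          (KL (π (ℓ - 1)) (Kmeas μ ν c ε) - KL πopt (Kmeas μ ν c ε))) ∧
    Tendsto (fun ℓ => KL (π ℓ) (Kmeas μ ν c ε) - KL πopt (Kmeas μ ν c ε)) atTop (𝓝 0) ∧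
    (∀ f : X × Y → ℝ, Continuous f →
      Tendsto (fun ℓ => ∫ p, f p ∂(π ℓ)) atTop (𝓝 (∫ p, f p ∂πopt))) := by
  set k : X × Y → ℝ := fun p => Real.exp (-c p / ε) with hkdef
  set k0 : ℝ := Real.exp (-cmax / ε) with hk0def
  have hk : KernelBound k k0 := by
    refine ⟨(hc.neg.div_const ε).exp, Real.exp_pos _, fun z => ?_, fun z => ?_⟩
    · exact Real.exp_le_exp.2 (div_le_div_of_nonneg_right (neg_le_neg (hcmax z)) hε.le)
    · exact Real.exp_le_one_iff.2 (div_nonpos_of_nonpos_of_nonneg (neg_nonpos.2 (hc0 z)) hε.le)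
  have hksq : Real.exp (-(2 * cmax) / ε) = k0 ^ 2 := by
    rw [hk0def, ← Real.exp_nat_mul]
    congr 1
    push_cast
    ring
  change (∀ π' ∈ Coupling μ ν,
    KL πopt (densMeas (μ.prod ν) k) ≤ KL π' (densMeas (μ.prod ν) k)) at hmin
  simp only [show Kmeas μ ν c ε = densMeas (μ.prod ν) k from rfl] at hstepA hstepB ⊢
  have hfin := hk.isFiniteMeasure (μ.prod ν)
  obtain ⟨sopt, hopt, rfl⟩ : ∃ s, IsOptDensity (densMeas (μ.prod ν) k) μ ν s ∧
      πopt = densMeas (densMeas (μ.prod ν) k) s := by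
    have h : IsOptPlan (densMeas (μ.prod ν) k) (μ.restrict Set.univ) ν πopt := by
      rw [Measure.restrict_univ]
      exact ⟨hπopt, hmin⟩
    have := h.exists_isOptDensity_of_le hk MeasurableSet.univ (by simp) le_rfl (by simp)
    rwa [Measure.restrict_univ] at this
  have hd12_3 : Disjoint (X1 ∪ X2) X3 := hd13.union_left hd23
  have hd1_23 : Disjoint X1 (X2 ∪ X3) := hd12.union_right hd13
  have hcov' : X1 ∪ (X2 ∪ X3) = Set.univ := by rw [← Set.union_assoc, hcov]
  have hmem : ∀ ℓ, π ℓ ∈ Coupling μ ν := by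
    intro ℓ
    induction ℓ with
    | zero => exact hπ0
    | succ n ih =>
      rcases Nat.even_or_odd (n + 1) with he | ho
      · obtain ⟨πa, πb, h, ha, hb⟩ := hstepB (n + 1) (by omega) he
        rw [h]
        exact coupling_add_cells ih (hm2.union hm3) hd1_23 hcov' ha.1 hb.1
      · obtain ⟨πa, πb, h, ha, hb⟩ := hstepA (n + 1) (by omega) ho
        rw [h]
        exact coupling_add_cells ih hm3 hd12_3 hcov ha.1 hb.1
  set K := densMeas (μ.prod ν) k with hK
  set q : ℝ := (1 + k0 ^ 2 * (μ X2).toReal / (μ (X1 ∪ X3)).toReal)⁻¹ with hq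
  have hstep : ∀ n, (∃ s, IsPlanDensity K μ ν s ∧ π (n + 1) = densMeas K s) ∧
      KL (π (n + 2)) K - KL (densMeas K sopt) K ≤
        ENNReal.ofReal q * (KL (π (n + 1)) K - KL (densMeas K sopt) K) := by
    intro n
    rcases Nat.even_or_odd n with he | ho
    · obtain ⟨πa', πb', h', ha', hb'⟩ := hstepA (n + 1) (by omega) he.add_one
      obtain ⟨πa, πb, h, ha, hb⟩ := hstepB (n + 2) (by omega) (he.add even_two)
      rw [show n + 2 - 1 = n + 1 from rfl, h'] at ha hb
      rw [h, h']
      exact KL_contraction_step hk hm1 hm2 hm3 hd12 hd13 hd23 hcov hp1.ne' hp2.ne' hp3.ne'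
        (hmem n) ha' hb' ha hb hopt
    · obtain ⟨πa', πb', h', ha', hb'⟩ := hstepB (n + 1) (by omega) ho.add_one
      obtain ⟨πa, πb, h, ha, hb⟩ := hstepA (n + 2) (by omega) (ho.add_even even_two)
      rw [add_comm πa' πb'] at h'
      rw [add_comm πa πb] at h
      rw [show n + 2 - 1 = n + 1 from rfl, h'] at ha hb
      rw [Set.union_comm X1 X2] at ha
      rw [Set.union_comm X2 X3] at hb'
      rw [h, h', hq, Set.union_comm X1 X3]
      refine KL_contraction_step hk hm3 hm2 hm1 hd23.symm hd13.symm hd12.symm ?_ hp3.ne' hp2.ne'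
        hp1.ne' (hmem n) hb' ha' hb ha hopt
      rw [← hcov, Set.union_comm, Set.union_comm X3, Set.union_assoc]
  have hq1 : ENNReal.ofReal q < 1 := by
    rw [ENNReal.ofReal_lt_one]
    have h2 := ENNReal.toReal_pos hp2.ne' (measure_ne_top _ _)
    have h13 : 0 < (μ (X1 ∪ X3)).toReal := ENNReal.toReal_pos
      (hp1.trans_le (measure_mono Set.subset_union_left)).ne' (measure_ne_top _ _)
    have := hk.pos
    exact inv_lt_one_of_one_lt₀ (by linarith [show
      0 < k0 ^ 2 * (μ X2).toReal / (μ (X1 ∪ X3)).toReal by positivity])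
  have hlim : Tendsto (fun ℓ => KL (π ℓ) K - KL (densMeas K sopt) K) atTop (𝓝 0) := by
    have hgeom : ∀ n, KL (π (n + 1)) K - KL (densMeas K sopt) K ≤
        ENNReal.ofReal q ^ n * (KL (π 1) K - KL (densMeas K sopt) K) := by
      intro n
      induction n with
      | zero => simp
      | succ n ih =>
        refine (hstep n).2.trans ?_
        rw [pow_succ', mul_assoc]
        gcongr
    have hD1 : KL (π 1) K - KL (densMeas K sopt) K ≠ ⊤ := by
      obtain ⟨s, hs, e⟩ := (hstep 0).1
      rw [zero_add] at e
      rw [e, hopt.KL_sub_KL hs]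
      exact ENNReal.ofReal_ne_top
    have h0 := ENNReal.Tendsto.mul_const (b := KL (π 1) K - KL (densMeas K sopt) K)
      (ENNReal.tendsto_pow_atTop_nhds_zero_of_lt_one hq1) (Or.inr hD1)
    rw [zero_mul] at h0
    exact (tendsto_add_atTop_iff_nat 1).1
      (tendsto_of_tendsto_of_tendsto_of_le_of_le tendsto_const_nhds h0 (fun _ => zero_le) hgeom)
  refine ⟨fun ℓ hℓ => ?_, hlim, fun f hf => ?_⟩
  · obtain ⟨n, rfl⟩ := Nat.exists_eq_add_of_le' hℓ
    rw [hksq]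
    exact (hstep n).2
  · obtain ⟨M, hM⟩ := (isCompact_range hf).isBounded.exists_norm_le
    have hfM : ∀ z, |f z| ≤ max M 0 := fun z => (hM _ ⟨z, rfl⟩).trans (le_max_left _ _)
    have hM0 : 0 ≤ max M 0 := le_max_right _ _
    generalize max M 0 = M at hfM hM0
    refine Metric.tendsto_atTop'.2 fun e he => ?_
    set δ : ℝ := e / (3 * M + 1) with hδ
    have hδ0 : 0 < δ := by positivity
    obtain ⟨N, hN⟩ := eventually_atTop.1
      (hlim.eventually_lt_const (u := ENNReal.ofReal (δ ^ 2)) (by positivity))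
    refine ⟨N, fun ℓ hℓ => ?_⟩
    obtain ⟨s, hs, e'⟩ := (hstep (ℓ - 1)).1
    rw [Nat.sub_add_cancel (by omega)] at e'
    have h := hN ℓ hℓ.le
    rw [e', hopt.KL_sub_KL hs, ENNReal.ofReal_lt_ofReal_iff (by positivity)] at h
    have hw := hopt.abs_integral_sub_le hs hδ0 hf.measurable hM0 hfM
    rw [e', Real.dist_eq]
    refine hw.trans_lt ?_
    have h1 : δ⁻¹ * (∫ z, phi (s z) ∂K - ∫ z, phi (sopt z) ∂K) ≤ δ := by
      rw [inv_mul_le_iff₀ hδ0]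
      nlinarith
    have h2 : δ * (3 * M + 1) = e := div_mul_cancel₀ _ (by positivity)
    nlinarith [mul_le_mul_of_nonneg_left h1 hM0]
end
end

section
/- (Convergence in the finite three-cell case) Let X and Y be finite sets, μ a probability measure on X assigning positive mass to every point, ν a probability measure on Y assigning positive mass to every point, and {X₁,X₂,X₃} a partition of X with μ(X_i) > 0. With 𝒥_A := {{1,2},{3}}, 𝒥_B := {{1},{2,3}} and the domain decomposition iterates (π^ℓ), the sequence (π^ℓ) converges to the unique minimizer π* of KL(·|K) over Π(μ,ν). -/
open MeasureTheory ENNReal Filter Topology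

noncomputable section

/-! ### The entropic objective on real matrices -/

lemma continuous_phi : Continuous phi :=
  (Real.continuous_mul_log.sub continuous_id).add continuous_const

lemma tangent_le_phi {a b : ℝ} (ha : 0 ≤ a) (hb : 0 < b) :
    phi b + (a - b) * Real.log b ≤ phi a := by
  unfold phi
  rcases ha.eq_or_lt with rfl | ha
  · simp only [zero_mul]; linarith
  · have h := Real.log_le_sub_one_of_pos (div_pos hb ha)
    rw [Real.log_div hb.ne' ha.ne'] at h
    have h2 := mul_le_mul_of_nonneg_left h ha.le
    have h3 : a * (b / a - 1) = b - a := by field_simp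
    nlinarith

lemma phi_nonneg_s19 {a : ℝ} (ha : 0 ≤ a) : 0 ≤ phi a := by
  simpa [phi] using tangent_le_phi ha one_pos

lemma phi_zero : phi 0 = 1 := by simp [phi]

lemma phi_midpoint_lt {a b : ℝ} (ha : 0 ≤ a) (hb : 0 ≤ b) (hab : a ≠ b) :
    phi ((a + b) / 2) < (phi a + phi b) / 2 := by
  have h := Real.strictConvexOn_mul_log.2 (Set.mem_Ici.2 ha) (Set.mem_Ici.2 hb) hab
    (by norm_num : (0 : ℝ) < 1 / 2) (by norm_num : (0 : ℝ) < 1 / 2) (by norm_num)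
  simp only [smul_eq_mul] at h
  have e : 1 / 2 * a + 1 / 2 * b = (a + b) / 2 := by ring
  rw [e] at h
  unfold phi
  linarith

section Matrices

variable {X Y : Type*}

/-- The vanishing of the `2 × 2` minor of `p / K` with rows `x, x'`, for all pairs of columns. -/
def RowsProportional (K p : X → Y → ℝ) (x x' : X) : Prop :=
  ∀ y y', (p x y / K x y) * (p x' y' / K x' y') = (p x y' / K x y') * (p x' y / K x' y)

lemma RowsProportional.symm {K p : X → Y → ℝ} {x x' : X} (h : RowsProportional K p x x') :
    RowsProportional K p x' x := fun y y' => by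
  rw [mul_comm, h y' y, mul_comm]

lemma exists_pos_of_sum_pos {ι : Type*} [Fintype ι] {f : ι → ℝ} (h : 0 < ∑ i, f i) :
    ∃ i, 0 < f i := by
  by_contra! hf
  exact absurd (Finset.sum_nonpos fun i _ => hf i) (not_le.2 h)

lemma RowsProportional.trans [Fintype Y] {K p : X → Y → ℝ} {x x' x'' : X} (hK : ∀ x y, 0 < K x y)
    (h : RowsProportional K p x x') (h' : RowsProportional K p x' x'')
    (hx' : 0 < ∑ y, p x' y) : RowsProportional K p x x'' := by
  intro y y'
  obtain ⟨z, hz⟩ := exists_pos_of_sum_pos hx'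
  have hz' := (div_pos hz (hK x' z)).ne'
  have e1 := h y z
  have e2 := h y' z
  have e3 := h' z y
  have e4 := h' z y'
  apply mul_left_cancel₀ (mul_ne_zero hz' hz')
  linear_combination (p x'' y' / K x'' y') * (p x' z / K x' z) * e1
    - (p x'' y / K x'' y) * (p x' z / K x' z) * e2
    + (p x z / K x z) * (p x' y / K x' y) * e4 - (p x z / K x z) * (p x' y' / K x' y') * e3

variable [Fintype X]

open Classical in
/-- The sum of the entries of column `y` of `p` over the rows in `S`. -/
def cellSum (S : Set X) (p : X → Y → ℝ) (y : Y) : ℝ := ∑ x, if x ∈ S then p x y else 0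

lemma cellSum_add_compl (S : Set X) (p : X → Y → ℝ) (y : Y) :
    cellSum S p y + cellSum Sᶜ p y = ∑ x, p x y := by
  classical
  simp only [cellSum, ← Finset.sum_add_distrib]
  refine Finset.sum_congr rfl fun x _ => ?_
  by_cases h : x ∈ S <;> simp [h]

lemma cellSum_midpoint (S : Set X) (p q : X → Y → ℝ) (y : Y) :
    cellSum S (fun x y => (p x y + q x y) / 2) y = (cellSum S p y + cellSum S q y) / 2 := by
  classical
  simp only [cellSum, ← Finset.sum_add_distrib, Finset.sum_div]
  refine Finset.sum_congr rfl fun x _ => ?_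
  by_cases h : x ∈ S <;> simp [h]

variable [Fintype Y]

/-- The Kullback--Leibler divergence of the matrix `p` with respect to `K`. -/
def entropy (K p : X → Y → ℝ) : ℝ := ∑ x, ∑ y, K x y * phi (p x y / K x y)

/-- Nonnegative matrices with row sums `m` whose partial column sums over `S` and over its
complement agree with those of `p₀`. -/
def Feasible (m : X → ℝ) (S : Set X) (p₀ q : X → Y → ℝ) : Prop :=
  (∀ x y, 0 ≤ q x y) ∧ (∀ x, ∑ y, q x y = m x) ∧
    (∀ y, cellSum S q y = cellSum S p₀ y) ∧ ∀ y, cellSum Sᶜ q y = cellSum Sᶜ p₀ y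

/-- `p` is obtained from `p₀` by solving the cell problems on `S` and on its complement. -/
def IsStep (K : X → Y → ℝ) (m : X → ℝ) (S : Set X) (p₀ p : X → Y → ℝ) : Prop :=
  Feasible m S p₀ p ∧ ∀ q, Feasible m S p₀ q → entropy K p ≤ entropy K q

variable {K : X → Y → ℝ} {m : X → ℝ} {n : Y → ℝ} {S : Set X} {p₀ p : X → Y → ℝ}

lemma continuous_entropy (K : X → Y → ℝ) : Continuous (entropy K) := by
  unfold entropy
  refine continuous_finsetSum _ fun x _ => continuous_finsetSum _ fun y _ => ?_
  exact continuous_const.mul (continuous_phi.comp (by fun_prop))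

lemma entropy_nonneg (hK : ∀ x y, 0 < K x y) (hp : ∀ x y, 0 ≤ p x y) : 0 ≤ entropy K p :=
  Finset.sum_nonneg fun x _ => Finset.sum_nonneg fun y _ =>
    mul_nonneg (hK x y).le (phi_nonneg_s19 (div_nonneg (hp x y) (hK x y).le))

lemma entropy_midpoint_lt (hK : ∀ x y, 0 < K x y) {q : X → Y → ℝ} (hp : ∀ x y, 0 ≤ p x y)
    (hq : ∀ x y, 0 ≤ q x y) (hpq : p ≠ q) :
    entropy K (fun x y => (p x y + q x y) / 2) < (entropy K p + entropy K q) / 2 := by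
  have key : ∀ x y, p x y ≠ q x y → K x y * phi ((p x y + q x y) / 2 / K x y) <
      (K x y * phi (p x y / K x y) + K x y * phi (q x y / K x y)) / 2 := fun x y h => by
    have h1 := phi_midpoint_lt (div_nonneg (hp x y) (hK x y).le)
      (div_nonneg (hq x y) (hK x y).le) (fun e => h ((div_left_inj' (hK x y).ne').1 e))
    have e : (p x y + q x y) / 2 / K x y = (p x y / K x y + q x y / K x y) / 2 := by ring
    rw [e]
    nlinarith [mul_lt_mul_of_pos_left h1 (hK x y)]
  have key' : ∀ x y, K x y * phi ((p x y + q x y) / 2 / K x y) ≤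
      (K x y * phi (p x y / K x y) + K x y * phi (q x y / K x y)) / 2 := fun x y => by
    by_cases h : p x y = q x y
    · rw [h, add_self_div_two, add_self_div_two]
    · exact (key x y h).le
  obtain ⟨x, y, hxy⟩ : ∃ x y, p x y ≠ q x y := by
    by_contra! h
    exact hpq (funext fun x => funext fun y => h x y)
  unfold entropy
  simp only [← Finset.sum_add_distrib, Finset.sum_div]
  exact Finset.sum_lt_sum (fun x _ => Finset.sum_le_sum fun y _ => key' x y)
    ⟨x, Finset.mem_univ _, Finset.sum_lt_sum (fun y _ => key' x y)
      ⟨y, Finset.mem_univ _, key x y hxy⟩⟩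

lemma entropy_add_of_disjoint {q : X → Y → ℝ} (hp : ∀ x ∉ S, ∀ y, p x y = 0)
    (hq : ∀ x ∈ S, ∀ y, q x y = 0) :
    entropy K (fun x y => p x y + q x y) = entropy K p + entropy K q - ∑ x, ∑ y, K x y := by
  unfold entropy
  simp only [← Finset.sum_add_distrib, ← Finset.sum_sub_distrib]
  refine Finset.sum_congr rfl fun x _ => Finset.sum_congr rfl fun y _ => ?_
  by_cases hx : x ∈ S
  · simp [hq x hx, phi_zero]
  · simp [hp x hx, phi_zero]

lemma Feasible.sum_col (h : Feasible m S p₀ p) (y : Y) : ∑ x, p x y = ∑ x, p₀ x y := by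
  rw [← cellSum_add_compl S p, ← cellSum_add_compl S p₀, h.2.2.1, h.2.2.2]

lemma Feasible.midpoint {q : X → Y → ℝ} (hp : Feasible m S p₀ p) (hq : Feasible m S p₀ q) :
    Feasible m S p₀ fun x y => (p x y + q x y) / 2 := by
  refine ⟨fun x y => by linarith [hp.1 x y, hq.1 x y], fun x => ?_, fun y => ?_, fun y => ?_⟩
  · rw [← Finset.sum_div, Finset.sum_add_distrib, hp.2.1, hq.2.1, add_self_div_two]
  · rw [cellSum_midpoint, hp.2.2.1, hq.2.2.1, add_self_div_two]
  · rw [cellSum_midpoint, hp.2.2.2, hq.2.2.2, add_self_div_two]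

/-- First-order optimality: moving mass `t` around the rectangle `{x, x'} × {y, y'}` does not
decrease the entropy. -/
lemma IsStep.mul_le_mul (hK : ∀ x y, 0 < K x y) (h : IsStep K m S p₀ p) {x x' : X}
    (hx : x ∈ S ↔ x' ∈ S) (y y' : Y) :
    (p x y / K x y) * (p x' y' / K x' y') ≤ (p x y' / K x y') * (p x' y / K x' y) := by
  classical
  by_contra! hlt
  obtain ⟨⟨hp0, hrow, hS, hT⟩, hmin⟩ := h
  have hq0 : ∀ x y, 0 ≤ p x y / K x y := fun x y => div_nonneg (hp0 x y) (hK x y).le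
  have hpos := (mul_nonneg (hq0 x y') (hq0 x' y)).trans_lt hlt
  have h1 : 0 < p x y := (hp0 x y).lt_of_ne' fun e => by simp [e] at hpos
  have h2 : 0 < p x' y' := (hp0 x' y').lt_of_ne' fun e => by simp [e] at hpos
  have hxx : x ≠ x' := by rintro rfl; exact absurd hlt (by rw [mul_comm]; exact lt_irrefl _)
  have hyy : y ≠ y' := by rintro rfl; exact absurd hlt (lt_irrefl _)
  let a : X → ℝ := fun z => if z = x then 1 else if z = x' then -1 else 0
  let b : Y → ℝ := fun z => if z = y then -1 else if z = y' then 1 else 0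
  have ax : a x = 1 := by simp [a]
  have ax' : a x' = -1 := by simp [a, hxx.symm]
  have by1 : b y = -1 := by simp [b]
  have by2 : b y' = 1 := by simp [b, hyy.symm]
  have a0 : ∀ z, z ≠ x → z ≠ x' → a z = 0 := fun z h h' => by simp [a, h, h']
  have b0 : ∀ z, z ≠ y → z ≠ y' → b z = 0 := fun z h h' => by simp [b, h, h']
  have sumX : ∀ f : X → ℝ, ∑ z, a z * f z = f x - f x' := fun f => by
    rw [Fintype.sum_eq_add x x' hxx (fun z hz => by rw [a0 z hz.1 hz.2, zero_mul]), ax, ax']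
    ring
  have sumY : ∀ f : Y → ℝ, ∑ z, b z * f z = f y' - f y := fun f => by
    rw [Fintype.sum_eq_add y y' hyy (fun z hz => by rw [b0 z hz.1 hz.2, zero_mul]), by1, by2]
    ring
  let P : ℝ → X → Y → ℝ := fun t u v => p u v + t * (a u * b v)
  have hP0 : P 0 = p := by funext u v; simp [P]
  have hPcont : ∀ u v, Continuous fun t => P t u v := fun u v => by
    simp only [P]; fun_prop
  have hcell : ∀ (t : ℝ) (R : Set X), (x ∈ R ↔ x' ∈ R) → ∀ v, cellSum R (P t) v = cellSum R p v := by
    intro t R hR v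
    have e : ∀ u, (if u ∈ R then P t u v else 0) =
        (if u ∈ R then p u v else 0) + t * b v * (a u * if u ∈ R then 1 else 0) := fun u => by
      by_cases hu : u ∈ R
      · simp only [hu, P, if_true]; ring
      · simp [hu]
    simp only [cellSum, e, Finset.sum_add_distrib, ← Finset.mul_sum]
    rw [sumX]
    simp [hR]
  have hsmall : ∀ᶠ t in 𝓝[>] (0 : ℝ), 0 < t ∧ 0 < P t x y ∧ 0 < P t x' y' := by
    refine (eventually_mem_nhdsWithin.mono fun _ h => h).and
      (((hPcont x y).continuousAt.eventually ?_ ).filter_mono nhdsWithin_le_nhds |>.and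
      (((hPcont x' y').continuousAt.eventually ?_).filter_mono nhdsWithin_le_nhds))
    · exact lt_mem_nhds (by simpa only [hP0] using h1)
    · exact lt_mem_nhds (by simpa only [hP0] using h2)
  have hineq : ∀ᶠ t in 𝓝[>] (0 : ℝ), (P t x y / K x y) * (P t x' y' / K x' y') ≤
      (P t x y' / K x y') * (P t x' y / K x' y) := by
    filter_upwards [hsmall] with t ⟨ht, g1, g2⟩
    have g3 : 0 < P t x y' := by
      have := hp0 x y'; simp only [P, ax, by2]; linarith
    have g4 : 0 < P t x' y := by
      have := hp0 x' y; simp only [P, ax', by1]; linarith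
    have hcase : ∀ u v, a u * b v ≠ 0 → 0 < P t u v := by
      intro u v huv
      by_cases hu : u = x
      · subst hu
        by_cases hv : v = y
        · subst hv; exact g1
        by_cases hv' : v = y'
        · subst hv'; exact g3
        exact absurd (by rw [b0 v hv hv', mul_zero]) huv
      by_cases hu' : u = x'
      · subst hu'
        by_cases hv : v = y
        · subst hv; exact g4
        by_cases hv' : v = y'
        · subst hv'; exact g2
        exact absurd (by rw [b0 v hv hv', mul_zero]) huv
      exact absurd (by rw [a0 u hu hu', zero_mul]) huv
    have hfeas : Feasible m S p₀ (P t) := by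
      refine ⟨fun u v => ?_, fun u => ?_, fun v => ?_, fun v => ?_⟩
      · by_cases huv : a u * b v = 0
        · simp only [P, huv, mul_zero, add_zero]; exact hp0 u v
        · exact (hcase u v huv).le
      · have e := sumY fun _ => 1
        simp only [mul_one, sub_self] at e
        simp only [P, Finset.sum_add_distrib, ← Finset.mul_sum, e, mul_zero, add_zero, hrow]
      · rw [hcell t S hx, hS]
      · rw [hcell t Sᶜ (not_congr hx), hT]
    have hle := hmin _ hfeas
    have hterm : ∀ u v, K u v * phi (P t u v / K u v) -
        t * (a u * (b v * Real.log (P t u v / K u v))) ≤ K u v * phi (p u v / K u v) := by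
      intro u v
      by_cases huv : a u * b v = 0
      · rw [← mul_assoc (a u), huv]; simp [P, huv]
      · have h3 := tangent_le_phi (hq0 u v) (div_pos (hcase u v huv) (hK u v))
        have h4 := mul_le_mul_of_nonneg_left h3 (hK u v).le
        have h5 : K u v * (p u v / K u v - P t u v / K u v) = - (t * (a u * b v)) := by
          have := (hK u v).ne'
          simp only [P]; field_simp; ring
        have h6 : K u v * (phi (P t u v / K u v) +
          (p u v / K u v - P t u v / K u v) * Real.log (P t u v / K u v)) =
            K u v * phi (P t u v / K u v) -
              t * (a u * (b v * Real.log (P t u v / K u v))) := by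
          rw [mul_add, ← mul_assoc, h5]; ring
        rw [← h6]; exact h4
    have hsum : ∑ u, ∑ v, (K u v * phi (P t u v / K u v) -
        t * (a u * (b v * Real.log (P t u v / K u v)))) ≤ entropy K p :=
      Finset.sum_le_sum fun u _ => Finset.sum_le_sum fun v _ => hterm u v
    simp only [Finset.sum_sub_distrib, ← Finset.mul_sum, sumY] at hsum
    rw [sumX] at hsum
    change entropy K (P t) - _ ≤ _ at hsum
    have h7 : 0 ≤ Real.log (P t x y' / K x y') - Real.log (P t x y / K x y) -
        (Real.log (P t x' y' / K x' y') - Real.log (P t x' y / K x' y)) := by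
      by_contra! hneg
      have := mul_neg_of_pos_of_neg ht hneg
      linarith
    have k1 := div_pos g1 (hK x y)
    have k2 := div_pos g2 (hK x' y')
    have k3 := div_pos g3 (hK x y')
    have k4 := div_pos g4 (hK x' y)
    rw [← Real.log_le_log_iff (mul_pos k1 k2) (mul_pos k3 k4), Real.log_mul k1.ne' k2.ne',
      Real.log_mul k3.ne' k4.ne']
    linarith
  have hlim : ∀ u v, Tendsto (fun t => P t u v / K u v) (𝓝[>] 0) (𝓝 (p u v / K u v)) := fun u v => by
    have := ((hPcont u v).div_const (K u v)).tendsto 0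
    rw [hP0] at this
    exact this.mono_left nhdsWithin_le_nhds
  exact absurd (le_of_tendsto_of_tendsto ((hlim x y).mul (hlim x' y'))
    ((hlim x y').mul (hlim x' y)) hineq) (not_le.2 hlt)

lemma IsStep.rowsProportional (hK : ∀ x y, 0 < K x y) (h : IsStep K m S p₀ p) {x x' : X}
    (hx : x ∈ S ↔ x' ∈ S) : RowsProportional K p x x' := fun y y' =>
  (h.mul_le_mul hK hx y y').antisymm (h.mul_le_mul hK hx y' y)

lemma pos_of_rowsProportional (hK : ∀ x y, 0 < K x y) (hp : ∀ x y, 0 ≤ p x y)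
    (hrow : ∀ x, 0 < ∑ y, p x y) (hcol : ∀ y, 0 < ∑ x, p x y)
    (h : ∀ x x', RowsProportional K p x x') (x : X) (y : Y) : 0 < p x y := by
  obtain ⟨y', hy'⟩ := exists_pos_of_sum_pos (hrow x)
  obtain ⟨x', hx'⟩ := exists_pos_of_sum_pos (hcol y)
  refine (hp x y).lt_of_ne' fun e => ?_
  have h1 := h x x' y y'
  rw [e, zero_div, zero_mul] at h1
  exact (mul_pos (div_pos hy' (hK x y')) (div_pos hx' (hK x' y))).ne h1

/-- A diagonal scaling of `K` is determined by its row and column sums. -/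
lemma eq_of_rowsProportional (hK : ∀ x y, 0 < K x y) {q : X → Y → ℝ}
    (hp : ∀ x y, 0 ≤ p x y) (hq : ∀ x y, 0 ≤ q x y)
    (hprow : ∀ x, 0 < ∑ y, p x y) (hpcol : ∀ y, 0 < ∑ x, p x y)
    (hrow : ∀ x, ∑ y, p x y = ∑ y, q x y) (hcol : ∀ y, ∑ x, p x y = ∑ x, q x y)
    (h : ∀ x x', RowsProportional K p x x') (h' : ∀ x x', RowsProportional K q x x') :
    p = q := by
  have pp := pos_of_rowsProportional hK hp hprow hpcol h
  have qp := pos_of_rowsProportional hK hq (fun x => hrow x ▸ hprow x)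
    (fun y => hcol y ▸ hpcol y) h'
  funext x₀ y₀
  let L : (X → Y → ℝ) → X → Y → ℝ := fun r x y => Real.log (r x y / K x y)
  have hL : ∀ r : X → Y → ℝ, (∀ x y, 0 < r x y) → (∀ x x', RowsProportional K r x x') →
      ∀ x y, L r x y = L r x y₀ + (L r x₀ y - L r x₀ y₀) := by
    intro r hr hr' x y
    have hpos : ∀ x y, r x y / K x y ≠ 0 := fun x y => (div_pos (hr x y) (hK x y)).ne'
    have e := congrArg Real.log (hr' x x₀ y y₀)
    rw [Real.log_mul (hpos _ _) (hpos _ _), Real.log_mul (hpos _ _) (hpos _ _)] at e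
    simp only [L]; linarith
  have hzero : ∑ x, ∑ y, (p x y - q x y) * (L p x y - L q x y) = 0 := by
    have e : ∀ x y, (p x y - q x y) * (L p x y - L q x y) =
        (p x y - q x y) * (L p x y₀ - L q x y₀) +
        (p x y - q x y) * (L p x₀ y - L p x₀ y₀ - (L q x₀ y - L q x₀ y₀)) := fun x y => by
      rw [hL p pp h x y, hL q qp h' x y]; ring
    simp only [e, Finset.sum_add_distrib]
    rw [Finset.sum_comm (f := fun x y =>
      (p x y - q x y) * (L p x₀ y - L p x₀ y₀ - (L q x₀ y - L q x₀ y₀)))]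
    simp only [← Finset.sum_mul, Finset.sum_sub_distrib, hrow, hcol, sub_self, zero_mul,
      Finset.sum_const_zero, add_zero]
  have hterm : ∀ x y, 0 ≤ (p x y - q x y) * (L p x y - L q x y) := by
    intro x y
    rcases le_total (p x y) (q x y) with hle | hle
    · refine mul_nonneg_of_nonpos_of_nonpos (sub_nonpos.2 hle) (sub_nonpos.2 ?_)
      exact Real.log_le_log (div_pos (pp x y) (hK x y))
        (div_le_div_of_nonneg_right hle (hK x y).le)
    · refine mul_nonneg (sub_nonneg.2 hle) (sub_nonneg.2 ?_)
      exact Real.log_le_log (div_pos (qp x y) (hK x y))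
        (div_le_div_of_nonneg_right hle (hK x y).le)
  rw [Fintype.sum_eq_zero_iff_of_nonneg fun x => Finset.sum_nonneg fun y _ => hterm x y] at hzero
  have h1 := congrFun hzero x₀
  simp only [Pi.zero_apply] at h1
  rw [Fintype.sum_eq_zero_iff_of_nonneg fun y => hterm x₀ y] at h1
  have h2 := congrFun h1 y₀
  simp only [Pi.zero_apply, mul_eq_zero] at h2
  rcases h2 with h2 | h2
  · linarith
  · have := Real.log_injOn_pos (div_pos (pp x₀ y₀) (hK x₀ y₀)) (div_pos (qp x₀ y₀) (hK x₀ y₀))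
      (sub_eq_zero.1 h2)
    exact (div_left_inj' (hK x₀ y₀).ne').1 this

/-- The domain decomposition iteration with three cells, for matrices. -/
theorem tendsto_of_isStep (hK : ∀ x y, 0 < K x y) (hm : ∀ x, 0 < m x) (hn : ∀ y, 0 < n y)
    {A B : Set X} (hBA : B ⊆ A) (hAB : (A \ B).Nonempty) {p : ℕ → X → Y → ℝ}
    (h0 : ∀ x y, 0 ≤ p 0 x y) (hrow0 : ∀ x, ∑ y, p 0 x y = m x)
    (hcol0 : ∀ y, ∑ x, p 0 x y = n y)
    (hA : ∀ l, Even l → IsStep K m A (p l) (p (l + 1)))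
    (hB : ∀ l, Odd l → IsStep K m B (p l) (p (l + 1)))
    {q : X → Y → ℝ} (hq : ∀ x y, 0 ≤ q x y) (hqrow : ∀ x, ∑ y, q x y = m x)
    (hqcol : ∀ y, ∑ x, q x y = n y) (hqprop : ∀ x x', RowsProportional K q x x') :
    Tendsto p atTop (𝓝 q) := by
  have hstep : ∀ l, ∃ S, IsStep K m S (p l) (p (l + 1)) := fun l =>
    (Nat.even_or_odd l).elim (fun h => ⟨A, hA l h⟩) fun h => ⟨B, hB l h⟩
  have hcpl : ∀ l, (∀ x y, 0 ≤ p l x y) ∧ (∀ x, ∑ y, p l x y = m x) ∧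
      ∀ y, ∑ x, p l x y = n y := by
    intro l
    induction l with
    | zero => exact ⟨h0, hrow0, hcol0⟩
    | succ l ih =>
      obtain ⟨S, hS⟩ := hstep l
      exact ⟨hS.1.1, hS.1.2.1, fun y => by rw [hS.1.sum_col, ih.2.2]⟩
  have hself : ∀ l S, Feasible m S (p l) (p l) := fun l S =>
    ⟨(hcpl l).1, (hcpl l).2.1, fun _ => rfl, fun _ => rfl⟩
  have hanti : Antitone fun l => entropy K (p l) := antitone_nat_of_succ_le fun l => by
    obtain ⟨S, hS⟩ := hstep l
    exact hS.2 _ (hself l S)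
  have hE := tendsto_atTop_ciInf hanti
    ⟨0, by rintro _ ⟨l, rfl⟩; exact entropy_nonneg hK (hcpl l).1⟩
  set E := ⨅ l, entropy K (p l)
  have hmem : ∀ l, p l ∈ Set.Icc (0 : X → Y → ℝ) (fun x _ => m x) := fun l =>
    ⟨fun x y => (hcpl l).1 x y, fun x y => by
      simp only [← (hcpl l).2.1 x]
      exact Finset.single_le_sum (fun y _ => (hcpl l).1 x y) (Finset.mem_univ y)⟩
  refine tendsto_of_subseq_tendsto fun ns hns => ?_
  obtain ⟨⟨a, b⟩, -, φ, hφ, hlim⟩ := (isCompact_Icc.prod isCompact_Icc).tendsto_subseq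
    (x := fun k => (p (ns k), p (ns k + 1))) fun k => ⟨hmem _, hmem _⟩
  have hidx : Tendsto (fun k => ns (φ k)) atTop atTop := hns.comp hφ.tendsto_atTop
  have ha : Tendsto (fun k => p (ns (φ k))) atTop (𝓝 a) := (continuous_fst.tendsto _).comp hlim
  have hb : Tendsto (fun k => p (ns (φ k) + 1)) atTop (𝓝 b) :=
    (continuous_snd.tendsto _).comp hlim
  have coord : ∀ {f : ℕ → X → Y → ℝ} {r : X → Y → ℝ}, Tendsto f atTop (𝓝 r) →
      ∀ x y, Tendsto (fun k => f k x y) atTop (𝓝 (r x y)) := fun h x y =>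
    tendsto_pi_nhds.1 (tendsto_pi_nhds.1 h x) y
  have ha0 : ∀ x y, 0 ≤ a x y := fun x y =>
    ge_of_tendsto' (coord ha x y) fun k => (hcpl _).1 x y
  have hb0 : ∀ x y, 0 ≤ b x y := fun x y =>
    ge_of_tendsto' (coord hb x y) fun k => (hcpl _).1 x y
  have harow : ∀ x, ∑ y, a x y = m x := fun x =>
    tendsto_nhds_unique (tendsto_finsetSum _ fun y _ => coord ha x y)
      (tendsto_const_nhds.congr fun k => ((hcpl _).2.1 x).symm)
  have hacol : ∀ y, ∑ x, a x y = n y := fun y =>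
    tendsto_nhds_unique (tendsto_finsetSum _ fun x _ => coord ha x y)
      (tendsto_const_nhds.congr fun k => ((hcpl _).2.2 y).symm)
  have hEa : entropy K a = E := tendsto_nhds_unique
    (((continuous_entropy K).tendsto a).comp ha) (hE.comp hidx)
  have hEb : entropy K b = E := tendsto_nhds_unique
    (((continuous_entropy K).tendsto b).comp hb)
    (hE.comp ((tendsto_add_atTop_nat 1).comp hidx))
  have hmid : entropy K b ≤ entropy K fun x y => (a x y + b x y) / 2 := by
    refine le_of_tendsto_of_tendsto' (((continuous_entropy K).tendsto b).comp hb)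
      (((continuous_entropy K).tendsto _).comp (tendsto_pi_nhds.2 fun x => tendsto_pi_nhds.2
        fun y => ((coord ha x y).add (coord hb x y)).div_const 2)) fun k => ?_
    obtain ⟨S, hS⟩ := hstep (ns (φ k))
    exact hS.2 _ ((hself _ S).midpoint hS.1)
  have hab : a = b := by
    by_contra hne
    have := entropy_midpoint_lt hK ha0 hb0 hne
    linarith
  subst hab
  have hprop : ∀ x x',
      (∀ l, 1 ≤ l → RowsProportional K (p l) x x' ∨ RowsProportional K (p (l + 1)) x x') →
      RowsProportional K a x x' := by
    intro x x' hor y y'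
    have hmin : ∀ {f : ℕ → X → Y → ℝ}, Tendsto f atTop (𝓝 a) → Tendsto (fun k =>
        (f k x y / K x y) * (f k x' y' / K x' y') - (f k x y' / K x y') * (f k x' y / K x' y))
        atTop (𝓝 ((a x y / K x y) * (a x' y' / K x' y') -
          (a x y' / K x y') * (a x' y / K x' y))) := fun h =>
      (((coord h x y).div_const _).mul ((coord h x' y').div_const _)).sub
        (((coord h x y').div_const _).mul ((coord h x' y).div_const _))
    have h0 := tendsto_nhds_unique ((hmin ha).mul (hmin hb))
      (tendsto_const_nhds.congr' (f₁ := fun _ => (0 : ℝ)) (by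
        filter_upwards [hidx.eventually_ge_atTop 1] with k hk
        rcases hor _ hk with h | h
        · rw [sub_eq_zero.2 (h y y'), zero_mul]
        · rw [sub_eq_zero.2 (h y y'), mul_zero]))
    exact sub_eq_zero.1 (mul_self_eq_zero.1 h0)
  have hpropA : ∀ x x', (x ∈ A ↔ x' ∈ A) → RowsProportional K a x x' := fun x x' hx =>
    hprop x x' fun l hl => by
      rcases Nat.even_or_odd l with h | h
      · exact .inr ((hA l h).rowsProportional hK hx)
      · obtain ⟨k, rfl⟩ := Nat.exists_eq_add_of_le' hl
        exact .inl ((hA k (by grind)).rowsProportional hK hx)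
  have hpropB : ∀ x x', (x ∈ B ↔ x' ∈ B) → RowsProportional K a x x' := fun x x' hx =>
    hprop x x' fun l hl => by
      rcases Nat.even_or_odd l with h | h
      · obtain ⟨k, rfl⟩ := Nat.exists_eq_add_of_le' hl
        exact .inl ((hB k (by grind)).rowsProportional hK hx)
      · exact .inr ((hB l h).rowsProportional hK hx)
  obtain ⟨z, hzA, hzB⟩ := hAB
  have hz : ∀ x, RowsProportional K a x z := fun x => by
    by_cases hx : x ∈ A
    · exact hpropA x z (iff_of_true hx hzA)
    · exact hpropB x z (iff_of_false (fun h => hx (hBA h)) hzB)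
  have haq : a = q := eq_of_rowsProportional hK ha0 hq (fun x => harow x ▸ hm x)
    (fun y => hacol y ▸ hn y) (fun x => by rw [harow, hqrow]) (fun y => by rw [hacol, hqcol])
    (fun x x' => (hz x).trans hK (hz x').symm (harow z ▸ hm z)) hqprop
  exact ⟨φ, haq ▸ ha⟩

end Matrices

/-! ### Measures on finite products as matrices -/

section Measures

variable {X Y : Type*}

open Classical in
/-- The rows of `p` in `S`, extended by zero. -/
def cellPart (S : Set X) (p : X → Y → ℝ) : X → Y → ℝ := fun x y => if x ∈ S then p x y else 0

variable [MeasurableSpace X] [MeasurableSpace Y]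

/-- The matrix of point masses of a measure on `X × Y`. -/
def entries (ρ : Measure (X × Y)) : X → Y → ℝ := fun x y => ρ.real {(x, y)}

lemma isFiniteMeasure_of_mem_coupling {μh : Measure X} {νh : Measure Y} [IsFiniteMeasure μh]
    {ρ : Measure (X × Y)} (h : ρ ∈ Coupling μh νh) : IsFiniteMeasure ρ := by
  have : IsFiniteMeasure (ρ.map Prod.fst) := by rw [h.1]; infer_instance
  exact Measure.isFiniteMeasure_of_map measurable_fst.aemeasurable

lemma entries_nonneg (ρ : Measure (X × Y)) (x : X) (y : Y) : 0 ≤ entries ρ x y :=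
  measureReal_nonneg

lemma entries_add (ρ σ : Measure (X × Y)) [IsFiniteMeasure ρ] [IsFiniteMeasure σ] :
    entries (ρ + σ) = fun x y => entries ρ x y + entries σ x y := by
  funext x y
  exact measureReal_add_apply

variable [Fintype X] [Fintype Y] [MeasurableSingletonClass X] [MeasurableSingletonClass Y]

omit [Fintype X] in
lemma real_map_fst_singleton (ρ : Measure (X × Y)) [IsFiniteMeasure ρ] (x : X) :
    (ρ.map Prod.fst).real {x} = ∑ y, entries ρ x y := by
  classical
  rw [map_measureReal_apply measurable_fst (measurableSet_singleton x)]
  have e : Prod.fst ⁻¹' {x} = (({x} ×ˢ Finset.univ : Finset (X × Y)) : Set (X × Y)) := by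
    ext ⟨u, v⟩; simp [eq_comm]
  rw [e, ← sum_measureReal_singleton, Finset.sum_product]
  simp [entries]

omit [Fintype Y] in
lemma real_map_snd_singleton (ρ : Measure (X × Y)) [IsFiniteMeasure ρ] (y : Y) :
    (ρ.map Prod.snd).real {y} = ∑ x, entries ρ x y := by
  classical
  rw [map_measureReal_apply measurable_snd (measurableSet_singleton y)]
  have e : Prod.snd ⁻¹' {y} = ((Finset.univ ×ˢ {y} : Finset (X × Y)) : Set (X × Y)) := by
    ext ⟨u, v⟩; simp [eq_comm]
  rw [e, ← sum_measureReal_singleton, Finset.sum_product]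
  simp [entries]

lemma ext_real_singleton {Z : Type*} [Countable Z] [MeasurableSpace Z] {ρ σ : Measure Z}
    [IsFiniteMeasure ρ] [IsFiniteMeasure σ] (h : ∀ z, ρ.real {z} = σ.real {z}) : ρ = σ :=
  Measure.ext_of_singleton fun z => (measureReal_eq_measureReal_iff).1 (h z)

lemma mem_coupling_iff {μh : Measure X} {νh : Measure Y} [IsFiniteMeasure μh]
    [IsFiniteMeasure νh] {ρ : Measure (X × Y)} [IsFiniteMeasure ρ] :
    ρ ∈ Coupling μh νh ↔ (∀ x, ∑ y, entries ρ x y = μh.real {x}) ∧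
      ∀ y, ∑ x, entries ρ x y = νh.real {y} := by
  constructor
  · rintro ⟨h1, h2⟩
    exact ⟨fun x => by rw [← real_map_fst_singleton, h1],
      fun y => by rw [← real_map_snd_singleton, h2]⟩
  · rintro ⟨h1, h2⟩
    exact ⟨ext_real_singleton fun x => by rw [real_map_fst_singleton, h1],
      ext_real_singleton fun y => by rw [real_map_snd_singleton, h2]⟩

lemma KL_eq_ofReal_entropy {K ρ : Measure (X × Y)} [IsFiniteMeasure K] [IsFiniteMeasure ρ]
    (hK : ∀ x y, 0 < entries K x y) :
    KL ρ K = ENNReal.ofReal (entropy (entries K) (entries ρ)) := by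
  have hac : ρ ≪ K := by
    refine Measure.AbsolutelyContinuous.mk fun s _ hs => ?_
    have hempty : s = ∅ := by
      refine Set.eq_empty_of_forall_notMem fun z hz => (hK z.1 z.2).ne' ?_
      have := measure_mono_null (Set.singleton_subset_iff.2 hz) hs
      simp [entries, Measure.real, this]
    rw [hempty, measure_empty]
  have hd : ∀ z : X × Y, ((ρ.rnDeriv K) z).toReal = entries ρ z.1 z.2 / entries K z.1 z.2 := by
    intro z
    rw [eq_div_iff (hK z.1 z.2).ne']
    have h := congrArg (fun σ : Measure (X × Y) => σ {z}) (Measure.withDensity_rnDeriv_eq ρ K hac)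
    simp only [withDensity_apply _ (measurableSet_singleton z), lintegral_singleton] at h
    simp only [entries, Measure.real, ← h, ENNReal.toReal_mul]
  have hphi : ∀ x y, 0 ≤ phi (entries ρ x y / entries K x y) := fun x y =>
    phi_nonneg_s19 (div_nonneg (entries_nonneg ρ x y) (entries_nonneg K x y))
  rw [KL, if_pos hac, lintegral_fintype]
  unfold entropy
  rw [← Fintype.sum_prod_type',
    ENNReal.ofReal_sum_of_nonneg fun z _ => mul_nonneg (hK _ _).le (hphi _ _)]
  refine Finset.sum_congr rfl fun z _ => ?_
  rw [hd, ENNReal.ofReal_mul (hK _ _).le, mul_comm]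
  simp [entries]

/-- The measure on `X × Y` with the given matrix of point masses. -/
def matrixMeasure (q : X → Y → ℝ) : Measure (X × Y) :=
  ∑ z : X × Y, ENNReal.ofReal (q z.1 z.2) • Measure.dirac z

instance (q : X → Y → ℝ) : IsFiniteMeasure (matrixMeasure q) := by
  refine ⟨?_⟩
  simp [matrixMeasure, Measure.finsetSum_apply, ENNReal.sum_lt_top]

lemma entries_matrixMeasure {q : X → Y → ℝ} (hq : ∀ x y, 0 ≤ q x y) :
    entries (matrixMeasure q) = q := by
  classical
  funext x y
  simp only [entries, Measure.real, matrixMeasure, Measure.finsetSum_apply, Measure.smul_apply,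
    smul_eq_mul, Measure.dirac_apply]
  rw [Finset.sum_eq_single (x, y)]
  · simp [hq x y]
  · intro z _ hz
    simp [hz]
  · simp

lemma IsOptPlan.entropy_le {K ρ : Measure (X × Y)} [IsFiniteMeasure K]
    (hK : ∀ x y, 0 < entries K x y) {μh : Measure X} {νh : Measure Y} [IsFiniteMeasure μh]
    [IsFiniteMeasure νh] (h : IsOptPlan K μh νh ρ) {q : X → Y → ℝ} (hq : ∀ x y, 0 ≤ q x y)
    (hrow : ∀ x, ∑ y, q x y = μh.real {x}) (hcol : ∀ y, ∑ x, q x y = νh.real {y}) :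
    entropy (entries K) (entries ρ) ≤ entropy (entries K) q := by
  have := isFiniteMeasure_of_mem_coupling h.1
  have hle := h.2 (matrixMeasure q)
    (mem_coupling_iff.2 (by rw [entries_matrixMeasure hq]; exact ⟨hrow, hcol⟩))
  rw [KL_eq_ofReal_entropy hK, KL_eq_ofReal_entropy hK, entries_matrixMeasure hq] at hle
  exact (ENNReal.ofReal_le_ofReal_iff (entropy_nonneg hK hq)).1 hle

omit [Fintype Y] in
lemma real_map_snd_restrict_singleton (ρ : Measure (X × Y)) [IsFiniteMeasure ρ] (S : Set X)
    (y : Y) : ((ρ.restrict (S ×ˢ Set.univ)).map Prod.snd).real {y} = cellSum S (entries ρ) y := by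
  classical
  rw [real_map_snd_singleton]
  refine Finset.sum_congr rfl fun x _ => ?_
  rw [entries, measureReal_restrict_apply (measurableSet_singleton _)]
  by_cases hx : x ∈ S
  · rw [if_pos hx, Set.inter_eq_left.2 (by simpa using hx)]; rfl
  · rw [if_neg hx, Set.singleton_inter_eq_empty.2 (by simpa using hx), measureReal_empty]

omit [Fintype X] in
lemma IsOptPlan.sum_row {K ρ : Measure (X × Y)} {μ : Measure X} {νh : Measure Y} {S : Set X}
    [IsFiniteMeasure μ] (h : IsOptPlan K (μ.restrict S) νh ρ) (x : X) [Decidable (x ∈ S)] :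
    ∑ y, entries ρ x y = if x ∈ S then μ.real {x} else 0 := by
  have := isFiniteMeasure_of_mem_coupling h.1
  rw [← real_map_fst_singleton, h.1.1, measureReal_restrict_apply (measurableSet_singleton _)]
  split_ifs with hx
  · rw [Set.inter_eq_left.2 (by simpa using hx)]
  · rw [Set.singleton_inter_eq_empty.2 hx, measureReal_empty]

omit [Fintype X] in
lemma IsOptPlan.entries_eq_zero {K ρ : Measure (X × Y)} {μ : Measure X} {νh : Measure Y}
    {S : Set X} [IsFiniteMeasure μ] (h : IsOptPlan K (μ.restrict S) νh ρ) {x : X} (hx : x ∉ S)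
    (y : Y) : entries ρ x y = 0 := by
  classical
  have e := h.sum_row x
  rw [if_neg hx, Fintype.sum_eq_zero_iff_of_nonneg fun y => entries_nonneg ρ x y] at e
  exact congrFun e y

lemma IsOptPlan.cell {K ρ σ : Measure (X × Y)} [IsFiniteMeasure K]
    (hK : ∀ x y, 0 < entries K x y) {μ : Measure X} [IsFiniteMeasure μ] [IsFiniteMeasure ρ]
    {S : Set X}
    (h : IsOptPlan K (μ.restrict S) ((ρ.restrict (S ×ˢ Set.univ)).map Prod.snd) σ) :
    (∀ y, ∑ x, entries σ x y = cellSum S (entries ρ) y) ∧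
    ∀ q : X → Y → ℝ, (∀ x y, 0 ≤ q x y) → (∀ x, ∑ y, q x y = μ.real {x}) →
      (∀ y, cellSum S q y = cellSum S (entries ρ) y) →
      entropy (entries K) (entries σ) ≤ entropy (entries K) (cellPart S q) := by
  classical
  have := isFiniteMeasure_of_mem_coupling h.1
  refine ⟨fun y => ?_, fun q hq hrow hcol => h.entropy_le hK (fun x y => ?_) (fun x => ?_)
    fun y => ?_⟩
  · rw [← real_map_snd_singleton, h.1.2, real_map_snd_restrict_singleton]
  · unfold cellPart
    split_ifs
    exacts [hq x y, le_rfl]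
  · rw [← h.1.1, real_map_fst_singleton, h.sum_row x]
    unfold cellPart
    split_ifs
    exacts [hrow x, by simp]
  · rw [real_map_snd_restrict_singleton, ← hcol y]
    rfl

lemma isStep_of_isOptPlan {K ρ ρa ρb : Measure (X × Y)} [IsFiniteMeasure K]
    (hK : ∀ x y, 0 < entries K x y) {μ : Measure X} [IsFiniteMeasure μ] [IsFiniteMeasure ρ]
    {S : Set X}
    (ha : IsOptPlan K (μ.restrict S) ((ρ.restrict (S ×ˢ Set.univ)).map Prod.snd) ρa)
    (hb : IsOptPlan K (μ.restrict Sᶜ) ((ρ.restrict (Sᶜ ×ˢ Set.univ)).map Prod.snd) ρb) :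
    IsStep (entries K) (fun x => μ.real {x}) S (entries ρ) (entries (ρa + ρb)) := by
  classical
  have := isFiniteMeasure_of_mem_coupling ha.1
  have := isFiniteMeasure_of_mem_coupling hb.1
  have za : ∀ x ∉ S, ∀ y, entries ρa x y = 0 := fun x hx y => ha.entries_eq_zero hx y
  have zb : ∀ x ∈ S, ∀ y, entries ρb x y = 0 := fun x hx y =>
    hb.entries_eq_zero (not_not.2 hx) y
  refine ⟨⟨entries_nonneg _, fun x => ?_, fun y => ?_, fun y => ?_⟩, fun q hq => ?_⟩
  · rw [entries_add, Finset.sum_add_distrib, ha.sum_row x, hb.sum_row x]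
    by_cases hx : x ∈ S <;> simp [hx]
  · rw [← (ha.cell hK).1 y, entries_add]
    refine Finset.sum_congr rfl fun x _ => ?_
    by_cases hx : x ∈ S
    · simp [hx, zb x hx]
    · simp [hx, za x hx]
  · rw [← (hb.cell hK).1 y, entries_add]
    refine Finset.sum_congr rfl fun x _ => ?_
    by_cases hx : x ∈ S
    · simp [hx, zb x hx]
    · simp [hx, za x hx]
  · have e : q = fun x y => cellPart S q x y + cellPart Sᶜ q x y := by
      funext x y
      by_cases hx : x ∈ S <;> simp [cellPart, hx]
    rw [e, entries_add, entropy_add_of_disjoint za zb,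
      entropy_add_of_disjoint (S := S) (fun x hx y => by simp [cellPart, hx])
        fun x hx y => by simp [cellPart, hx]]
    linarith [(ha.cell hK).2 q hq.1 hq.2.1 hq.2.2.1, (hb.cell hK).2 q hq.1 hq.2.1 hq.2.2.2]

lemma IsOptPlan.rowsProportional {K ρ : Measure (X × Y)} [IsFiniteMeasure K]
    (hK : ∀ x y, 0 < entries K x y) {μh : Measure X} {νh : Measure Y} [IsFiniteMeasure μh]
    [IsFiniteMeasure νh] (h : IsOptPlan K μh νh ρ) (x x' : X) :
    RowsProportional (entries K) (entries ρ) x x' := by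
  have := isFiniteMeasure_of_mem_coupling h.1
  obtain ⟨hrow, hcol⟩ := mem_coupling_iff.1 h.1
  have hstep : IsStep (entries K) (fun x => μh.real {x}) Set.univ (entries ρ) (entries ρ) :=
    ⟨⟨entries_nonneg ρ, hrow, fun _ => rfl, fun _ => rfl⟩, fun q hq =>
      h.entropy_le hK hq.1 hq.2.1 fun y => by rw [hq.sum_col, hcol]⟩
  exact hstep.rowsProportional hK (by simp)

lemma tendsto_measure_of_entries {ρ : ℕ → Measure (X × Y)} {σ : Measure (X × Y)}
    [∀ l, IsFiniteMeasure (ρ l)] [IsFiniteMeasure σ]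
    (h : Tendsto (fun l => entries (ρ l)) atTop (𝓝 (entries σ))) (s : Set (X × Y)) :
    Tendsto (fun l => ρ l s) atTop (𝓝 (σ s)) := by
  classical
  have e : ∀ τ : Measure (X × Y), τ s = ∑ z ∈ s.toFinset, τ {z} := fun τ => by
    rw [sum_measure_singleton, Set.coe_toFinset]
  simp only [e]
  refine tendsto_finsetSum _ fun z _ => ?_
  have hz := ENNReal.tendsto_ofReal (tendsto_pi_nhds.1 (tendsto_pi_nhds.1 h z.1) z.2)
  simpa [entries] using hz

omit [Fintype X] in
lemma entries_Kmeas_pos {μ : Measure X} {ν : Measure Y} [IsFiniteMeasure μ] [IsFiniteMeasure ν]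
    (hμ : ∀ x, 0 < μ {x}) (hν : ∀ y, 0 < ν {y}) (c : X × Y → ℝ) (ε : ℝ) (x : X) (y : Y) :
    0 < entries (Kmeas μ ν c ε) x y := by
  rw [entries, Measure.real, Kmeas, withDensity_apply _ (measurableSet_singleton _),
    lintegral_singleton, ← Set.singleton_prod_singleton, Measure.prod_prod]
  refine ENNReal.toReal_pos ?_ ?_
  · simp [(hμ x).ne', (hν y).ne', Real.exp_pos]
  · finiteness

lemma isFiniteMeasure_Kmeas (μ : Measure X) (ν : Measure Y) [IsFiniteMeasure μ]
    [IsFiniteMeasure ν] (c : X × Y → ℝ) (ε : ℝ) : IsFiniteMeasure (Kmeas μ ν c ε) := by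
  refine isFiniteMeasure_withDensity ?_
  rw [lintegral_fintype]
  exact ENNReal.sum_ne_top.2 fun z _ => by finiteness

end Measures

/-- Proposition 3.2, convergence in the finite three-cell case:
for finite `X`, `Y` with everywhere-positive marginals `μ`, `ν`, the three-cell
domain decomposition iterates converge to the unique minimizer `π*` of
`KL(⋅|K)` over `Π(μ,ν)`. -/
theorem finite_three_cell_convergence
    {X Y : Type*} [Fintype X] [Fintype Y] [MeasurableSpace X] [MeasurableSpace Y]
    [MeasurableSingletonClass X] [MeasurableSingletonClass Y]
    (μ : Measure X) (ν : Measure Y) [IsProbabilityMeasure μ] [IsProbabilityMeasure ν]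
    (hμpos : ∀ x : X, 0 < μ {x}) (hνpos : ∀ y : Y, 0 < ν {y})
    (c : X × Y → ℝ) (hc0 : ∀ p, 0 ≤ c p)
    (ε : ℝ) (hε : 0 < ε)
    (X1 X2 X3 : Set X)
    (hd12 : Disjoint X1 X2) (hd13 : Disjoint X1 X3) (hd23 : Disjoint X2 X3)
    (hcov : X1 ∪ X2 ∪ X3 = Set.univ)
    (hp1 : 0 < μ X1) (hp2 : 0 < μ X2) (hp3 : 0 < μ X3)
    (πopt : Measure (X × Y)) (hπopt : πopt ∈ Coupling μ ν)
    (hmin : ∀ π' ∈ Coupling μ ν, KL πopt (Kmeas μ ν c ε) ≤ KL π' (Kmeas μ ν c ε))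
    (π : ℕ → Measure (X × Y)) (hπ0 : π 0 ∈ Coupling μ ν)
    (hstepA : ∀ ℓ : ℕ, 1 ≤ ℓ → Odd ℓ → ∃ πa πb : Measure (X × Y),
      π ℓ = πa + πb ∧
      IsOptPlan (Kmeas μ ν c ε) (μ.restrict (X1 ∪ X2))
        (((π (ℓ - 1)).restrict ((X1 ∪ X2) ×ˢ Set.univ)).map Prod.snd) πa ∧
      IsOptPlan (Kmeas μ ν c ε) (μ.restrict X3)
        (((π (ℓ - 1)).restrict (X3 ×ˢ Set.univ)).map Prod.snd) πb)
    (hstepB : ∀ ℓ : ℕ, 1 ≤ ℓ → Even ℓ → ∃ πa πb : Measure (X × Y),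
      π ℓ = πa + πb ∧
      IsOptPlan (Kmeas μ ν c ε) (μ.restrict X1)
        (((π (ℓ - 1)).restrict (X1 ×ˢ Set.univ)).map Prod.snd) πa ∧
      IsOptPlan (Kmeas μ ν c ε) (μ.restrict (X2 ∪ X3))
        (((π (ℓ - 1)).restrict ((X2 ∪ X3) ×ˢ Set.univ)).map Prod.snd) πb) :
    ∀ s : Set (X × Y), Tendsto (fun ℓ => π ℓ s) atTop (𝓝 (πopt s)) := by
  have : IsFiniteMeasure (Kmeas μ ν c ε) := isFiniteMeasure_Kmeas μ ν c ε
  have hK := entries_Kmeas_pos hμpos hνpos c ε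
  have hX3 : X3 = (X1 ∪ X2)ᶜ := by
    refine (IsCompl.compl_eq ⟨?_, ?_⟩).symm
    · exact Set.disjoint_union_left.2 ⟨hd13, hd23⟩
    · exact codisjoint_iff.2 hcov
  have hX23 : X2 ∪ X3 = X1ᶜ := by
    refine (IsCompl.compl_eq ⟨?_, ?_⟩).symm
    · exact Set.disjoint_union_right.2 ⟨hd12, hd13⟩
    · exact codisjoint_iff.2 ((Set.union_assoc X1 X2 X3).symm.trans hcov)
  have hfin : ∀ l, IsFiniteMeasure (π l) := by
    rintro (_ | l)
    · exact isFiniteMeasure_of_mem_coupling hπ0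
    · obtain ⟨πa, πb, h, ha, hb⟩ | ⟨πa, πb, h, ha, hb⟩ := (Nat.even_or_odd (l + 1)).symm.imp
        (hstepA (l + 1) l.succ_pos) (hstepB (l + 1) l.succ_pos)
      all_goals
        have := isFiniteMeasure_of_mem_coupling ha.1
        have := isFiniteMeasure_of_mem_coupling hb.1
        rw [h]
        infer_instance
  have := isFiniteMeasure_of_mem_coupling hπopt
  obtain ⟨hrow0, hcol0⟩ := mem_coupling_iff.1 hπ0
  obtain ⟨hrow, hcol⟩ := mem_coupling_iff.1 hπopt
  have hX2 : ((X1 ∪ X2) \ X1).Nonempty := by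
    rw [Set.union_sdiff_cancel_left hd12.le_bot]
    exact nonempty_of_measure_ne_zero hp2.ne'
  refine tendsto_measure_of_entries (tendsto_of_isStep hK
    (fun x => ENNReal.toReal_pos (hμpos x).ne' (measure_ne_top _ _))
    (fun y => ENNReal.toReal_pos (hνpos y).ne' (measure_ne_top _ _))
    Set.subset_union_left hX2 (entries_nonneg _) hrow0 hcol0 (fun l hl => ?_) (fun l hl => ?_)
    (entries_nonneg _) hrow hcol (IsOptPlan.rowsProportional hK ⟨hπopt, hmin⟩))
  · obtain ⟨πa, πb, h, ha, hb⟩ := hstepA (l + 1) l.succ_pos hl.add_one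
    rw [hX3] at hb
    rw [h]
    exact isStep_of_isOptPlan hK ha hb
  · obtain ⟨πa, πb, h, ha, hb⟩ := hstepB (l + 1) l.succ_pos hl.add_one
    rw [hX23] at hb
    rw [h]
    exact isStep_of_isOptPlan hK ha hb
end
end
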